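/- Let n≥2, 1≤d<n, θ∈ℝ^n, U⊂ℝ^d be open, f:U→ℝ^n be nonsingular and nondegenerate in U, m=n−d, l∈ℕ, and α = 1/(d(2l−1)(n+1)). Let ψ:(0,∞)→(0,1) be non-increasing and s>0. Suppose that H^s({x∈U : f is not l-nondegenerate at x}) = 0, that Σ_{q≥1} q^n (ψ(q)/q)^{s+m} < ∞, and that Σ_{t≥1} (ψ(e^t)/e^t)^{(s−d)/2} (ψ(e^t)^{n−1/2} e^{3t/2})^{−α} < ∞. Then H^s(f^{-1}(S_n^θ(ψ))) = 0, where H^s is s-dimensional Hausdorff measure. -/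

import Mathlib

open MeasureTheory Filter Set
open scoped ENNReal NNReal

noncomputable section

/-- The set `S_n^θ(ψ)` of `(ψ,θ)`-approximable points of `ℝ^n` (sup norm on `Fin n → ℝ`):
points `x` with `‖x - (p+θ)/q‖ ≤ ψ q / q` for infinitely many `(p,q) ∈ ℤ^n × ℕ`. -/
def SApprox (n : ℕ) (θ : Fin n → ℝ) (ψ : ℝ → ℝ) : Set (Fin n → ℝ) :=
  {x | {pq : (Fin n → ℤ) × ℕ | 0 < pq.2 ∧
    ‖(fun i => x i - ((pq.1 i : ℝ) + θ i) / (pq.2 : ℝ) : Fin n → ℝ)‖ ≤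
      ψ (pq.2 : ℝ) / (pq.2 : ℝ)}.Infinite}

/-- Iterated partial derivatives along a list of coordinate directions. -/
def listPDeriv {d n : ℕ} : List (Fin d) → ((Fin d → ℝ) → (Fin n → ℝ)) → ((Fin d → ℝ) → (Fin n → ℝ))
  | [], f => f
  | i :: is, f => fun x => fderiv ℝ (listPDeriv is f) x (Pi.single i 1)

/-- `f` is `l`-nondegenerate at `x`: `f` is `C^l` near `x` and the partial derivatives of `f`
at `x` of orders `1,…,l` span `ℝ^n`. -/
def IsLNondegenerateAt {d n : ℕ} (l : ℕ) (f : (Fin d → ℝ) → (Fin n → ℝ)) (x : Fin d → ℝ) : Prop :=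
  (∃ V ∈ nhds x, ContDiffOn ℝ l f V) ∧
  Submodule.span ℝ {v : Fin n → ℝ | ∃ β : List (Fin d),
    1 ≤ β.length ∧ β.length ≤ l ∧ v = listPDeriv β f x} = ⊤

def IsNondegenerateAt {d n : ℕ} (f : (Fin d → ℝ) → (Fin n → ℝ)) (x : Fin d → ℝ) : Prop :=
  ∃ l : ℕ, IsLNondegenerateAt l f x

/-- `f` is nondegenerate in `U`: nondegenerate at almost every point of `U`. -/
def IsNondegenerateIn {d n : ℕ} (f : (Fin d → ℝ) → (Fin n → ℝ)) (U : Set (Fin d → ℝ)) : Prop :=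
  ∀ᵐ x ∂(volume : Measure (Fin d → ℝ)), x ∈ U → IsNondegenerateAt f x

/-- `f` is nonsingular on `U`: its Jacobian has rank `d` at every point of `U`. -/
def IsNonsingularOn {d n : ℕ} (f : (Fin d → ℝ) → (Fin n → ℝ)) (U : Set (Fin d → ℝ)) : Prop :=
  ∀ x ∈ U, LinearMap.rank (fderiv ℝ f x).toLinearMap = (d : Cardinal)

/-- `η(n,d)`. -/
def etaND (n d : ℕ) : ℝ := if 1 < d then 1 / ((n : ℝ) - 1) else 3 / (2 * (n : ℝ) - 1)

/-- The set counted by `N*_θ(Δ;ε,t)`. -/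
def NstarSet {d n : ℕ} (f : (Fin d → ℝ) → Fin n → ℝ) (θ : Fin n → ℝ)
    (Δ : Set (Fin d → ℝ)) (ε t : ℝ) : Set ((Fin n → ℤ) × ℤ) :=
  {pq | Real.exp (t - 1) ≤ (pq.2 : ℝ) ∧ (pq.2 : ℝ) ≤ Real.exp t ∧
    sInf ((fun x => ‖(fun i => f x i - ((pq.1 i : ℝ) + θ i) / (pq.2 : ℝ) : Fin n → ℝ)‖) '' Δ)
      ≤ ε / Real.exp t}

/-- `N*_θ(Δ;ε,t)`. -/
def Nstar {d n : ℕ} (f : (Fin d → ℝ) → Fin n → ℝ) (θ : Fin n → ℝ)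
    (Δ : Set (Fin d → ℝ)) (ε t : ℝ) : ℕ := (NstarSet f θ Δ ε t).ncard

/-- The set counted by `N_θ(Δ;ε,t)` (with `1 ≤ q ≤ e^t`). -/
def NfullSet {d n : ℕ} (f : (Fin d → ℝ) → Fin n → ℝ) (θ : Fin n → ℝ)
    (Δ : Set (Fin d → ℝ)) (ε t : ℝ) : Set ((Fin n → ℤ) × ℤ) :=
  {pq | 1 ≤ pq.2 ∧ (pq.2 : ℝ) ≤ Real.exp t ∧
    sInf ((fun x => ‖(fun i => f x i - ((pq.1 i : ℝ) + θ i) / (pq.2 : ℝ) : Fin n → ℝ)‖) '' Δ)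
      ≤ ε / Real.exp t}

/-- `N_θ(Δ;ε,t)`. -/
def Nfull {d n : ℕ} (f : (Fin d → ℝ) → Fin n → ℝ) (θ : Fin n → ℝ)
    (Δ : Set (Fin d → ℝ)) (ε t : ℝ) : ℕ := (NfullSet f θ Δ ε t).ncard

/-- Sup norm of the gradient of a scalar function on `ℝ^d`. -/
def gradSupNorm {d : ℕ} (g : (Fin d → ℝ) → ℝ) (x : Fin d → ℝ) : ℝ :=
  ‖(fun j : Fin d => fderiv ℝ g x (Pi.single j 1) : Fin d → ℝ)‖

/-- The set `𝔖_f(δ,K,T)`. -/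
def SfrakSet {d n : ℕ} (U : Set (Fin d → ℝ)) (f : (Fin d → ℝ) → Fin n → ℝ)
    (δ K : ℝ) (T : Fin n → ℝ) : Set (Fin d → ℝ) :=
  {x | x ∈ U ∧ ∃ a₀ : ℤ, ∃ a : Fin n → ℤ, a ≠ 0 ∧
    |(a₀ : ℝ) + ∑ i, f x i * (a i : ℝ)| < δ ∧
    gradSupNorm (fun y => ∑ i, f y i * (a i : ℝ)) x < K ∧
    ∀ i, |(a i : ℝ)| < T i}

/-- First-order partial derivative `∂_i f_j` (0-based indices as naturals; junk value 0
out of range). -/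
def pd1 {d m : ℕ} (f : (Fin d → ℝ) → Fin m → ℝ) (i j : ℕ) (x : Fin d → ℝ) : ℝ :=
  if h : i < d ∧ j < m then
    fderiv ℝ (fun y => f y ⟨j, h.2⟩) x (Pi.single (⟨i, h.1⟩ : Fin d) 1)
  else 0

/-- Second-order partial derivative `∂_{i'} ∂_i f_j`. -/
def pd2 {d m : ℕ} (f : (Fin d → ℝ) → Fin m → ℝ) (i i' j : ℕ) (x : Fin d → ℝ) : ℝ :=
  if h : i' < d then fderiv ℝ (fun y => pd1 f i j y) x (Pi.single (⟨i', h⟩ : Fin d) 1) else 0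

/-- The Monge map `x ↦ (x, f(x)) : ℝ^d → ℝ^{d+m}`. -/
def fullMap (d m : ℕ) (f : (Fin d → ℝ) → Fin m → ℝ) : (Fin d → ℝ) → Fin (d + m) → ℝ :=
  fun x i => if h : (i : ℕ) < d then x ⟨(i : ℕ), h⟩
    else f x ⟨(i : ℕ) - d, by have := i.isLt; omega⟩

/-- The `i`-th Minkowski successive minimum (w.r.t. the closed unit Euclidean ball) of the
lattice `g ℤ^k`. -/
def succMin {k : ℕ} (i : ℕ) (g : Matrix (Fin k) (Fin k) ℝ) : ℝ :=
  sInf {r : ℝ | 0 ≤ r ∧ i ≤ Module.finrank ℝ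
    (Submodule.span ℝ {w : Fin k → ℝ | (∃ v : Fin k → ℤ, v ≠ 0 ∧
      w = g.mulVec (fun j => (v j : ℝ))) ∧ Real.sqrt (∑ j, w j ^ 2) ≤ r})}

/-- The unipotent matrix `u₁(x) ∈ SL_{n+1}(ℝ)`, `n = d+m`. -/
def u1Mat {d m : ℕ} (f : (Fin d → ℝ) → Fin m → ℝ) (x : Fin d → ℝ) :
    Matrix (Fin (d + m + 1)) (Fin (d + m + 1)) ℝ := fun r c =>
  if (r : ℕ) = (c : ℕ) then 1
  else if (r : ℕ) < m ∧ m ≤ (c : ℕ) ∧ (c : ℕ) < d + m then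
    - pd1 f (d + m - 1 - (c : ℕ)) (m - 1 - (r : ℕ)) x
  else if (r : ℕ) < m ∧ (c : ℕ) = d + m then
    (if h : m - 1 - (r : ℕ) < m then f x ⟨m - 1 - (r : ℕ), h⟩ else 0)
      - ∑ i : Fin d, x i * pd1 f (i : ℕ) (m - 1 - (r : ℕ)) x
  else if m ≤ (r : ℕ) ∧ (r : ℕ) < d + m ∧ (c : ℕ) = d + m then
    (if h : d + m - 1 - (r : ℕ) < d then x ⟨d + m - 1 - (r : ℕ), h⟩ else 0)
  else 0

/-- The inverse `a_{ε,t,v}⁻¹` of the diagonal matrix `a_{ε,t,v}`. -/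
def aInvMat (d m : ℕ) (ε t v : ℝ) : Matrix (Fin (d + m + 1)) (Fin (d + m + 1)) ℝ :=
  Matrix.diagonal (fun i => v * (if (i : ℕ) < m then ε⁻¹
    else if (i : ℕ) < d + m then (ε ^ m * Real.exp t) ^ ((1 : ℝ) / d)
    else (v ^ (d + m + 1) * Real.exp t)⁻¹))

/-- The set `𝔊(v,t,ε)`. -/
def Gfrak {d m : ℕ} (U : Set (Fin d → ℝ)) (f : (Fin d → ℝ) → Fin m → ℝ)
    (v t ε : ℝ) : Set (Fin d → ℝ) :=
  {x | x ∈ U ∧ v ≤ succMin 1 (aInvMat d m ε t v * u1Mat f x)}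

/-- The set `𝒩_θ(t,ε,B)`. -/
def NCal {d m : ℕ} (f : (Fin d → ℝ) → Fin m → ℝ) (θ : Fin (d + m) → ℝ)
    (t : ℕ) (ε : ℝ) (B : Set (Fin d → ℝ)) : Set (ℕ × (Fin d → ℤ) × (Fin m → ℤ)) :=
  {q | 0 < q.1 ∧
    (fun i => ((q.2.1 i : ℝ) + θ (Fin.castAdd m i)) / (q.1 : ℝ)) ∈ B ∧
    Real.exp ((t : ℝ) - 1) ≤ (q.1 : ℝ) ∧ (q.1 : ℝ) ≤ Real.exp t ∧
    ‖(fun j => (q.1 : ℝ) * f (fun i => ((q.2.1 i : ℝ) + θ (Fin.castAdd m i)) / (q.1 : ℝ)) j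
        - θ (Fin.natAdd d j) - (q.2.2 j : ℝ) : Fin m → ℝ)‖ ≤ ε}

/-- The set `Δ_θ(t,ε,B,ρ)`. -/
def DeltaCal {d m : ℕ} (f : (Fin d → ℝ) → Fin m → ℝ) (θ : Fin (d + m) → ℝ)
    (t : ℕ) (ε : ℝ) (B : Set (Fin d → ℝ)) (ρ : ℝ) : Set (Fin d → ℝ) :=
  ⋃ q ∈ NCal f θ t ε B,
    Metric.ball (fun i => ((q.2.1 i : ℝ) + θ (Fin.castAdd m i)) / (q.1 : ℝ)) ρ

/-- `φ = (ε^n e^t)^{1/(n+1)}`, `n = d+m`. -/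
def phiC (d m : ℕ) (ε t : ℝ) : ℝ := (ε ^ (d + m) * Real.exp t) ^ ((1 : ℝ) / (d + m + 1))

/-- `h = dt/(2(n+1))`. -/
def hC (d m : ℕ) (t : ℝ) : ℝ := (d : ℝ) * t / (2 * ((d : ℝ) + m + 1))

def gMat (d m : ℕ) (ε t : ℝ) : Matrix (Fin (d + m + 1)) (Fin (d + m + 1)) ℝ :=
  Matrix.diagonal (fun i => phiC d m ε t *
    (if (i : ℕ) < d + m then ε⁻¹ else Real.exp (-t)))

def bMat (d m : ℕ) (t : ℝ) : Matrix (Fin (d + m + 1)) (Fin (d + m + 1)) ℝ :=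
  Matrix.diagonal (fun i => if (i : ℕ) < m then Real.exp (hC d m t)
    else if (i : ℕ) < d + m then Real.exp (-(((m : ℝ) + 1) * t) / (2 * ((d : ℝ) + m + 1)))
    else Real.exp (hC d m t))

def dMat (d m : ℕ) (ε : ℝ) : Matrix (Fin (d + m + 1)) (Fin (d + m + 1)) ℝ :=
  Matrix.diagonal (fun i => if (i : ℕ) < m then 1
    else if (i : ℕ) < d + m then Real.sqrt ε else 1)

/-- The raw nongeneric set `𝔐₀(ε,t)`. -/
def M0frak {d m : ℕ} (U : Set (Fin d → ℝ)) (f : (Fin d → ℝ) → Fin m → ℝ)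
    (ε t : ℝ) : Set (Fin d → ℝ) :=
  {x | x ∈ U ∧ phiC d m ε t * Real.exp (hC d m t) <
    succMin (d + m + 1) (dMat d m ε * bMat d m t * gMat d m ε t * u1Mat f x)}

/-- The nongeneric (special) set `𝔐(ε,t)`. -/
def Mfrak {d m : ℕ} (U : Set (Fin d → ℝ)) (f : (Fin d → ℝ) → Fin m → ℝ)
    (ε t : ℝ) : Set (Fin d → ℝ) :=
  (⋃ x ∈ M0frak U f ε t, Metric.ball x (Real.sqrt ε * Real.exp (-t / 2))) ∩ U

/-- The inhomogeneous Diophantine exponent `λ_n^θ(x)` of `(x,x²,…,x^n)`, as a value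
in `[0,∞]`. -/
def lambdaN (n : ℕ) (θ : Fin n → ℝ) (x : ℝ) : ℝ≥0∞ :=
  sSup {lam : ℝ≥0∞ | ∃ τ : ℝ, lam = ENNReal.ofReal τ ∧
    (fun i : Fin n => x ^ ((i : ℕ) + 1)) ∈ SApprox n θ (fun q => q ^ (-τ))}

end

section Helpers
open scoped Topology

theorem exists_sep_or_small (A : Set ℝ) (s : ℝ) (hs : 0 < s) (k : ℕ) :
    (∃ F : Finset ℝ, F.card = k + 1 ∧ ↑F ⊆ A ∧ ∀ x ∈ F, ∀ y ∈ F, x ≠ y → s ≤ |x - y|) ∨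
    volume A ≤ ENNReal.ofReal (k * (2 * s)) := by
  induction k with
  | zero =>
    rcases A.eq_empty_or_nonempty with h | ⟨x, hx⟩
    · right; simp [h]
    · left; exact ⟨{x}, by simp, by simpa using hx, by simp⟩
  | succ k ih =>
    rcases ih with ⟨F, hc, hF, hsep⟩ | h
    · by_cases hy : ∃ y ∈ A, ∀ x ∈ F, s ≤ |x - y|
      · obtain ⟨y, hyA, hy⟩ := hy
        have hyF : y ∉ F := fun h => by have := hy y h; simp at this; linarith
        left
        refine ⟨insert y F, by simp [hyF, hc], ?_, ?_⟩
        · simp [insert_subset_iff, hyA, hF]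
        · intro a ha b hb hab
          simp only [Finset.mem_insert] at ha hb
          rcases ha with rfl | ha <;> rcases hb with rfl | hb
          · exact absurd rfl hab
          · rw [abs_sub_comm]; exact hy b hb
          · exact hy a ha
          · exact hsep a ha b hb hab
      · right
        push Not at hy
        have hsub : A ⊆ ⋃ x ∈ F, Metric.ball x s := by
          intro y hyA
          obtain ⟨x, hx, hxy⟩ := hy y hyA
          simp only [mem_iUnion]
          exact ⟨x, hx, by rw [Metric.mem_ball, dist_comm, Real.dist_eq]; exact hxy⟩
        calc volume A ≤ volume (⋃ x ∈ F, Metric.ball x s) := measure_mono hsub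
          _ ≤ ∑ x ∈ F, volume (Metric.ball x s) := measure_biUnion_finset_le _ _
          _ = ENNReal.ofReal ((k + 1 : ℕ) * (2 * s)) := by
            simp only [Real.volume_ball, Finset.sum_const, hc]
            rw [ENNReal.ofReal_mul (Nat.cast_nonneg _), nsmul_eq_mul, ENNReal.ofReal_natCast]
    · right
      refine h.trans (ENNReal.ofReal_le_ofReal ?_)
      push_cast; nlinarith

theorem sublevel_one (p : Polynomial ℝ) (k : ℕ) (hp : p.natDegree ≤ k) (a R M η z : ℝ)
    (hR : 0 < R) (hM : 0 < M) (hη : 0 < η) (hz : z ∈ Metric.closedBall a R) (hzM : M ≤ |p.eval z|) :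
    volume {t | t ∈ Metric.closedBall a R ∧ |p.eval t| < η ^ k * M} ≤
      ENNReal.ofReal (k * (4 * (k + 1)) * η * R) := by
  set s : ℝ := 2 * (k + 1) * η * R with hs
  have hspos : 0 < s := by positivity
  rcases exists_sep_or_small {t | t ∈ Metric.closedBall a R ∧ |p.eval t| < η ^ k * M} s hspos k with
    ⟨F, hc, hF, hsep⟩ | h
  · exfalso
    have hint := Lagrange.eq_interpolate (s := F) (v := id) (f := p) (by simp)
      (by rw [hc]; exact lt_of_le_of_lt (Polynomial.degree_le_of_natDegree_le hp) (by exact_mod_cast Nat.lt_succ_self k))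
    have hev := congrArg (Polynomial.eval z) hint
    rw [Lagrange.interpolate_apply, Polynomial.eval_finsetSum] at hev
    simp only [Polynomial.eval_mul, Polynomial.eval_C, id] at hev
    set B : ℝ := (2 * R / s) ^ k with hB
    have hBpos : 0 < B := by positivity
    have hbasis : ∀ x ∈ F, |Polynomial.eval z (Lagrange.basis F id x)| ≤ B := by
      intro x hx
      rw [Lagrange.basis, Polynomial.eval_prod, Finset.abs_prod]
      have : (F.erase x).card = k := by rw [Finset.card_erase_of_mem hx, hc]; rfl
      rw [hB, ← this, ← Finset.prod_const]
      refine Finset.prod_le_prod (fun _ _ => abs_nonneg _) fun y hy => ?_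
      rw [Finset.mem_erase] at hy
      simp only [Lagrange.basisDivisor, Polynomial.eval_mul, Polynomial.eval_C,
        Polynomial.eval_sub, Polynomial.eval_X, id]
      rw [abs_mul, abs_inv, mul_comm, ← div_eq_mul_inv]
      have h1 := hsep x hx y hy.2 (Ne.symm hy.1)
      have h2 : |z - y| ≤ 2 * R := by
        have := (hF hy.2).1
        rw [Metric.mem_closedBall, Real.dist_eq] at this hz
        calc |z - y| = |(z - a) - (y - a)| := by ring_nf
          _ ≤ |z - a| + |y - a| := abs_sub _ _
          _ ≤ 2 * R := by linarith
      exact div_le_div₀ (by positivity) h2 hspos h1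
    have hne : F.Nonempty := by rw [← Finset.card_pos, hc]; omega
    have : |p.eval z| < M := by
      rw [hev]
      calc |∑ x ∈ F, p.eval x * Polynomial.eval z (Lagrange.basis F id x)|
          ≤ ∑ x ∈ F, |p.eval x * Polynomial.eval z (Lagrange.basis F id x)| := Finset.abs_sum_le_sum_abs _ _
        _ < ∑ x ∈ F, (η ^ k * M) * B := by
            refine Finset.sum_lt_sum_of_nonempty hne fun x hx => ?_
            rw [abs_mul]
            calc _ ≤ |p.eval x| * B := mul_le_mul_of_nonneg_left (hbasis x hx) (abs_nonneg _)
              _ < _ := mul_lt_mul_of_pos_right (hF hx).2 hBpos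
        _ = (k + 1) * ((η ^ k * M) * B) := by rw [Finset.sum_const, hc]; simp
        _ ≤ M := by
            have hBe : B = 1 / ((k + 1) ^ k * η ^ k) := by
              rw [hB, hs, ← mul_pow]
              rw [one_div, ← inv_pow]; congr 1; field_simp
            have hk : ((k : ℝ) + 1) ≤ (k + 1) ^ k := by
              rcases k with _ | k
              · simp
              · exact le_self_pow₀ (by push_cast; linarith [Nat.cast_nonneg (α := ℝ) k]) (by omega)
            rw [hBe]
            have : ((k : ℝ) + 1) * (η ^ k * M * (1 / ((k + 1) ^ k * η ^ k))) = M * ((k + 1) / (k + 1) ^ k) := by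
              field_simp
            rw [this]
            have : ((k : ℝ) + 1) / (k + 1) ^ k ≤ 1 := by rw [div_le_one (by positivity)]; exact hk
            nlinarith
    linarith
  · refine h.trans (ENNReal.ofReal_le_ofReal (le_of_eq ?_))
    rw [hs]; ring

theorem mem_closedBall_cons {d : ℕ} (x : Fin (d + 1) → ℝ) (R : ℝ) (hR : 0 ≤ R) (t : ℝ) (y : Fin d → ℝ) :
    (Fin.cons t y : Fin (d + 1) → ℝ) ∈ Metric.closedBall x R ↔
      t ∈ Metric.closedBall (x 0) R ∧ y ∈ Metric.closedBall (fun i => x i.succ) R := by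
  simp only [Metric.mem_closedBall, dist_pi_le_iff hR, Fin.forall_fin_succ, Fin.cons_zero, Fin.cons_succ]

theorem sublevel_multi : ∀ (d : ℕ) (k : Fin d → ℕ), ∃ C : ℝ, 0 < C ∧
    ∀ q : (Fin d → ℝ) → ℝ, Continuous q →
    (∀ u i, ∃ p : Polynomial ℝ, p.natDegree ≤ k i ∧ ∀ t, q (Function.update u i t) = p.eval t) →
    ∀ (x : Fin d → ℝ) (R M η : ℝ), 0 < R → 0 < M → 0 < η → η ≤ 1 →
    (∃ z ∈ Metric.closedBall x R, M ≤ |q z|) →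
    volume {y | y ∈ Metric.closedBall x R ∧ |q y| < η ^ (∑ i, k i) * M} ≤
      ENNReal.ofReal (C * η * R ^ d) := by
  intro d
  induction d with
  | zero =>
    intro k
    refine ⟨1, one_pos, ?_⟩
    rintro q - - x R M η hR hM hη hη1 ⟨z, hz, hzM⟩
    have : {y | y ∈ Metric.closedBall x R ∧ |q y| < η ^ (∑ i, k i) * M} = ∅ := by
      ext y
      have : y = z := Subsingleton.elim _ _
      subst this
      simp only [Finset.univ_eq_empty, Finset.sum_empty, pow_zero, one_mul, mem_ofPred_eq, mem_empty_iff_false,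
        iff_false, not_and, not_lt]
      exact fun _ => hzM
    rw [this]; simp
  | succ d ih =>
    intro k
    obtain ⟨C, hC, H⟩ := ih (fun i => k i.succ)
    refine ⟨2 ^ d * (k 0 * (4 * (k 0 + 1))) + 2 * C, by positivity, ?_⟩
    rintro q hq hpoly x R M η hR hM hη hη1 ⟨z, hz, hzM⟩
    set S := {y | y ∈ Metric.closedBall x R ∧ |q y| < η ^ (∑ i, k i) * M} with hS
    have hSm : MeasurableSet S := by
      apply MeasurableSet.inter Metric.isClosed_closedBall.measurableSet
      exact (isOpen_lt (continuous_abs.comp hq) continuous_const).measurableSet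
    have hz' : z = Fin.cons (z 0) (fun i => z i.succ) := by
      ext i; refine Fin.cases ?_ (fun i => ?_) i <;> simp
    have hzb := (mem_closedBall_cons x R hR.le (z 0) (fun i => z i.succ)).1 (hz' ▸ hz)
    obtain ⟨p0, hp0, hp0e⟩ := hpoly z 0
    have hup : ∀ t, Function.update z 0 t = (Fin.cons t (fun i => z i.succ) : Fin (d + 1) → ℝ) := by
      intro t; ext i; refine Fin.cases ?_ (fun i => ?_) i <;> simp
    set T0 := {t | t ∈ Metric.closedBall (x 0) R ∧ |p0.eval t| < η ^ (k 0) * M} with hT0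
    have hT0m : MeasurableSet T0 := by
      apply MeasurableSet.inter Metric.isClosed_closedBall.measurableSet
      exact (isOpen_lt (continuous_abs.comp p0.continuous) continuous_const).measurableSet
    have hT0v : volume T0 ≤ ENNReal.ofReal (k 0 * (4 * (k 0 + 1)) * η * R) := by
      apply sublevel_one p0 (k 0) hp0 (x 0) R M η (z 0) hR hM hη hzb.1
      rw [← hp0e, Function.update_eq_self]; exact hzM
    have hmp := (volume_preserving_piFinSuccAbove (fun _ : Fin (d + 1) => ℝ) 0).symm
    have hvol : volume S = ∫⁻ t, volume {y : Fin d → ℝ | (Fin.cons t y : Fin (d + 1) → ℝ) ∈ S} := by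
      rw [← hmp.measure_preimage hSm.nullMeasurableSet, Measure.volume_eq_prod,
        Measure.prod_apply (hmp.measurable hSm)]
      refine lintegral_congr fun t => congrArg _ ?_
      ext y
      have : (MeasurableEquiv.piFinSuccAbove (fun _ : Fin (d + 1) => ℝ) 0).symm (t, y) = Fin.cons t y := by
        simp [MeasurableEquiv.piFinSuccAbove]; rfl
      simp only [mem_preimage, this, mem_ofPred_eq]
    have hbd : ∀ t, volume {y : Fin d → ℝ | (Fin.cons t y : Fin (d + 1) → ℝ) ∈ S} ≤
        T0.indicator (fun _ => ENNReal.ofReal ((2 * R) ^ d)) t +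
        (Metric.closedBall (x 0) R).indicator (fun _ => ENNReal.ofReal (C * η * R ^ d)) t := by
      intro t
      by_cases htI : t ∈ Metric.closedBall (x 0) R
      · by_cases htT : t ∈ T0
        · rw [indicator_of_mem htT]
          refine le_trans ?_ le_self_add
          calc _ ≤ volume (Metric.closedBall (fun i => x i.succ : Fin d → ℝ) R) := by
                apply measure_mono
                intro y hy
                exact ((mem_closedBall_cons x R hR.le t y).1 hy.1).2
            _ = _ := by rw [Real.volume_pi_closedBall _ hR.le]; simp
        · rw [indicator_of_mem htI]
          refine le_trans ?_ le_add_self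
          have hge : η ^ (k 0) * M ≤ |q (Fin.cons t (fun i => z i.succ))| := by
            rw [← hup, hp0e]
            by_contra hcon
            exact htT ⟨htI, not_le.1 hcon⟩
          have := H (fun y => q (Fin.cons t y)) (by fun_prop) ?_ (fun i => x i.succ) R (η ^ (k 0) * M) η
            hR (by positivity) hη hη1 ⟨fun i => z i.succ, hzb.2, hge⟩
          · refine le_trans (measure_mono ?_) this
            intro y hy
            refine ⟨((mem_closedBall_cons x R hR.le t y).1 hy.1).2, ?_⟩
            have := hy.2
            rw [Fin.sum_univ_succ, pow_add] at this
            rw [← mul_assoc, mul_comm (η ^ _) (η ^ (k 0))]; exact this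
          · intro u i
            obtain ⟨p, hp, hpe⟩ := hpoly (Fin.cons t u) i.succ
            refine ⟨p, hp, fun t' => ?_⟩
            rw [← hpe, Fin.cons_update]
      · have : {y : Fin d → ℝ | (Fin.cons t y : Fin (d + 1) → ℝ) ∈ S} = ∅ := by
          ext y; simp only [mem_ofPred_eq, mem_empty_iff_false, iff_false]
          exact fun hy => htI ((mem_closedBall_cons x R hR.le t y).1 hy.1).1
        rw [this]; simp
    rw [hvol]
    calc _ ≤ ∫⁻ t, (T0.indicator (fun _ => ENNReal.ofReal ((2 * R) ^ d)) t +
        (Metric.closedBall (x 0) R).indicator (fun _ => ENNReal.ofReal (C * η * R ^ d)) t) := lintegral_mono hbd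
      _ = ENNReal.ofReal ((2 * R) ^ d) * volume T0 + ENNReal.ofReal (C * η * R ^ d) * ENNReal.ofReal (2 * R) := by
        rw [lintegral_add_left (measurable_const.indicator hT0m), lintegral_indicator_const hT0m,
          lintegral_indicator_const Metric.isClosed_closedBall.measurableSet, Real.volume_closedBall]
      _ ≤ ENNReal.ofReal ((2 * R) ^ d) * ENNReal.ofReal (k 0 * (4 * (k 0 + 1)) * η * R) + ENNReal.ofReal (C * η * R ^ d) * ENNReal.ofReal (2 * R) := by
        gcongr
      _ = _ := by
        rw [← ENNReal.ofReal_mul (by positivity), ← ENNReal.ofReal_mul (by positivity),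
          ← ENNReal.ofReal_add (by positivity) (by positivity)]
        congr 1
        rw [mul_pow]; ring

/-- Besicovitch summation lemma -/
theorem besi_sum (d : ℕ) : ∃ N : ℝ, 1 ≤ N ∧ ∀ (A Z : Set (Fin d → ℝ)) (r : (Fin d → ℝ) → ℝ) (Rb κ : ℝ),
    0 ≤ κ →
    (∀ y ∈ A, 0 < r y ∧ r y ≤ Rb ∧ Metric.closedBall y (r y) ⊆ Z ∧
      volume (A ∩ Metric.closedBall y (r y)) ≤ ENNReal.ofReal κ * volume (Metric.closedBall y (r y))) →
    volume A ≤ ENNReal.ofReal (N * κ) * volume Z := by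
  set N := Besicovitch.multiplicity (Fin d → ℝ) with hN
  refine ⟨N + 1, by simp, ?_⟩
  intro A Z r Rb κ hκ H
  let q : Besicovitch.BallPackage A (Fin d → ℝ) :=
    { c := fun y => y, r := fun y => r y, rpos := fun y => (H y y.2).1, r_bound := Rb,
      r_le := fun y => (H y y.2).2.1 }
  obtain ⟨s, hdisj, hcov⟩ := Besicovitch.exist_disjoint_covering_families
    (Besicovitch.one_lt_goodτ (Fin d → ℝ)) (Besicovitch.isEmpty_satelliteConfig_multiplicity (Fin d → ℝ)) q
  have hcount : ∀ i, (s i).Countable := by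
    intro i
    apply (hdisj i).countable_of_nonempty_interior
    intro j hj
    exact ⟨q.c j, interior_mono Metric.ball_subset_closedBall (by rw [Metric.isOpen_ball.interior_eq]; exact Metric.mem_ball_self (q.rpos j))⟩
  have hAsub : A ⊆ ⋃ i, ⋃ j ∈ s i, (A ∩ Metric.closedBall (q.c j) (q.r j)) := by
    intro y hy
    have : y ∈ range q.c := ⟨⟨y, hy⟩, rfl⟩
    have := hcov this
    simp only [mem_iUnion] at this ⊢
    obtain ⟨i, j, hj, hyj⟩ := this
    exact ⟨i, j, hj, hy, Metric.ball_subset_closedBall hyj⟩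
  calc volume A ≤ volume (⋃ i, ⋃ j ∈ s i, (A ∩ Metric.closedBall (q.c j) (q.r j))) := measure_mono hAsub
    _ ≤ ∑ i, volume (⋃ j ∈ s i, (A ∩ Metric.closedBall (q.c j) (q.r j))) := measure_iUnion_fintype_le _ _
    _ ≤ ∑ i : Fin N, ENNReal.ofReal κ * volume Z := by
      refine Finset.sum_le_sum fun i _ => ?_
      calc _ ≤ ∑' j : s i, volume (A ∩ Metric.closedBall (q.c j) (q.r j)) := measure_biUnion_le _ (hcount i) _
        _ ≤ ∑' j : s i, ENNReal.ofReal κ * volume (Metric.closedBall (q.c j) (q.r j)) :=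
            ENNReal.tsum_le_tsum fun j => (H (j : A) (j : A).2).2.2.2
        _ = ENNReal.ofReal κ * volume (⋃ j ∈ s i, Metric.closedBall (q.c j) (q.r j)) := by
            rw [ENNReal.tsum_mul_left, measure_biUnion (hcount i) (hdisj i)
              (fun j _ => Metric.isClosed_closedBall.measurableSet)]
        _ ≤ _ := by
            gcongr
            refine iUnion₂_subset fun j hj => (H (j : A) (j : A).2).2.2.1
    _ = N * (ENNReal.ofReal κ * volume Z) := by simp
    _ ≤ _ := by
      rw [ENNReal.ofReal_mul (by positivity), mul_assoc]
      gcongr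
      rw [← ENNReal.ofReal_natCast]
      exact ENNReal.ofReal_le_ofReal (by linarith)

def WeakG {d : ℕ} (Φ : (Fin d → ℝ) → ℝ) (W : Set (Fin d → ℝ)) (τ κ : ℝ) : Prop :=
  ∀ x R, 0 < R → Metric.closedBall x R ⊆ W → ∀ M, 0 < M → (∃ z ∈ Metric.closedBall x R, M ≤ Φ z) →
    volume {y | y ∈ Metric.closedBall x R ∧ Φ y < τ * M} ≤ ENNReal.ofReal κ * volume (Metric.closedBall x R)

def GoodG {d : ℕ} (Φ : (Fin d → ℝ) → ℝ) (W : Set (Fin d → ℝ)) (C α : ℝ) : Prop :=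
  ∀ x R, 0 < R → Metric.closedBall x (3 * R) ⊆ W → ∀ M ε, 0 < M → 0 < ε →
    (∃ z ∈ Metric.closedBall x R, M ≤ Φ z) →
    volume {y | y ∈ Metric.closedBall x R ∧ Φ y < ε * M} ≤
      ENNReal.ofReal (C * ε ^ α) * volume (Metric.closedBall x R)

theorem vol_ball_scale {d : ℕ} (x y : Fin d → ℝ) (R a : ℝ) (hR : 0 ≤ R) (ha : 0 ≤ a) :
    volume (Metric.closedBall x (a * R)) = ENNReal.ofReal (a ^ d) * volume (Metric.closedBall y R) := by
  rw [Real.volume_pi_closedBall _ hR, Real.volume_pi_closedBall _ (by positivity),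
    ← ENNReal.ofReal_mul (by positivity)]
  simp only [Fintype.card_fin]
  congr 1; rw [← mul_pow]; ring

theorem vol_ball_ne_top {d : ℕ} (x : Fin d → ℝ) (R : ℝ) : volume (Metric.closedBall x R) ≠ ⊤ :=
  measure_closedBall_lt_top.ne

theorem vol_ball_pos {d : ℕ} (x : Fin d → ℝ) (R : ℝ) (hR : 0 < R) : volume (Metric.closedBall x R) ≠ 0 :=
  (Metric.measure_closedBall_pos _ _ hR).ne'

/-- dyadic stopping -/
theorem dyadic_stop (P : ℝ → Prop) (R0 : ℝ) (hR0 : 0 < R0) (h0 : ¬ P R0)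
    (h1 : ∃ δ > 0, ∀ r, 0 < r → r < δ → P r) : ∃ r, 0 < r ∧ 2 * r ≤ R0 ∧ P r ∧ ¬ P (2 * r) := by
  obtain ⟨δ, hδ, h1⟩ := h1
  have hex : ∃ n : ℕ, P (R0 * (1 / 2) ^ n) := by
    obtain ⟨n, hn⟩ := exists_pow_lt_of_lt_one (show 0 < δ / R0 by positivity) (show (1 / 2 : ℝ) < 1 by norm_num)
    refine ⟨n, h1 _ (by positivity) ?_⟩
    rw [lt_div_iff₀ hR0] at hn
    linarith
  classical
  have hn := Nat.find_spec hex
  have hmin := fun m => Nat.find_min hex (m := m)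
  set n := Nat.find hex with hnn
  rcases Nat.eq_zero_or_pos n with h | h
  · rw [h] at hn; simp at hn; exact absurd hn h0
  · obtain ⟨k, hk⟩ := Nat.exists_eq_succ_of_ne_zero h.ne'
    have hk' : 2 * (R0 * (1 / 2 : ℝ) ^ n) = R0 * (1 / 2) ^ k := by rw [hk, pow_succ]; ring
    refine ⟨R0 * (1 / 2) ^ n, by positivity, ?_, hn, ?_⟩
    · rw [hk']
      have : (1 / 2 : ℝ) ^ k ≤ 1 := pow_le_one₀ (by norm_num) (by norm_num)
      nlinarith
    · rw [hk']; exact hmin k (by omega)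

theorem weak_iter {d : ℕ} (N : ℝ) (hN1 : 1 ≤ N) (hN : ∀ (A Z : Set (Fin d → ℝ)) (r : (Fin d → ℝ) → ℝ) (Rb κ : ℝ),
    0 ≤ κ →
    (∀ y ∈ A, 0 < r y ∧ r y ≤ Rb ∧ Metric.closedBall y (r y) ⊆ Z ∧
      volume (A ∩ Metric.closedBall y (r y)) ≤ ENNReal.ofReal κ * volume (Metric.closedBall y (r y))) →
    volume A ≤ ENNReal.ofReal (N * κ) * volume Z)
    (Φ : (Fin d → ℝ) → ℝ) (W : Set (Fin d → ℝ)) (hc : ContinuousOn Φ W)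
    (τ κ : ℝ) (hτ0 : 0 < τ) (hτ1 : τ < 1) (hκ0 : 0 < κ) (hκ : κ * 20 ^ d < 1)
    (hw : WeakG Φ W τ κ) (k : ℕ) : ∀ x R, 0 < R → Metric.closedBall x (3 * R) ⊆ W → ∀ M, 0 < M →
    (∃ z ∈ Metric.closedBall x R, M ≤ Φ z) →
    volume {y | y ∈ Metric.closedBall x R ∧ Φ y < τ ^ k * M} ≤
      ENNReal.ofReal ((4 ^ d * N * κ) ^ k) * volume (Metric.closedBall x R) := by
  induction k with
  | zero =>
    intro x R hR hW M hM hz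
    simp only [pow_zero, ENNReal.ofReal_one, one_mul]
    exact measure_mono fun y hy => hy.1
  | succ k ih =>
    intro x R hR hW M hM hz
    set A := {y | y ∈ Metric.closedBall x R ∧ Φ y < τ ^ (k + 1) * M} with hA
    have key : ∀ y, ∃ r, y ∈ A → 0 < r ∧ 2 * r ≤ R / 10 ∧ (∀ y' ∈ Metric.closedBall y r, Φ y' < τ * M) ∧
        ∃ z ∈ Metric.closedBall y (2 * r), τ * M ≤ Φ z := by
      intro y
      by_cases hy : y ∈ A
      · have hyx : dist y x ≤ R := hy.1
        have g0 : ¬ ∀ y' ∈ Metric.closedBall y (R / 10), Φ y' < τ * M := by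
          intro hcon
          have hball : Metric.closedBall x (1.1 * R) ⊆ W :=
            (Metric.closedBall_subset_closedBall (by linarith)).trans hW
          obtain ⟨z, hzb, hzM⟩ := hz
          have := hw x (1.1 * R) (by positivity) hball M hM ⟨z, Metric.closedBall_subset_closedBall (by linarith) hzb, hzM⟩
          have h2 : volume (Metric.closedBall y (R / 10)) ≤ ENNReal.ofReal κ * volume (Metric.closedBall x (1.1 * R)) := by
            refine le_trans (measure_mono ?_) this
            intro y' hy'
            refine ⟨?_, hcon y' hy'⟩
            have := dist_triangle y' y x
            rw [Metric.mem_closedBall] at hy' ⊢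
            linarith
          rw [show (1.1 : ℝ) * R = 11 * (R / 10) by ring, vol_ball_scale x y _ _ (by positivity) (by norm_num),
            ← mul_assoc, ← ENNReal.ofReal_mul hκ0.le] at h2
          have h3 : ENNReal.ofReal (κ * 11 ^ d) < 1 := by
            rw [← ENNReal.ofReal_one]
            apply (ENNReal.ofReal_lt_ofReal_iff one_pos).2
            refine lt_of_le_of_lt ?_ hκ
            gcongr; norm_num
          have h4 := ENNReal.mul_lt_mul_left (vol_ball_pos y (R / 10) (by positivity)) (vol_ball_ne_top y _) h3
          rw [one_mul] at h4
          exact absurd h2 (not_le.2 h4)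
        have g1 : ∃ δ > 0, ∀ r, 0 < r → r < δ → ∀ y' ∈ Metric.closedBall y r, Φ y' < τ * M := by
          have hnb : W ∈ nhds y := by
            refine mem_of_superset (Metric.closedBall_mem_nhds y (show 0 < R by positivity)) (subset_trans ?_ hW)
            intro y' hy'
            have := dist_triangle y' y x
            rw [Metric.mem_closedBall] at hy' ⊢
            linarith
          have hlt : Φ y < τ * M := by
            refine lt_of_lt_of_le hy.2 ?_
            rw [pow_succ]
            have : τ ^ k ≤ 1 := pow_le_one₀ hτ0.le hτ1.le
            have : 0 < τ * M := by positivity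
            nlinarith
          have := (hc.continuousAt hnb).eventually (gt_mem_nhds hlt)
          obtain ⟨δ, hδ, h⟩ := Metric.eventually_nhds_iff.1 this
          exact ⟨δ, hδ, fun r hr hrδ y' hy' => h (lt_of_le_of_lt hy' hrδ)⟩
        obtain ⟨r, h1, h2, h3, h4⟩ := dyadic_stop (fun r => ∀ y' ∈ Metric.closedBall y r, Φ y' < τ * M) (R / 10)
          (by positivity) g0 g1
        push Not at h4
        exact ⟨r, fun _ => ⟨h1, h2, h3, h4⟩⟩
      · exact ⟨0, fun h => absurd h hy⟩
    choose r hr using key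
    have hcov := hN A {y | y ∈ Metric.closedBall x (2 * R) ∧ Φ y < τ * M} r R (2 ^ d * (4 ^ d * N * κ) ^ k)
      (by positivity) ?_
    · have hZ := hw x (2 * R) (by positivity) ((Metric.closedBall_subset_closedBall (by linarith)).trans hW) M hM
        (by obtain ⟨z, hz, hzM⟩ := hz; exact ⟨z, Metric.closedBall_subset_closedBall (by linarith) hz, hzM⟩)
      refine hcov.trans ((mul_le_mul_right hZ _).trans (le_of_eq ?_))
      rw [vol_ball_scale x x _ _ hR.le (by norm_num), ← mul_assoc, ← mul_assoc, ← ENNReal.ofReal_mul (by positivity),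
        ← ENNReal.ofReal_mul (by positivity)]
      congr 2
      rw [show (4 : ℝ) ^ d = 2 ^ d * 2 ^ d by rw [← mul_pow]; norm_num]
      ring
    · intro y hy
      obtain ⟨h1, h2, h3, h4⟩ := hr y hy
      have hyx : dist y x ≤ R := hy.1
      refine ⟨h1, by linarith, ?_, ?_⟩
      · intro y' hy'
        refine ⟨?_, h3 y' hy'⟩
        have := dist_triangle y' y x
        rw [Metric.mem_closedBall] at hy' ⊢
        linarith
      · have := ih y (2 * r y) (by positivity) ?_ (τ * M) (by positivity) h4
        · rw [vol_ball_scale y y _ _ h1.le (by norm_num), ← mul_assoc (ENNReal.ofReal _), ← ENNReal.ofReal_mul (by positivity), mul_comm ((_ : ℝ) ^ k) (2 ^ d)] at this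
          refine le_trans (measure_mono ?_) this
          rintro y' ⟨hy', hy''⟩
          refine ⟨Metric.closedBall_subset_closedBall (by linarith) hy'', ?_⟩
          have := hy'.2
          rw [pow_succ] at this
          linarith
        · refine subset_trans ?_ hW
          intro y' hy'
          have := dist_triangle y' y x
          rw [Metric.mem_closedBall] at hy' ⊢
          linarith

theorem weak_to_good (d : ℕ) : ∃ N : ℝ, 1 ≤ N ∧ ∀ (Φ : (Fin d → ℝ) → ℝ) (W : Set (Fin d → ℝ)), ContinuousOn Φ W →
    ∀ (τ κ α : ℝ), 0 < τ → τ < 1 → 0 < κ → κ * 20 ^ d < 1 → 0 < α → 4 ^ d * N * κ ≤ τ ^ α →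
    WeakG Φ W τ κ → GoodG Φ W (τ ^ (-α)) α := by
  obtain ⟨N, hN1, hN⟩ := besi_sum d
  refine ⟨N, hN1, ?_⟩
  intro Φ W hc τ κ α hτ0 hτ1 hκ0 hκ hα hle hw x R hR hW M ε hM hε hz
  have hC1 : 1 ≤ τ ^ (-α) := Real.one_le_rpow_of_pos_of_le_one_of_nonpos hτ0 hτ1.le (by linarith)
  by_cases h1 : ε ≤ 1
  · obtain ⟨k, hk1, hk2⟩ := exists_nat_pow_near_of_lt_one hε h1 hτ0 hτ1
    have := weak_iter N hN1 hN Φ W hc τ κ hτ0 hτ1 hκ0 hκ hw k x R hR hW M hM hz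
    refine le_trans (measure_mono ?_) (this.trans ?_)
    · intro y hy
      exact ⟨hy.1, hy.2.trans_le (by gcongr)⟩
    · gcongr
      calc (4 ^ d * N * κ) ^ k ≤ (τ ^ α) ^ k := by gcongr
        _ = τ ^ (-α) * (τ ^ (k + 1)) ^ α := by
          rw [← Real.rpow_natCast, ← Real.rpow_mul hτ0.le, ← Real.rpow_natCast, ← Real.rpow_mul hτ0.le,
            ← Real.rpow_add hτ0]
          congr 1; push_cast; ring
        _ ≤ _ := by gcongr
  · have : 1 ≤ ε ^ α := Real.one_le_rpow (by linarith) hα.le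
    have h2 : (1 : ℝ≥0∞) ≤ ENNReal.ofReal (τ ^ (-α) * ε ^ α) := by
      rw [← ENNReal.ofReal_one]; exact ENNReal.ofReal_le_ofReal (by nlinarith)
    calc _ ≤ volume (Metric.closedBall x R) := measure_mono fun y hy => hy.1
      _ = 1 * volume (Metric.closedBall x R) := (one_mul _).symm
      _ ≤ _ := by gcongr

def MarkedKM {d : ℕ} {S : Type} [PartialOrder S] (ψ : S → (Fin d → ℝ) → ℝ) (ε ρ : ℝ) (y : Fin d → ℝ) : Prop :=
  ∃ F : Finset S, IsChain (· ≤ ·) (F : Set S) ∧ (∀ s ∈ F, ε ≤ ψ s y ∧ ψ s y ≤ 1) ∧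
    ∀ s, s ∉ F → IsChain (· ≤ ·) (insert s (F : Set S)) → ρ ≤ ψ s y

theorem MarkedKM.mono {d : ℕ} {S : Type} [PartialOrder S] {ψ : S → (Fin d → ℝ) → ℝ} {ε ρ ρ' : ℝ} {y : Fin d → ℝ}
    (h : MarkedKM ψ ε ρ y) (hρ : ρ' ≤ ρ) : MarkedKM ψ ε ρ' y := by
  obtain ⟨F, h1, h2, h3⟩ := h
  exact ⟨F, h1, h2, fun s hs hc => hρ.trans (h3 s hs hc)⟩

theorem km_abstract (d : ℕ) (C α : ℝ) (hC : 0 < C) (hα : 0 < α) (L j : ℕ) : ∀ ρ : ℝ, 0 < ρ → ρ ≤ 1 →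
    ∃ ρs > 0, ∃ Cj > 0, ∀ (S : Type) [PartialOrder S] (ψ : S → (Fin d → ℝ) → ℝ) (W : Set (Fin d → ℝ)),
    (∀ s, ContinuousOn (ψ s) W) → (∀ s, GoodG (ψ s) W C α) →
    (∀ F : Finset S, IsChain (· ≤ ·) (F : Set S) → F.card ≤ L) →
    ∀ F : Finset S, IsChain (· ≤ ·) (F : Set S) → L ≤ F.card + j →
    ∀ x R, 0 < R → Metric.closedBall x (7 * (j + 1) * R) ⊆ W →
    (∀ s, s ∉ F → IsChain (· ≤ ·) (insert s (F : Set S)) → ∃ z ∈ Metric.closedBall x R, ρ ≤ ψ s z) →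
    ∀ ε, 0 < ε →
    volume {y | y ∈ Metric.closedBall x R ∧ (∀ s ∈ F, ε ≤ ψ s y ∧ ψ s y ≤ 1) ∧ ¬ MarkedKM ψ ε ρs y} ≤
      ENNReal.ofReal (Cj * ε ^ α) * volume (Metric.closedBall x R) := by
  classical
  induction j with
  | zero =>
    intro ρ hρ hρ1
    refine ⟨ρ, hρ, 1, one_pos, ?_⟩
    intro S _ ψ W hcont hgood hL F hF hFL x R hR hW hz ε hε
    have : {y | y ∈ Metric.closedBall x R ∧ (∀ s ∈ F, ε ≤ ψ s y ∧ ψ s y ≤ 1) ∧ ¬ MarkedKM ψ ε ρ y} = ∅ := by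
      ext y
      simp only [mem_ofPred_eq, mem_empty_iff_false, iff_false, not_and, not_not]
      intro hy hs
      refine ⟨F, hF, hs, fun s hsF hch => ?_⟩
      have := hL (insert s F) (by simpa using hch)
      rw [Finset.card_insert_of_notMem hsF] at this
      omega
    rw [this]; simp
  | succ j ih =>
    intro ρ hρ hρ1
    obtain ⟨N, hN1, hN⟩ := besi_sum d
    obtain ⟨c, hc0, hc1, hc⟩ : ∃ c : ℝ, 0 < c ∧ c ≤ 1 ∧ C * c ^ α * 2 ^ d < 1 := by
      have : Tendsto (fun c : ℝ => C * c ^ α * 2 ^ d) (nhdsWithin 0 (Ioi 0)) (nhds 0) := by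
        have h : ContinuousAt (fun c : ℝ => C * c ^ α * 2 ^ d) 0 := by
          have := Real.continuousAt_rpow_const 0 α (Or.inr hα.le)
          fun_prop
        have h2 := h.tendsto.mono_left (nhdsWithin_le_nhds (s := Ioi 0))
        simpa [Real.zero_rpow hα.ne'] using h2
      have h1 := this.eventually (gt_mem_nhds one_pos)
      have h2 : ∀ᶠ c : ℝ in nhdsWithin 0 (Ioi 0), c ∈ Ioo (0 : ℝ) 1 := Ioo_mem_nhdsGT one_pos
      obtain ⟨c, hc, hc'⟩ := (h1.and h2).exists
      exact ⟨c, hc'.1, hc'.2.le, hc⟩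
    obtain ⟨ρs, hρs, Cj, hCj, H⟩ := ih (c * ρ) (by positivity) (by nlinarith)
    refine ⟨min ρs ρ, by positivity, N * (C * ρ ^ (-α) * 2 ^ d + Cj) * 2 ^ d, by positivity, ?_⟩
    intro S _ ψ W hcont hgood hL F hF hFL x R hR hW hz ε hε
    set A := {y | y ∈ Metric.closedBall x R ∧ (∀ s ∈ F, ε ≤ ψ s y ∧ ψ s y ≤ 1) ∧ ¬ MarkedKM ψ ε (min ρs ρ) y} with hA
    have hsubW : ∀ y ∈ Metric.closedBall x R, ∀ r, r ≤ 6 * R → Metric.closedBall y r ⊆ W := by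
      intro y hy r hr
      refine subset_trans ?_ hW
      intro y' hy'
      have := dist_triangle y' y x
      rw [Metric.mem_closedBall] at hy' hy ⊢
      push_cast
      have : (0 : ℝ) ≤ j * R := by positivity
      nlinarith
    have key : ∀ y, ∃ r, y ∈ A → 0 < r ∧ 2 * r ≤ 2 * R ∧ (∃ s, s ∉ F ∧ IsChain (· ≤ ·) (insert s (F : Set S)) ∧
        ∀ y' ∈ Metric.closedBall y r, ψ s y' < ρ) ∧
        ∀ s, s ∉ F → IsChain (· ≤ ·) (insert s (F : Set S)) → ∃ z ∈ Metric.closedBall y (2 * r), ρ ≤ ψ s z := by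
      intro y
      by_cases hy : y ∈ A
      · have hyx : dist y x ≤ R := hy.1
        have g0 : ¬ ∃ s, s ∉ F ∧ IsChain (· ≤ ·) (insert s (F : Set S)) ∧
            ∀ y' ∈ Metric.closedBall y (2 * R), ψ s y' < ρ := by
          rintro ⟨s, hs, hch, hlt⟩
          obtain ⟨z, hzb, hzρ⟩ := hz s hs hch
          refine absurd (hlt z ?_) (not_lt.2 hzρ)
          have := dist_triangle z x y
          rw [Metric.mem_closedBall] at hzb ⊢
          rw [dist_comm] at hyx
          linarith
        have g1 : ∃ δ > 0, ∀ r, 0 < r → r < δ → ∃ s, s ∉ F ∧ IsChain (· ≤ ·) (insert s (F : Set S)) ∧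
            ∀ y' ∈ Metric.closedBall y r, ψ s y' < ρ := by
          have : ∃ s, s ∉ F ∧ IsChain (· ≤ ·) (insert s (F : Set S)) ∧ ψ s y < ρ := by
            by_contra hcon
            push Not at hcon
            exact hy.2.2 ⟨F, hF, hy.2.1,
              fun s hs hch => (min_le_right _ _).trans (hcon s hs hch)⟩
          obtain ⟨s, hs, hch, hlt⟩ := this
          have hnb : W ∈ nhds y := mem_of_superset (Metric.closedBall_mem_nhds y hR) (hsubW y hy.1 R (by linarith))
          have := ((hcont s).continuousAt hnb).eventually (gt_mem_nhds hlt)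
          obtain ⟨δ, hδ, h⟩ := Metric.eventually_nhds_iff.1 this
          exact ⟨δ, hδ, fun r hr hrδ => ⟨s, hs, hch, fun y' hy' => h (lt_of_le_of_lt hy' hrδ)⟩⟩
        obtain ⟨r, h1, h2, h3, h4⟩ := dyadic_stop _ (2 * R) (by positivity) g0 g1
        push Not at h4
        exact ⟨r, fun _ => ⟨h1, h2, h3, h4⟩⟩
      · exact ⟨0, fun h => absurd h hy⟩
    choose r hr using key
    have hcov := hN A (Metric.closedBall x (2 * R)) r R ((C * ρ ^ (-α) * 2 ^ d + Cj) * ε ^ α) (by positivity) ?_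
    · refine hcov.trans (le_of_eq ?_)
      rw [vol_ball_scale x x _ _ hR.le (by norm_num), ← mul_assoc, ← ENNReal.ofReal_mul (by positivity)]
      congr 2; ring
    · intro y hy
      obtain ⟨hr0, hr2, ⟨s, hsF, hch, hlt⟩, hz2⟩ := hr y hy
      have hyx : dist y x ≤ R := hy.1
      refine ⟨hr0, by linarith, ?_, ?_⟩
      · intro y' hy'
        have := dist_triangle y' y x
        rw [Metric.mem_closedBall] at hy' ⊢
        linarith
      have hWy := hsubW y hy.1 (3 * (2 * r y)) (by linarith)
      have e1 : volume {y' | y' ∈ Metric.closedBall y (2 * r y) ∧ ψ s y' < ε} ≤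
          ENNReal.ofReal (C * ρ ^ (-α) * 2 ^ d * ε ^ α) * volume (Metric.closedBall y (r y)) := by
        have := hgood s y (2 * r y) (by positivity) hWy ρ (ε / ρ) hρ (by positivity) (hz2 s hsF hch)
        rw [div_mul_cancel₀ _ hρ.ne', vol_ball_scale y y _ _ hr0.le (by norm_num), ← mul_assoc,
          ← ENNReal.ofReal_mul (by positivity)] at this
        refine this.trans (le_of_eq ?_)
        congr 2
        rw [Real.div_rpow hε.le hρ.le, Real.rpow_neg hρ.le]; ring
      have e2 := H S ψ W hcont hgood hL (insert s F) (by simpa using hch)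
        (by rw [Finset.card_insert_of_notMem hsF]; omega) y (r y) hr0 ?_ ?_ ε hε
      · refine le_trans (measure_mono ?_) ((measure_union_le _ _).trans ((add_le_add e1 e2).trans (le_of_eq ?_)))
        · rintro y' ⟨hy', hyb⟩
          by_cases hε' : ψ s y' < ε
          · left; exact ⟨Metric.closedBall_subset_closedBall (by linarith) hyb, hε'⟩
          · right
            refine ⟨hyb, ?_, fun hm => hy'.2.2 (hm.mono (min_le_left _ _))⟩
            intro s' hs'
            rcases Finset.mem_insert.1 hs' with rfl | h
            · exact ⟨not_lt.1 hε', (hlt y' hyb).le.trans hρ1⟩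
            · exact hy'.2.1 s' h
        · rw [← add_mul, ← ENNReal.ofReal_add (by positivity) (by positivity)]
          congr 2; ring
      · refine subset_trans ?_ hW
        intro y' hy'
        have := dist_triangle y' y x
        rw [Metric.mem_closedBall] at hy' ⊢
        push_cast
        have : 7 * ((j : ℝ) + 1) * r y ≤ 7 * (j + 1) * R := by gcongr; linarith
        nlinarith
      · intro s' hs' hch'
        by_contra hcon
        push Not at hcon
        have hch2 : IsChain (· ≤ ·) (insert s' (F : Set S)) :=
          hch'.mono (insert_subset_insert (by simp))
        have hs2 : s' ∉ F := fun h => hs' (Finset.mem_insert_of_mem h)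
        have := hgood s' y (2 * r y) (by positivity) hWy ρ c hρ hc0 (hz2 s' hs2 hch2)
        have h2 : volume (Metric.closedBall y (r y)) ≤ ENNReal.ofReal (C * c ^ α * 2 ^ d) * volume (Metric.closedBall y (r y)) := by
          rw [vol_ball_scale y y _ _ hr0.le (by norm_num), ← mul_assoc,
            ← ENNReal.ofReal_mul (by positivity)] at this
          refine le_trans (measure_mono ?_) this
          intro y' hy'
          exact ⟨Metric.closedBall_subset_closedBall (by linarith) hy', hcon y' hy'⟩
        have h3 : ENNReal.ofReal (C * c ^ α * 2 ^ d) < 1 := by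
          rw [← ENNReal.ofReal_one]
          exact (ENNReal.ofReal_lt_ofReal_iff one_pos).2 hc
        have h4 := ENNReal.mul_lt_mul_left (vol_ball_pos y (r y) hr0) (vol_ball_ne_top y _) h3
        rw [one_mul] at h4
        exact absurd h2 (not_le.2 h4)

section IterL
variable {E G : Type*} [NormedAddCommGroup E] [NormedSpace ℝ E] [NormedAddCommGroup G] [NormedSpace ℝ G]

noncomputable def iterL : List E → (E → G) → E → G
  | [], g => g
  | v :: L, g => fun x => fderiv ℝ (iterL L g) x v

theorem iterL_eq (g : E → G) (U : Set E) (hU : IsOpen U) (l : ℕ) (hg : ContDiffOn ℝ l g U) (L : List E) :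
    L.length ≤ l → ∀ x ∈ U, iterL L g x = iteratedFDeriv ℝ L.length g x L.get := by
  induction L with
  | nil => intro _ x _; simp [iterL]
  | cons v L ih =>
    intro hl x hx
    simp only [List.length_cons] at hl
    have hev : iterL L g =ᶠ[nhds x] fun y => iteratedFDeriv ℝ L.length g y L.get := by
      filter_upwards [hU.mem_nhds hx] with y hy using ih (by omega) y hy
    have hd : DifferentiableAt ℝ (iteratedFDeriv ℝ L.length g) x := by
      apply (hg.contDiffAt (hU.mem_nhds hx)).differentiableAt_iteratedFDeriv
      exact_mod_cast hl
    have h2 := hd.iteratedFDeriv_succ_apply_left' (m := (v :: L).get)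
    simp only [iterL]
    rw [hev.fderiv_eq]
    exact h2.symm

theorem iterL_contDiffAt (g : E → G) (U : Set E) (hU : IsOpen U) (l : ℕ) (hg : ContDiffOn ℝ l g U) (L : List E)
    (j : ℕ) (hl : j + L.length ≤ l) (x : E) (hx : x ∈ U) : ContDiffAt ℝ j (iterL L g) x := by
  have hev : iterL L g =ᶠ[nhds x] fun y => iteratedFDeriv ℝ L.length g y L.get := by
    filter_upwards [hU.mem_nhds hx] with y hy using iterL_eq g U hU l hg L (by omega) y hy
  refine ContDiffAt.congr_of_eventuallyEq ?_ hev
  have : ContDiffAt ℝ j (iteratedFDeriv ℝ L.length g) x :=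
    (hg.contDiffAt (hU.mem_nhds hx)).iteratedFDeriv_right (by exact_mod_cast hl)
  exact (ContinuousMultilinearMap.apply ℝ (fun _ : Fin L.length => E) G L.get).contDiff.contDiffAt.comp x this

theorem iterL_perm (g : E → G) (U : Set E) (hU : IsOpen U) (l : ℕ) (hg : ContDiffOn ℝ l g U) {L L' : List E}
    (hp : L.Perm L') : L.length ≤ l → ∀ x ∈ U, iterL L g x = iterL L' g x := by
  induction hp with
  | nil => intro _ x _; rfl
  | cons v hp ih =>
    intro hl x hx
    simp only [List.length_cons] at hl
    simp only [iterL]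
    rw [Filter.EventuallyEq.fderiv_eq]
    filter_upwards [hU.mem_nhds hx] with y hy using ih (by omega) y hy
  | swap a b L =>
    intro hl x hx
    simp only [List.length_cons] at hl
    have h2 : ContDiffAt ℝ 2 (iterL L g) x := iterL_contDiffAt g U hU l hg L 2 (by omega) x hx
    have hsym := h2.isSymmSndFDerivAt (by simp)
    have hd : DifferentiableAt ℝ (fderiv ℝ (iterL L g)) x :=
      (h2.fderiv_right (m := 1) (by norm_num)).differentiableAt (by simp)
    simp only [iterL]
    have e : ∀ a b : E, fderiv ℝ (fun y => fderiv ℝ (iterL L g) y a) x b = fderiv ℝ (fderiv ℝ (iterL L g)) x b a := by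
      intro a b
      rw [fderiv_clm_apply hd (differentiableAt_const _)]
      simp
    rw [e, e]
    exact hsym.eq _ _
  | trans h1 h2 ih1 ih2 =>
    intro hl x hx
    rw [ih1 hl x hx, ih2 (by rw [← h1.length_eq]; exact hl) x hx]

theorem iteratedFDeriv_perm (g : E → G) (U : Set E) (hU : IsOpen U) (l : ℕ) (hg : ContDiffOn ℝ l g U)
    (k : ℕ) (hk : k ≤ l) (x : E) (hx : x ∈ U) (m : Fin k → E) (σ : Equiv.Perm (Fin k)) :
    iteratedFDeriv ℝ k g x (m ∘ σ) = iteratedFDeriv ℝ k g x m := by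
  have key : ∀ m : Fin k → E, iteratedFDeriv ℝ k g x m = iterL (List.ofFn m) g x := by
    intro m
    rw [iterL_eq g U hU l hg _ (by simpa using hk) x hx]
    have aux : ∀ (k' : ℕ) (h : k' = k) (m' : Fin k' → E), (∀ i, m' i = m (Fin.cast h i)) →
        iteratedFDeriv ℝ k g x m = iteratedFDeriv ℝ k' g x m' := by
      rintro k' rfl m' h
      congr 1; ext i; exact (h i).symm
    exact aux _ (by simp) _ (by intro i; simp; rfl)
  rw [key, key]
  exact iterL_perm g U hU l hg (Equiv.Perm.ofFn_comp_perm σ m) (by simpa using hk) x hx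

theorem iteratedFDeriv_diag_hasFDerivAt (g : E → G) (U : Set E) (hU : IsOpen U) (l : ℕ) (hg : ContDiffOn ℝ l g U)
    (k : ℕ) (hk : k + 1 ≤ l) (x : E) (hx : x ∈ U) (y e : E) :
    fderiv ℝ (fun y => iteratedFDeriv ℝ (k + 1) g x (fun _ => y)) y e =
      ((k : ℝ) + 1) • iteratedFDeriv ℝ k (fderiv ℝ g) x (fun _ => y) e := by
  have h := (ContinuousMultilinearMap.hasFDerivAt (iteratedFDeriv ℝ (k + 1) g x) (fun _ => y)).comp y
    ((ContinuousLinearMap.pi (fun _ : Fin (k + 1) => ContinuousLinearMap.id ℝ E)).hasFDerivAt)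
  have h' : HasFDerivAt (fun y => iteratedFDeriv ℝ (k + 1) g x (fun _ => y)) _ y := h
  rw [h'.fderiv]
  simp only [ContinuousLinearMap.comp_apply, ContinuousMultilinearMap.linearDeriv_apply,
    ContinuousLinearMap.coe_pi', ContinuousLinearMap.coe_id', id]
  have hterm : ∀ i : Fin (k + 1), iteratedFDeriv ℝ (k + 1) g x (Function.update (fun _ => y) i e) =
      iteratedFDeriv ℝ k (fderiv ℝ g) x (fun _ => y) e := by
    intro i
    have : (Function.update (fun _ => y) i e : Fin (k + 1) → E) =
        (Function.update (fun _ => y) (Fin.last k) e : Fin (k + 1) → E) ∘ (Equiv.swap i (Fin.last k)) := by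
      ext j
      by_cases hj : j = i
      · subst hj; simp
      · simp only [Function.comp]
        rw [Function.update_of_ne hj]
        by_cases hj2 : j = Fin.last k
        · subst hj2; rw [Equiv.swap_apply_right, Function.update_of_ne]; exact fun h => hj h.symm
        · rw [Equiv.swap_apply_of_ne_of_ne hj hj2, Function.update_of_ne hj2]
    rw [this, iteratedFDeriv_perm g U hU l hg _ hk x hx, iteratedFDeriv_succ_apply_right]
    congr 2
    · ext j; simp [Fin.init, Function.update, Fin.ext_iff]; intro h; exact absurd h (by omega)
    · simp
  simp only [hterm]
  rw [Finset.sum_const]; simp [← Nat.cast_smul_eq_nsmul ℝ]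

theorem sym_diag_zero (g : E → G) (U : Set E) (hU : IsOpen U) (l : ℕ) (hg : ContDiffOn ℝ l g U)
    (k : ℕ) (hk : k ≤ l) (x : E) (hx : x ∈ U) (P : G →L[ℝ] ℝ)
    (h0 : ∀ v, P (iteratedFDeriv ℝ k g x (fun _ => v)) = 0) (m : Fin k → E) : P (iteratedFDeriv ℝ k g x m) = 0 := by
  have h := ContinuousMultilinearMap.iteratedFDeriv_comp_diagonal
    (P.compContinuousMultilinearMap (iteratedFDeriv ℝ k g x)) 0 m
  have hz : (fun v : E => (P.compContinuousMultilinearMap (iteratedFDeriv ℝ k g x)) (fun _ => v)) = fun _ => (0 : ℝ) := by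
    ext v; exact h0 v
  rw [hz] at h
  have hs : ∀ σ : Equiv.Perm (Fin k), (P.compContinuousMultilinearMap (iteratedFDeriv ℝ k g x)) (fun i => m (σ i)) =
      P (iteratedFDeriv ℝ k g x m) := by
    intro σ
    have := iteratedFDeriv_perm g U hU l hg k hk x hx m σ
    simp only [ContinuousLinearMap.compContinuousMultilinearMap_coe, Function.comp]
    exact congrArg P this
  simp only [hs, Finset.sum_const] at h
  have h3 : iteratedFDeriv ℝ k (fun _ : E => (0 : ℝ)) 0 m = 0 := by
    rw [show (fun _ : E => (0 : ℝ)) = (0 : E → ℝ) from rfl]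
    simp
  rw [h3] at h
  simpa [Fintype.card_perm, Nat.factorial_ne_zero] using h.symm

theorem taylor_bound [CompleteSpace G] (g : E → G) (n : ℕ) (x y : E) (η : ℝ)
    (hg : ∀ t ∈ Icc (0 : ℝ) 1, ContDiffAt ℝ (n + 1) g (x + t • y))
    (hη : ∀ t ∈ Icc (0 : ℝ) 1, ‖iteratedFDeriv ℝ (n + 1) g (x + t • y) - iteratedFDeriv ℝ (n + 1) g x‖ ≤ η) :
    ‖g (x + y) - ∑ k ∈ Finset.range (n + 2), (k.factorial : ℝ)⁻¹ • iteratedFDeriv ℝ k g x (fun _ => y)‖ ≤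
      η * ‖y‖ ^ (n + 1) := by
  rw [map_add_eq_sum_add_integral_iteratedFDeriv hg, Finset.sum_range_succ _ (n + 1)]
  have hη0 : 0 ≤ η := (norm_nonneg _).trans (hη 0 (by simp))
  set D := iteratedFDeriv ℝ (n + 1) g x (fun _ => y)
  have hcont : ContinuousOn (fun t : ℝ => iteratedFDeriv ℝ (n + 1) g (x + t • y) (fun _ => y)) (uIcc 0 1) := by
    intro t ht
    rw [uIcc_of_le zero_le_one] at ht
    have h_cont : ContinuousAt (iteratedFDeriv ℝ (n + 1) g) (x + t • y) :=
      ((hg t ht).iteratedFDeriv_right (i := n + 1) (m := 0) (by simp)).continuousAt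
    exact (h_cont.comp (x := t) (by fun_prop)).continuousWithinAt.eval_const _
  have hI : ∫ t in (0 : ℝ)..1, (1 - t) ^ n • D = ((n : ℝ) + 1)⁻¹ • D := by
    rw [intervalIntegral.integral_smul_const]
    congr 1
    have := intervalIntegral.integral_comp_sub_left (fun t : ℝ => t ^ n) (a := 0) (b := 1) 1
    rw [this]; simp
  have hfac : ((n + 1).factorial : ℝ)⁻¹ • D = (n.factorial : ℝ)⁻¹ • ∫ t in (0 : ℝ)..1, (1 - t) ^ n • D := by
    rw [hI, smul_smul]; congr 1; rw [Nat.factorial_succ]; push_cast; rw [mul_inv, mul_comm]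
  rw [hfac]
  have hsub : ∀ (a b c : G), a + b - (a + c) = b - c := by intros; abel
  rw [hsub, ← smul_sub, ← intervalIntegral.integral_sub]
  · rw [norm_smul]
    have h1 : ‖((n.factorial : ℝ))⁻¹‖ ≤ 1 := by
      rw [norm_inv, Real.norm_natCast]; exact inv_le_one_of_one_le₀ (by exact_mod_cast Nat.factorial_pos n)
    have h2 : ‖∫ t in (0 : ℝ)..1, ((1 - t) ^ n • (iteratedFDeriv ℝ (n + 1) g (x + t • y)) (fun _ => y) - (1 - t) ^ n • D)‖
        ≤ η * ‖y‖ ^ (n + 1) * |1 - 0| := by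
      apply intervalIntegral.norm_integral_le_of_norm_le_const
      intro t ht
      rw [uIoc_of_le zero_le_one] at ht
      rw [← smul_sub, norm_smul]
      have h3 : ‖(1 - t) ^ n‖ ≤ 1 := by
        rw [norm_pow, Real.norm_eq_abs, abs_of_nonneg (by linarith [ht.2])]
        exact pow_le_one₀ (by linarith [ht.2]) (by linarith [ht.1])
      have h4 : ‖(iteratedFDeriv ℝ (n + 1) g (x + t • y)) (fun _ => y) - D‖ ≤ η * ‖y‖ ^ (n + 1) := by
        have := ContinuousMultilinearMap.le_opNorm (iteratedFDeriv ℝ (n + 1) g (x + t • y) - iteratedFDeriv ℝ (n + 1) g x) (fun _ => y)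
        simp only [Finset.prod_const, Finset.card_univ, Fintype.card_fin] at this
        exact this.trans (by gcongr; exact hη t ⟨ht.1.le, ht.2⟩)
      calc _ ≤ 1 * (η * ‖y‖ ^ (n + 1)) := by gcongr
        _ = _ := one_mul _
    calc _ ≤ 1 * (η * ‖y‖ ^ (n + 1) * |1 - 0|) := by gcongr
      _ = _ := by simp
  · exact (ContinuousOn.smul (by fun_prop) hcont).intervalIntegrable
  · exact (Continuous.intervalIntegrable (by fun_prop) _ _)
end IterL

section Polys
open MvPolynomial

theorem mv_hasFDerivAt {d : ℕ} (p : MvPolynomial (Fin d) ℝ) (u : Fin d → ℝ) :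
    HasFDerivAt (fun u : Fin d → ℝ => eval u p)
      (∑ i, eval u (pderiv i p) • (ContinuousLinearMap.proj i : (Fin d → ℝ) →L[ℝ] ℝ)) u := by
  induction p using MvPolynomial.induction_on with
  | C a => simpa using hasFDerivAt_const a u
  | add p q hp hq =>
    simp only [map_add, add_smul, Finset.sum_add_distrib]
    exact hp.add hq
  | mul_X p j hp =>
    simp only [map_mul, eval_X, pderiv_mul, pderiv_X, map_add]
    have hX : HasFDerivAt (fun u : Fin d → ℝ => u j) (ContinuousLinearMap.proj j : (Fin d → ℝ) →L[ℝ] ℝ) u :=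
      (ContinuousLinearMap.proj j : (Fin d → ℝ) →L[ℝ] ℝ).hasFDerivAt
    have := hp.mul hX
    refine this.congr_fderiv ?_
    ext1 v
    simp only [add_apply, smul_apply, sum_apply, smul_eq_mul,
      ContinuousLinearMap.proj_apply, add_mul, Finset.sum_add_distrib, Finset.mul_sum]
    rw [add_comm]
    congr 1
    · refine Finset.sum_congr rfl fun i _ => ?_
      ring
    · rw [Finset.sum_eq_single j]
      · simp
      · intro i _ hi; rw [Pi.single_eq_of_ne hi.symm]; simp
      · simp

theorem mv_fderiv {d : ℕ} (p : MvPolynomial (Fin d) ℝ) (u : Fin d → ℝ) (j : Fin d) :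
    fderiv ℝ (fun u : Fin d → ℝ => eval u p) u (Pi.single j 1) = eval u (pderiv j p) := by
  rw [(mv_hasFDerivAt p u).fderiv]
  simp [Pi.single_apply]

theorem totalDegree_pderiv {d : ℕ} (p : MvPolynomial (Fin d) ℝ) (i : Fin d) (l : ℕ) (hp : p.totalDegree ≤ l) :
    (pderiv i p).totalDegree ≤ l - 1 := by
  refine Finset.sup_le fun m hm => ?_
  have h1 : m + Finsupp.single i 1 ∈ p.support := by
    rw [mem_support_iff] at hm ⊢
    intro h0
    rw [coeff_pderiv, h0, zero_mul] at hm
    exact hm rfl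
  have h2 := le_totalDegree h1
  rw [Finsupp.sum_add_index' (by simp) (by simp), Finsupp.sum_single_index (by simp)] at h2
  omega

/-- restriction to coordinate line -/
noncomputable def lineP {d : ℕ} (u : Fin d → ℝ) (i : Fin d) (p : MvPolynomial (Fin d) ℝ) : Polynomial ℝ :=
  aeval (fun j => if j = i then Polynomial.X else Polynomial.C (u j)) p

theorem lineP_eval {d : ℕ} (u : Fin d → ℝ) (i : Fin d) (p : MvPolynomial (Fin d) ℝ) (t : ℝ) :
    (lineP u i p).eval t = eval (Function.update u i t) p := by
  unfold lineP
  induction p using MvPolynomial.induction_on with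
  | C a => simp
  | add p q hp hq => simp [hp, hq]
  | mul_X p j hp =>
    simp only [map_mul, Polynomial.eval_mul, hp, aeval_X, eval_X]
    by_cases h : j = i
    · subst h; simp
    · simp [h]

theorem lineP_natDegree {d : ℕ} (u : Fin d → ℝ) (i : Fin d) (p : MvPolynomial (Fin d) ℝ) (l : ℕ)
    (hp : p.totalDegree ≤ l) : (lineP u i p).natDegree ≤ l := by
  have := aeval_natDegree_le (n := 1) p hp (fun j => if j = i then Polynomial.X else Polynomial.C (u j))
    (by intro j; split_ifs <;> simp)
  rw [mul_one] at this
  exact this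

theorem lineP_pderiv {d : ℕ} (u : Fin d → ℝ) (i : Fin d) (p : MvPolynomial (Fin d) ℝ) :
    lineP u i (pderiv i p) = Polynomial.derivative (lineP u i p) := by
  unfold lineP
  induction p using MvPolynomial.induction_on with
  | C a => simp
  | add p q hp hq => simp [hp, hq]
  | mul_X p j hp =>
    simp only [pderiv_mul, map_add, map_mul, hp, aeval_X, Polynomial.derivative_mul, pderiv_X]
    by_cases h : j = i
    · subst h; simp
    · simp [h]

theorem wronskian_deg (a b : Polynomial ℝ) (l : ℕ) (hl : 1 ≤ l) (ha : a.natDegree ≤ l) (hb : b.natDegree ≤ l) :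
    (a * Polynomial.derivative b - b * Polynomial.derivative a).natDegree ≤ 2 * l - 2 := by
  have hW : ∀ a b : Polynomial ℝ, a.natDegree ≤ l → b.natDegree ≤ l - 1 →
    (a * Polynomial.derivative b - b * Polynomial.derivative a).natDegree ≤ 2 * l - 2 := by
    intro a b ha hb
    have h : a * Polynomial.derivative b - b * Polynomial.derivative a = a.wronskian b := by
      rw [Polynomial.wronskian, mul_comm b]
    rw [h]
    by_cases h0 : a.wronskian b = 0
    · simp [h0]
    · have := Polynomial.natDegree_wronskian_lt_add h0
      omega
  by_cases ha' : a.coeff l = 0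
  · have : a.natDegree ≤ l - 1 := by
      rw [Polynomial.natDegree_le_iff_coeff_eq_zero]
      intro N hN
      rcases Nat.lt_or_ge l N with h | h
      · exact Polynomial.coeff_eq_zero_of_natDegree_lt (by omega)
      · rwa [show N = l by omega]
    have h2 := hW b a hb this
    rw [← neg_sub, Polynomial.natDegree_neg]; exact h2
  · set c := b.coeff l / a.coeff l
    have h : (b - Polynomial.C c * a).natDegree ≤ l - 1 := by
      rw [Polynomial.natDegree_le_iff_coeff_eq_zero]
      intro N hN
      rcases Nat.lt_or_ge l N with h | h
      · rw [Polynomial.coeff_sub, Polynomial.coeff_C_mul, Polynomial.coeff_eq_zero_of_natDegree_lt (p := b) (by omega),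
          Polynomial.coeff_eq_zero_of_natDegree_lt (p := a) (by omega)]; simp
      · rw [show N = l by omega, Polynomial.coeff_sub, Polynomial.coeff_C_mul]
        simp only [c]; field_simp; ring
    have h2 := hW a _ ha h
    convert h2 using 2
    simp only [Polynomial.derivative_sub, Polynomial.derivative_C_mul]
    ring

/-- the skew polynomial -/
noncomputable def skewP {d : ℕ} (i : Fin d) (p q : MvPolynomial (Fin d) ℝ) : MvPolynomial (Fin d) ℝ :=
  p * pderiv i q - q * pderiv i p

def skewDeg (d l : ℕ) (i j : Fin d) : ℕ := if j = i then 2 * l - 2 else 2 * l - 1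

theorem skewDeg_sum (d l : ℕ) (hl : 1 ≤ l) (i : Fin d) : ∑ j, skewDeg d l i j = d * (2 * l - 1) - 1 := by
  have h : ∑ j, (skewDeg d l i j + if j = i then 1 else 0) = ∑ j : Fin d, (2 * l - 1) := by
    refine Finset.sum_congr rfl fun j _ => ?_
    unfold skewDeg; split_ifs <;> omega
  rw [Finset.sum_add_distrib] at h
  simp at h
  omega

theorem skewP_line {d l : ℕ} (hl : 1 ≤ l) (i : Fin d) (p q : MvPolynomial (Fin d) ℝ) (hp : p.totalDegree ≤ l)
    (hq : q.totalDegree ≤ l) (u : Fin d → ℝ) (j : Fin d) :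
    (lineP u j (skewP i p q)).natDegree ≤ skewDeg d l i j := by
  unfold skewDeg
  split_ifs with h
  · subst h
    have : lineP u j (skewP j p q) = lineP u j p * Polynomial.derivative (lineP u j q) -
        lineP u j q * Polynomial.derivative (lineP u j p) := by
      rw [← lineP_pderiv, ← lineP_pderiv]; simp [skewP, lineP]
    rw [this]
    exact wronskian_deg _ _ l hl (lineP_natDegree u j p l hp) (lineP_natDegree u j q l hq)
  · apply lineP_natDegree
    unfold skewP
    refine (totalDegree_sub _ _).trans (max_le ?_ ?_)
    · refine (totalDegree_mul _ _).trans ?_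
      have := totalDegree_pderiv q i l hq
      omega
    · refine (totalDegree_mul _ _).trans ?_
      have := totalDegree_pderiv p i l hp
      omega

abbrev QQ (d : ℕ) := Metric.closedBall (0 : Fin d → ℝ) 1

instance (d : ℕ) : CompactSpace (QQ d) := isCompact_iff_compactSpace.1 (isCompact_closedBall _ _)

noncomputable def toC (d : ℕ) : MvPolynomial (Fin d) ℝ →ₗ[ℝ] C(QQ d, ℝ) where
  toFun p := ⟨fun u => eval u.1 p, (MvPolynomial.continuous_eval p).comp continuous_subtype_val⟩
  map_add' p q := by ext; simp
  map_smul' c p := by ext; simp [smul_eval]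

theorem toC_apply {d : ℕ} (p : MvPolynomial (Fin d) ℝ) (u : QQ d) : toC d p u = eval u.1 p := rfl

theorem mv_zero_of_ball {d : ℕ} (p : MvPolynomial (Fin d) ℝ) (x : Fin d → ℝ) (r : ℝ) (hr : 0 < r)
    (h : ∀ u ∈ Metric.ball x r, eval u p = 0) : p = 0 := by
  refine MvPolynomial.funext_set (fun i => Metric.ball (x i) r) ?_ ?_
  · intro i; rw [Real.ball_eq_Ioo]; exact Ioo_infinite (by linarith)
  · intro u hu
    rw [map_zero]
    apply h
    rw [ball_pi _ hr]; exact hu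

theorem toC_inj {d : ℕ} : Function.Injective (toC d) := by
  rw [injective_iff_map_eq_zero]
  intro p hp
  apply mv_zero_of_ball p 0 1 one_pos
  intro u hu
  have := DFunLike.congr_fun hp ⟨u, Metric.ball_subset_closedBall hu⟩
  exact this

theorem skew_zero {d : ℕ} (p q : MvPolynomial (Fin d) ℝ) (h : ∀ i, toC d (skewP i p q) = 0) (hq : q ≠ 0) :
    ∃ β : ℝ, p = β • q := by
  have hsk : ∀ i, skewP i p q = 0 := fun i => toC_inj (by rw [h i, map_zero])
  obtain ⟨u0, hu0⟩ : ∃ u, eval u q ≠ 0 := by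
    by_contra hc
    push Not at hc
    exact hq (MvPolynomial.funext fun u => by rw [hc u, map_zero])
  have hopen : IsOpen {u | eval u q ≠ 0} := isOpen_ne_fun (MvPolynomial.continuous_eval q) continuous_const
  obtain ⟨r, hr, hball⟩ := Metric.isOpen_iff.1 hopen u0 hu0
  have hder : ∀ u ∈ Metric.ball u0 r, HasFDerivAt (fun u => eval u p / eval u q) (0 : (Fin d → ℝ) →L[ℝ] ℝ) u := by
    intro u hu
    have hne : eval u q ≠ 0 := hball hu
    have := (mv_hasFDerivAt p u).mul ((hasDerivAt_inv hne).comp_hasFDerivAt u (mv_hasFDerivAt q u))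
    refine this.congr_fderiv ?_
    ext1 v
    have hz : ∀ i, eval u p * eval u (pderiv i q) = eval u q * eval u (pderiv i p) := by
      intro i
      have := congrArg (eval u) (hsk i)
      simp only [skewP, map_sub, map_mul, map_zero] at this
      linarith
    simp only [zero_apply, smul_apply, add_apply,
      sum_apply, smul_eq_mul, Finset.mul_sum, ContinuousLinearMap.proj_apply, Function.comp]
    rw [← Finset.sum_add_distrib, Finset.sum_eq_zero]
    intro i _
    have := hz i
    field_simp
    linear_combination -(v i) * (hz i)
  obtain ⟨β, hβ⟩ := Metric.isOpen_ball.exists_is_const_of_fderiv_eq_zero (𝕜 := ℝ) (convex_ball u0 r).isPreconnected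
    (fun u hu => (hder u hu).differentiableAt.differentiableWithinAt) (fun u hu => (hder u hu).fderiv)
  refine ⟨β, ?_⟩
  rw [← sub_eq_zero]
  apply mv_zero_of_ball _ u0 r hr
  intro u hu
  have h1 := hβ u hu
  have hne : eval u q ≠ 0 := hball hu
  rw [div_eq_iff hne] at h1
  simp [smul_eval, h1]

theorem abs_markov {X : Type*} [NormedRing X] [NormedAlgebra ℝ X] (W : Submodule ℝ X) [FiniteDimensional ℝ W]
    {J : Type*} [Fintype J] (D : J → W →ₗ[ℝ] X) : ∃ C : ℝ, 0 < C ∧ ∀ i a, ‖D i a‖ ≤ C * ‖a‖ := by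
  refine ⟨1 + ∑ i, ‖LinearMap.toContinuousLinearMap (D i)‖, by positivity, fun i a => ?_⟩
  have h := ContinuousLinearMap.le_opNorm (LinearMap.toContinuousLinearMap (D i)) a
  rw [LinearMap.coe_toContinuousLinearMap'] at h
  have h2 : ‖LinearMap.toContinuousLinearMap (D i)‖ ≤ ∑ i, ‖LinearMap.toContinuousLinearMap (D i)‖ :=
    Finset.single_le_sum (f := fun i => ‖LinearMap.toContinuousLinearMap (D i)‖)
      (fun _ _ => ContinuousLinearMap.opNorm_nonneg _) (Finset.mem_univ i)
  refine h.trans ?_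
  gcongr
  linarith

theorem abs_skew {X : Type*} [NormedRing X] [NormedAlgebra ℝ X] (W : Submodule ℝ X) [FiniteDimensional ℝ W]
    {J : Type*} [Fintype J] (D : J → W →ₗ[ℝ] X)
    (hz : ∀ a b : W, b ≠ 0 → (∀ i, (a : X) * D i b - b * D i a = 0) → ∃ β : ℝ, a = β • b) :
    ∃ c : ℝ, 0 < c ∧ ∀ a b : W, (∀ β : ℝ, ‖a‖ / 2 ≤ ‖a - β • b‖) →
      c * (‖a‖ * ‖b‖) ≤ ∑ i, ‖(a : X) * D i b - b * D i a‖ := by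
  have : ProperSpace W := FiniteDimensional.proper ℝ _
  set G : W × W → ℝ := fun w => ∑ i, ‖(w.1 : X) * D i w.2 - (w.2 : X) * D i w.1‖ with hG
  have hcd : ∀ i, Continuous (D i) := fun i => LinearMap.continuous_of_finiteDimensional _
  have hGc : Continuous G := by
    refine continuous_finsetSum _ fun i _ => ?_
    refine Continuous.norm ?_
    exact ((continuous_subtype_val.comp continuous_fst).mul ((hcd i).comp continuous_snd)).sub
      ((continuous_subtype_val.comp continuous_snd).mul ((hcd i).comp continuous_fst))
  set K : Set (W × W) := {w | ‖w.1‖ = 1 ∧ ‖w.2‖ = 1 ∧ ∀ β : ℝ, 1 / 2 ≤ ‖w.1 - β • w.2‖} with hK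
  have hKc : IsCompact K := by
    refine (isCompact_closedBall (0 : W × W) 1).of_isClosed_subset ?_ ?_
    · have : K = {w | ‖w.1‖ = 1} ∩ ({w | ‖w.2‖ = 1} ∩ ⋂ β : ℝ, {w | 1 / 2 ≤ ‖w.1 - β • w.2‖}) := by
        ext w; simp only [hK, mem_inter_iff, mem_iInter]; rfl
      rw [this]
      refine (isClosed_eq (by fun_prop) (by fun_prop)).inter ((isClosed_eq (by fun_prop) (by fun_prop)).inter
        (isClosed_iInter fun β => isClosed_le (by fun_prop) (by fun_prop)))
    · rintro ⟨a, b⟩ ⟨h1, h2, -⟩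
      rw [mem_closedBall_zero_iff, Prod.norm_def]
      exact max_le h1.le h2.le
  have hpos : ∀ w ∈ K, 0 < G w := by
    rintro ⟨a, b⟩ ⟨h1, h2, h3⟩
    refine lt_of_le_of_ne (Finset.sum_nonneg fun _ _ => norm_nonneg _) fun h0 => ?_
    rw [eq_comm, Finset.sum_eq_zero_iff_of_nonneg (fun _ _ => norm_nonneg _)] at h0
    obtain ⟨β, hβ⟩ := hz a b (by intro hb; rw [hb] at h2; simp at h2)
      (fun i => norm_eq_zero.1 (h0 i (Finset.mem_univ _)))
    have h4 := h3 β
    simp only [hβ, sub_self, norm_zero] at h4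
    linarith
  obtain ⟨c, hc, hcK⟩ : ∃ c : ℝ, 0 < c ∧ ∀ w ∈ K, c ≤ G w := by
    rcases K.eq_empty_or_nonempty with h | h
    · exact ⟨1, one_pos, by simp [h]⟩
    · obtain ⟨w, hw, hmin⟩ := hKc.exists_isMinOn h hGc.continuousOn
      exact ⟨G w, hpos w hw, fun v hv => hmin hv⟩
  refine ⟨c, hc, fun a b hβ => ?_⟩
  have hn : 0 ≤ ∑ i, ‖(a : X) * D i b - b * D i a‖ := Finset.sum_nonneg fun _ _ => norm_nonneg _
  by_cases hp0 : ‖a‖ = 0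
  · rw [hp0]; simpa using hn
  by_cases hq0 : ‖b‖ = 0
  · rw [hq0]; simpa using hn
  have hp1 : 0 < ‖a‖ := lt_of_le_of_ne (norm_nonneg _) (Ne.symm hp0)
  have hq1 : 0 < ‖b‖ := lt_of_le_of_ne (norm_nonneg _) (Ne.symm hq0)
  have hmem : (‖a‖⁻¹ • a, ‖b‖⁻¹ • b) ∈ K := by
    refine ⟨?_, ?_, fun β => ?_⟩
    · simp only; rw [norm_smul, norm_inv, norm_norm, inv_mul_cancel₀ hp0]
    · simp only; rw [norm_smul, norm_inv, norm_norm, inv_mul_cancel₀ hq0]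
    · have h := hβ (‖a‖ * β * ‖b‖⁻¹)
      have e : ‖a‖⁻¹ • a - β • ‖b‖⁻¹ • b = ‖a‖⁻¹ • (a - (‖a‖ * β * ‖b‖⁻¹) • b) := by
        simp only [smul_sub, smul_smul]
        congr 2
        field_simp
      simp only
      rw [e, norm_smul, norm_inv, norm_norm, inv_mul_eq_div, le_div_iff₀ hp1]
      linarith
  have h1 := hcK _ hmem
  have h2 : G (‖a‖⁻¹ • a, ‖b‖⁻¹ • b) = (‖a‖ * ‖b‖)⁻¹ * ∑ i, ‖(a : X) * D i b - b * D i a‖ := by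
    simp only [hG, Finset.mul_sum]
    refine Finset.sum_congr rfl fun i _ => ?_
    have : (‖a‖⁻¹ • a : W) * D i (‖b‖⁻¹ • b) - (‖b‖⁻¹ • b : W) * D i (‖a‖⁻¹ • a) =
        (‖a‖ * ‖b‖)⁻¹ • ((a : X) * D i b - b * D i a) := by
      simp only [map_smul, Submodule.coe_smul, smul_mul_smul_comm, smul_sub, mul_inv]
      rw [mul_comm ‖b‖⁻¹]
    rw [this, norm_smul, norm_inv, norm_mul, norm_norm, norm_norm]
  rw [h2, inv_mul_eq_div, le_div_iff₀ (by positivity)] at h1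
  exact h1

/-- polynomials of degree at most l as functions on the unit cube -/
noncomputable def PP (d l : ℕ) : Submodule ℝ C(QQ d, ℝ) :=
  (restrictTotalDegree (Fin d) ℝ l).map (toC d)

instance (d l : ℕ) : FiniteDimensional ℝ (PP d l) := by
  unfold PP; infer_instance

noncomputable def PPe (d l : ℕ) : restrictTotalDegree (Fin d) ℝ l ≃ₗ[ℝ] PP d l :=
  Submodule.equivMapOfInjective (toC d) toC_inj _

noncomputable def PPd (d l : ℕ) (i : Fin d) : PP d l →ₗ[ℝ] C(QQ d, ℝ) :=
  (toC d) ∘ₗ (pderiv i : Derivation ℝ (MvPolynomial (Fin d) ℝ) (MvPolynomial (Fin d) ℝ)).toLinearMap ∘ₗ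
    (Submodule.subtype _) ∘ₗ (PPe d l).symm.toLinearMap

theorem PPd_apply {d l : ℕ} (i : Fin d) (p : restrictTotalDegree (Fin d) ℝ l) :
    PPd d l i (PPe d l p) = toC d (pderiv i p.1) := by
  simp [PPd]

theorem PPe_coe {d l : ℕ} (p : restrictTotalDegree (Fin d) ℝ l) :
    ((PPe d l p : PP d l) : C(QQ d, ℝ)) = toC d p.1 := rfl

/-- Markov inequality -/
theorem markov (d l : ℕ) : ∃ C : ℝ, 0 < C ∧ ∀ p : MvPolynomial (Fin d) ℝ, p.totalDegree ≤ l → ∀ i,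
    ‖toC d (pderiv i p)‖ ≤ C * ‖toC d p‖ := by
  obtain ⟨C, hC, h⟩ := abs_markov (PP d l) (PPd d l)
  refine ⟨C, hC, fun p hp i => ?_⟩
  have := h i (PPe d l ⟨p, (mem_restrictTotalDegree _ _ _).2 hp⟩)
  rw [PPd_apply] at this
  exact this

theorem skew_lower (d l : ℕ) (hd : 1 ≤ d) : ∃ c : ℝ, 0 < c ∧ ∀ p q : MvPolynomial (Fin d) ℝ, p.totalDegree ≤ l →
    q.totalDegree ≤ l → (∀ β : ℝ, ‖toC d p‖ / 2 ≤ ‖toC d (p - β • q)‖) →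
    ∃ i, c * (‖toC d p‖ * ‖toC d q‖) ≤ ‖toC d (skewP i p q)‖ := by
  have hsk : ∀ (a b : restrictTotalDegree (Fin d) ℝ l) i, (PPe d l a : C(QQ d, ℝ)) * PPd d l i (PPe d l b) -
      PPe d l b * PPd d l i (PPe d l a) = toC d (skewP i a.1 b.1) := by
    intro a b i
    rw [PPd_apply, PPd_apply]
    ext u
    simp [toC_apply, skewP, PPe_coe]
  obtain ⟨c, hc, h⟩ := abs_skew (PP d l) (PPd d l) (by
    intro a b hb h
    obtain ⟨a, rfl⟩ := (PPe d l).surjective a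
    obtain ⟨b, rfl⟩ := (PPe d l).surjective b
    obtain ⟨β, hβ⟩ := skew_zero a.1 b.1 (fun i => by rw [← hsk]; exact h i) (by
      intro hb'
      apply hb
      rw [show b = 0 from Subtype.ext hb', map_zero])
    refine ⟨β, ?_⟩
    rw [show a = β • b from Subtype.ext hβ, map_smul])
  have hd0 : (0 : ℝ) < d := by exact_mod_cast hd
  refine ⟨c / d, by positivity, fun p q hp hq hβ => ?_⟩
  have i0 : Fin d := ⟨0, hd⟩
  have h1 := h (PPe d l ⟨p, (mem_restrictTotalDegree _ _ _).2 hp⟩) (PPe d l ⟨q, (mem_restrictTotalDegree _ _ _).2 hq⟩) (by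
    intro β
    have := hβ β
    rw [map_sub, map_smul] at this
    exact this)
  simp only [hsk] at h1
  change c * (‖toC d p‖ * ‖toC d q‖) ≤ _ at h1
  by_contra hcon
  push Not at hcon
  have h3 : ∑ i, ‖toC d (skewP i p q)‖ < ∑ i : Fin d, c / d * (‖toC d p‖ * ‖toC d q‖) :=
    Finset.sum_lt_sum_of_nonempty ⟨i0, Finset.mem_univ _⟩ fun i _ => hcon i
  have h4 : ∑ i : Fin d, c / (d : ℝ) * (‖toC d p‖ * ‖toC d q‖) = c * (‖toC d p‖ * ‖toC d q‖) := by
    simp; field_simp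
  rw [h4] at h3
  exact absurd h1 (not_le.2 h3)
end Polys

section Approx
open MvPolynomial

def ApproxAt {d : ℕ} {ι : Type} [Fintype ι] (F : (Fin d → ℝ) → ι → ℝ) (l : ℕ) (x0 : Fin d → ℝ) : Prop :=
  ∃ c0 : ℝ, 0 < c0 ∧ ∀ η : ℝ, 0 < η → ∃ ρ : ℝ, 0 < ρ ∧ ∀ x ∈ Metric.ball x0 ρ, ∀ R : ℝ, 0 < R → R < ρ →
    ∃ p : ι → MvPolynomial (Fin d) ℝ, (∀ i, (p i).totalDegree ≤ l) ∧
      (∀ u ∈ Metric.closedBall (0 : Fin d → ℝ) 1, ∀ i, |F (x + R • u) i - eval u (p i)| ≤ η * R ^ l) ∧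
      (∀ u ∈ Metric.closedBall (0 : Fin d → ℝ) 1, ∀ i j,
        |R * fderiv ℝ F (x + R • u) (Pi.single j 1) i - eval u (pderiv j (p i))| ≤ η * R ^ l) ∧
      ∀ c : ι → ℝ, c0 * R ^ l * ‖c‖ ≤ ‖toC d (∑ i, c i • p i)‖

noncomputable def diagPoly {d k : ℕ} {ι : Type} [Fintype ι]
    (A : ContinuousMultilinearMap ℝ (fun _ : Fin k => (Fin d → ℝ)) (ι → ℝ)) (i : ι) : MvPolynomial (Fin d) ℝ :=
  ∑ β : Fin k → Fin d, C (A (fun a => Pi.single (β a) 1) i) * ∏ a, X (β a)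

theorem diagPoly_eval {d k : ℕ} {ι : Type} [Fintype ι]
    (A : ContinuousMultilinearMap ℝ (fun _ : Fin k => (Fin d → ℝ)) (ι → ℝ)) (i : ι) (u : Fin d → ℝ) :
    eval u (diagPoly A i) = A (fun _ => u) i := by
  have hu : u = ∑ j, u j • (Pi.single j 1 : Fin d → ℝ) := by
    ext a; simp [Finset.sum_apply, Pi.single_apply]
  conv_rhs => rw [hu]
  have h := A.map_sum (fun (_ : Fin k) (j : Fin d) => u j • (Pi.single j 1 : Fin d → ℝ))
  rw [h]
  simp only [ContinuousMultilinearMap.map_smul_univ, Finset.sum_apply, Pi.smul_apply, smul_eq_mul]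
  simp only [diagPoly, map_sum, map_mul, eval_C, map_prod, eval_X]
  refine Finset.sum_congr rfl fun β _ => ?_
  rw [mul_comm]

theorem diagPoly_deg {d k : ℕ} {ι : Type} [Fintype ι]
    (A : ContinuousMultilinearMap ℝ (fun _ : Fin k => (Fin d → ℝ)) (ι → ℝ)) (i : ι) :
    (diagPoly A i).totalDegree ≤ k := by
  refine totalDegree_finsetSum_le fun β _ => ?_
  refine (totalDegree_mul _ _).trans ?_
  rw [totalDegree_C, zero_add]
  refine (totalDegree_finsetProd _ _).trans ?_
  simp [totalDegree_X]

noncomputable def taylorP {d : ℕ} {ι : Type} [Fintype ι] (F : (Fin d → ℝ) → ι → ℝ) (l : ℕ) (x : Fin d → ℝ) (R : ℝ)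
    (i : ι) : MvPolynomial (Fin d) ℝ :=
  ∑ k ∈ Finset.range (l + 1), C ((k.factorial : ℝ)⁻¹ * R ^ k) * diagPoly (iteratedFDeriv ℝ k F x) i

theorem taylorP_eval {d : ℕ} {ι : Type} [Fintype ι] (F : (Fin d → ℝ) → ι → ℝ) (l : ℕ) (x : Fin d → ℝ) (R : ℝ)
    (i : ι) (u : Fin d → ℝ) : eval u (taylorP F l x R i) =
      ∑ k ∈ Finset.range (l + 1), ((k.factorial : ℝ)⁻¹ * R ^ k) * iteratedFDeriv ℝ k F x (fun _ => u) i := by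
  simp only [taylorP, map_sum, map_mul, eval_C, diagPoly_eval]

theorem diag_smul {d k : ℕ} {G : Type*} [NormedAddCommGroup G] [NormedSpace ℝ G]
    (A : ContinuousMultilinearMap ℝ (fun _ : Fin k => (Fin d → ℝ)) G) (R : ℝ) (u : Fin d → ℝ) :
    A (fun _ => R • u) = R ^ k • A (fun _ => u) := by
  have := A.map_smul_univ (fun _ => R) (fun _ => u)
  simpa using this

theorem taylorP_deg {d : ℕ} {ι : Type} [Fintype ι] (F : (Fin d → ℝ) → ι → ℝ) (l : ℕ) (x : Fin d → ℝ) (R : ℝ)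
    (i : ι) : (taylorP F l x R i).totalDegree ≤ l := by
  refine totalDegree_finsetSum_le fun k hk => ?_
  refine (totalDegree_mul _ _).trans ?_
  rw [totalDegree_C, zero_add]
  have := Finset.mem_range.1 hk
  exact (diagPoly_deg _ i).trans (by omega)

theorem taylorP_pderiv {d : ℕ} {ι : Type} [Fintype ι] (F : (Fin d → ℝ) → ι → ℝ) (V : Set (Fin d → ℝ)) (hV : IsOpen V)
    (l : ℕ) (hF : ContDiffOn ℝ l F V) (x : Fin d → ℝ) (hx : x ∈ V) (R : ℝ)
    (i : ι) (u : Fin d → ℝ) (j : Fin d) : eval u (pderiv j (taylorP F l x R i)) =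
      R * (∑ k ∈ Finset.range l, (k.factorial : ℝ)⁻¹ • iteratedFDeriv ℝ k (fderiv ℝ F) x (fun _ => R • u)) (Pi.single j 1) i := by
  rw [← mv_fderiv]
  have hdiff : ∀ k, Differentiable ℝ (fun u : Fin d → ℝ => iteratedFDeriv ℝ k F x (fun _ => u)) := by
    intro k u
    exact ((iteratedFDeriv ℝ k F x).hasFDerivAt (fun _ => u)).differentiableAt.comp u
      ((ContinuousLinearMap.pi (fun _ : Fin k => ContinuousLinearMap.id ℝ (Fin d → ℝ))).differentiableAt)
  have h1 : ∀ k, HasFDerivAt (fun u : Fin d → ℝ => ((k.factorial : ℝ)⁻¹ * R ^ k) * iteratedFDeriv ℝ k F x (fun _ => u) i)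
      (((k.factorial : ℝ)⁻¹ * R ^ k) • (ContinuousLinearMap.proj i ∘L fderiv ℝ (fun u : Fin d → ℝ => iteratedFDeriv ℝ k F x (fun _ => u)) u)) u := by
    intro k
    refine HasFDerivAt.const_mul ?_ _
    exact (ContinuousLinearMap.proj (R := ℝ) (φ := fun _ : ι => ℝ) i).hasFDerivAt.comp u (hdiff k u).hasFDerivAt
  have h2 := HasFDerivAt.fun_sum (u := Finset.range (l + 1)) (fun k _ => h1 k)
  simp only [taylorP_eval]
  rw [h2.fderiv, sum_apply]
  rw [Finset.sum_range_succ']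
  have h0 : fderiv ℝ (fun u : Fin d → ℝ => iteratedFDeriv ℝ 0 F x (fun _ => u)) u = 0 := by
    simp [iteratedFDeriv_zero_apply]
  rw [h0]
  simp only [ContinuousLinearMap.comp_zero, smul_zero, zero_apply, add_zero]
  rw [sum_apply, Finset.sum_apply, Finset.mul_sum]
  refine Finset.sum_congr rfl fun k hk => ?_
  have hk' := Finset.mem_range.1 hk
  simp only [smul_apply, ContinuousLinearMap.comp_apply, ContinuousLinearMap.proj_apply]
  rw [iteratedFDeriv_diag_hasFDerivAt F V hV l hF k (by omega) x hx, diag_smul]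
  simp only [smul_apply, Pi.smul_apply, smul_eq_mul]
  rw [Nat.factorial_succ, pow_succ]
  push_cast
  field_simp

theorem coef_bound (l : ℕ) : ∃ m : ℝ, 0 < m ∧ ∀ (a : ℕ → ℝ) (k : ℕ), k ≤ l → ∃ t ∈ Icc (0 : ℝ) 1,
    m * |a k| ≤ |∑ k ∈ Finset.range (l + 1), a k * t ^ k| := by
  let T : (Fin (l + 1) → ℝ) →ₗ[ℝ] C(Icc (0 : ℝ) 1, ℝ) :=
    { toFun := fun a => ⟨fun t => ∑ k, a k * (t : ℝ) ^ (k : ℕ), by fun_prop⟩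
      map_add' := by intro a b; ext t; simp [add_mul, Finset.sum_add_distrib]
      map_smul' := by intro c a; ext t; simp [Finset.mul_sum, mul_assoc] }
  have hT : LinearMap.ker T = ⊥ := by
    rw [LinearMap.ker_eq_bot']
    intro a ha
    set P : Polynomial ℝ := ∑ k : Fin (l + 1), Polynomial.monomial (k : ℕ) (a k) with hP
    have hev : ∀ t ∈ Icc (0 : ℝ) 1, P.eval t = 0 := by
      intro t ht
      have := DFunLike.congr_fun ha ⟨t, ht⟩
      simpa [hP, Polynomial.eval_finsetSum, Polynomial.eval_monomial, T] using this
    have hP0 : P = 0 := Polynomial.eq_zero_of_infinite_isRoot P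
      ((Icc_infinite (zero_lt_one (α := ℝ))).mono fun t ht => hev t ht)
    ext k
    have h := congrArg (fun q => Polynomial.coeff q (k : ℕ)) hP0
    simp only [hP, Polynomial.finsetSum_coeff, Polynomial.coeff_monomial, Polynomial.coeff_zero] at h
    rw [Finset.sum_eq_single k] at h
    · simpa using h
    · intro b _ hb; rw [if_neg]; exact fun h => hb (Fin.ext h)
    · simp
  obtain ⟨K, hK, hanti⟩ := T.exists_antilipschitzWith hT
  have hK' : (0 : ℝ) < K := hK
  refine ⟨(K : ℝ)⁻¹, by positivity, fun a k hk => ?_⟩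
  set b : Fin (l + 1) → ℝ := fun k => a k
  have h1' : ‖b‖ ≤ K * ‖T b‖ := by simpa [dist_zero_right] using hanti.le_mul_dist b 0
  have hne : Nonempty (Icc (0 : ℝ) 1) := ⟨⟨0, by simp⟩⟩
  obtain ⟨t, -, ht⟩ := (isCompact_univ (X := Icc (0 : ℝ) 1)).exists_isMaxOn univ_nonempty
    (continuous_norm.comp (T b).continuous).continuousOn
  have hmax : ‖T b‖ ≤ ‖T b t‖ := by
    rw [ContinuousMap.norm_le _ (norm_nonneg _)]
    intro s; exact ht (mem_univ s)
  refine ⟨t, t.2, ?_⟩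
  have hk2 : |a k| ≤ ‖b‖ := by
    have := norm_le_pi_norm b ⟨k, by omega⟩
    exact this
  have e : T b t = ∑ k ∈ Finset.range (l + 1), a k * (t : ℝ) ^ k := by
    rw [Finset.sum_range]; rfl
  rw [← e, inv_mul_le_iff₀ hK']
  calc |a k| ≤ _ := hk2
    _ ≤ _ := h1'
    _ ≤ _ := by gcongr; exact hmax

theorem nd_uniform {d : ℕ} {ι : Type} [Fintype ι] (F : (Fin d → ℝ) → ι → ℝ) (l : ℕ) (x0 : Fin d → ℝ)
    (hF : ContDiffAt ℝ l F x0)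
    (hnd : ∀ c : ι → ℝ, c ≠ 0 → ∃ k ≤ l, ∃ v, ∑ i, c i * iteratedFDeriv ℝ k F x0 (fun _ => v) i ≠ 0) :
    ∃ δ : ℝ, 0 < δ ∧ ∃ ρ : ℝ, 0 < ρ ∧ ∀ x ∈ Metric.ball x0 ρ, ∀ c ∈ Metric.sphere (0 : ι → ℝ) 1, ∃ k ≤ l,
      ∃ v ∈ Metric.closedBall (0 : Fin d → ℝ) 1, δ ≤ |∑ i, c i * iteratedFDeriv ℝ k F x (fun _ => v) i| := by
  refine (isCompact_sphere (0 : ι → ℝ) 1).induction_on (p := fun S => ∃ δ : ℝ, 0 < δ ∧ ∃ ρ : ℝ, 0 < ρ ∧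
    ∀ x ∈ Metric.ball x0 ρ, ∀ c ∈ S, ∃ k ≤ l,
      ∃ v ∈ Metric.closedBall (0 : Fin d → ℝ) 1, δ ≤ |∑ i, c i * iteratedFDeriv ℝ k F x (fun _ => v) i|) ?_ ?_ ?_ ?_
  · exact ⟨1, one_pos, 1, one_pos, by simp⟩
  · rintro s t hst ⟨δ, hδ, ρ, hρ, h⟩
    exact ⟨δ, hδ, ρ, hρ, fun x hx c hc => h x hx c (hst hc)⟩
  · rintro s t ⟨δ, hδ, ρ, hρ, h⟩ ⟨δ', hδ', ρ', hρ', h'⟩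
    refine ⟨min δ δ', lt_min hδ hδ', min ρ ρ', lt_min hρ hρ', fun x hx c hc => ?_⟩
    rcases hc with hc | hc
    · obtain ⟨k, hk, v, hv, hh⟩ := h x (Metric.ball_subset_ball (min_le_left _ _) hx) c hc
      exact ⟨k, hk, v, hv, (min_le_left _ _).trans hh⟩
    · obtain ⟨k, hk, v, hv, hh⟩ := h' x (Metric.ball_subset_ball (min_le_right _ _) hx) c hc
      exact ⟨k, hk, v, hv, (min_le_right _ _).trans hh⟩
  · intro c hc
    have hc0 : c ≠ 0 := by rintro rfl; simp at hc
    obtain ⟨k, hk, v, hv⟩ := hnd c hc0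
    obtain ⟨w, hw, hw2⟩ : ∃ w ∈ Metric.closedBall (0 : Fin d → ℝ) 1,
        ∑ i, c i * iteratedFDeriv ℝ k F x0 (fun _ => w) i ≠ 0 := by
      refine ⟨(1 + ‖v‖)⁻¹ • v, ?_, ?_⟩
      · rw [mem_closedBall_zero_iff, norm_smul, norm_inv, Real.norm_of_nonneg (by positivity), inv_mul_le_iff₀ (by positivity)]
        linarith
      · rw [diag_smul]
        have : ∀ i, c i * ((1 + ‖v‖)⁻¹ ^ k • iteratedFDeriv ℝ k F x0 (fun _ => v)) i =
            (1 + ‖v‖)⁻¹ ^ k * (c i * iteratedFDeriv ℝ k F x0 (fun _ => v) i) := by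
          intro i; simp only [Pi.smul_apply, smul_eq_mul]; ring
        simp only [this, ← Finset.mul_sum]
        exact mul_ne_zero (by positivity) hv
    have hcont : ContinuousAt (fun z : (Fin d → ℝ) × (ι → ℝ) => |∑ i, z.2 i * iteratedFDeriv ℝ k F z.1 (fun _ => w) i|) (x0, c) := by
      have h1 : ContinuousAt (iteratedFDeriv ℝ k F) x0 :=
        (hF.iteratedFDeriv_right (m := 0) (i := k) (by simpa using hk)).continuousAt
      have h2 : ContinuousAt (fun z : (Fin d → ℝ) × (ι → ℝ) => iteratedFDeriv ℝ k F z.1 (fun _ => w)) (x0, c) :=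
        ((ContinuousMultilinearMap.apply ℝ (fun _ : Fin k => (Fin d → ℝ)) (ι → ℝ) (fun _ => w)).continuous.continuousAt).comp
          (ContinuousAt.comp (f := Prod.fst) (x := (x0, c)) h1 continuousAt_fst)
      refine ContinuousAt.abs ?_
      refine tendsto_finsetSum _ fun i _ => ?_
      refine Tendsto.mul ?_ ?_
      · exact ((continuous_apply i).comp continuous_snd).continuousAt
      · exact ((continuous_apply i).continuousAt).comp h2
    set δ := |∑ i, c i * iteratedFDeriv ℝ k F x0 (fun _ => w) i| / 2 with hδ
    have hδ0 : 0 < δ := by have := abs_pos.2 hw2; positivity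
    have hev : ∀ᶠ z : (Fin d → ℝ) × (ι → ℝ) in nhds (x0, c), δ < |∑ i, z.2 i * iteratedFDeriv ℝ k F z.1 (fun _ => w) i| := by
      apply hcont.eventually_const_lt
      simp only [hδ]
      have := abs_pos.2 hw2
      linarith
    rw [nhds_prod_eq] at hev
    obtain ⟨pa, hpa, pb, hpb, hab⟩ := Filter.eventually_prod_iff.1 hev
    obtain ⟨ρ, hρ, hball⟩ := Metric.eventually_nhds_iff_ball.1 hpa
    exact ⟨{c | pb c}, nhdsWithin_le_nhds hpb, δ, hδ0, ρ, hρ, fun x hx c' hc' =>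
      ⟨k, hk, w, hw, (hab (hball x hx) hc').le⟩⟩

theorem approxAt_of_nd {d : ℕ} {ι : Type} [Fintype ι] (F : (Fin d → ℝ) → ι → ℝ) (V : Set (Fin d → ℝ)) (hV : IsOpen V)
    (l : ℕ) (hl : 2 ≤ l) (hF : ContDiffOn ℝ l F V) (x0 : Fin d → ℝ) (hx0 : x0 ∈ V)
    (hnd : ∀ c : ι → ℝ, c ≠ 0 → ∃ k ≤ l, ∃ v, ∑ i, c i * iteratedFDeriv ℝ k F x0 (fun _ => v) i ≠ 0) :
    ApproxAt F l x0 := by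
  have hFat : ∀ x ∈ V, ContDiffAt ℝ l F x := fun x hx => hF.contDiffAt (hV.mem_nhds hx)
  obtain ⟨δ, hδ, ρ1, hρ1, hlow⟩ := nd_uniform F l x0 (hFat x0 hx0) hnd
  obtain ⟨m, hm, hcoef⟩ := coef_bound l
  obtain ⟨n, rfl⟩ : ∃ n, l = n + 2 := ⟨l - 2, by omega⟩
  have hF2at : ∀ x ∈ V, ContDiffAt ℝ (n + 1 : ℕ) (fderiv ℝ F) x := fun x hx =>
    (hFat x hx).fderiv_right (by norm_cast)
  refine ⟨m * (δ * ((n + 2).factorial : ℝ)⁻¹), by positivity, fun η hη => ?_⟩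
  have hc1 : ContinuousAt (iteratedFDeriv ℝ (n + 2) F) x0 :=
    ((hFat x0 hx0).iteratedFDeriv_right (m := 0) (i := n + 2) (by norm_cast; simp)).continuousAt
  have hc2 : ContinuousAt (iteratedFDeriv ℝ (n + 1) (fderiv ℝ F)) x0 :=
    ((hF2at x0 hx0).iteratedFDeriv_right (m := 0) (i := n + 1) (by norm_cast; simp)).continuousAt
  obtain ⟨ρ2, hρ2, hb2⟩ := Metric.eventually_nhds_iff_ball.1
    ((Metric.tendsto_nhds.1 hc1 (η / 2) (by positivity)).and
      ((Metric.tendsto_nhds.1 hc2 (η / 2) (by positivity)).and (hV.eventually_mem hx0)))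
  have hdist : ∀ {Y : Type _} [SeminormedAddCommGroup Y] (a b c : Y), dist a c < η / 2 → dist b c < η / 2 → ‖a - b‖ ≤ η := by
    intro Y _ a b c h1 h2
    rw [← dist_eq_norm]
    have := dist_triangle_right a b c
    linarith
  refine ⟨min (min ρ1 (ρ2 / 2)) 1, by positivity, fun x hx R hR hRρ => ?_⟩
  have hRρ2 : R < ρ2 / 2 := hRρ.trans_le ((min_le_left _ _).trans (min_le_right _ _))
  have hR1 : R < 1 := hRρ.trans_le (min_le_right _ _)
  have hxρ1 : x ∈ Metric.ball x0 ρ1 := Metric.ball_subset_ball ((min_le_left _ _).trans (min_le_left _ _)) hx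
  have hxρ2 : x ∈ Metric.ball x0 (ρ2 / 2) := Metric.ball_subset_ball ((min_le_left _ _).trans (min_le_right _ _)) hx
  have hin : ∀ u ∈ Metric.closedBall (0 : Fin d → ℝ) 1, ∀ t ∈ Icc (0 : ℝ) 1, x + t • R • u ∈ Metric.ball x0 ρ2 := by
    intro u hu t ht
    rw [mem_closedBall_zero_iff] at hu
    rw [Metric.mem_ball] at hxρ2 ⊢
    have h1 : dist (x + t • R • u) x ≤ R := by
      rw [dist_eq_norm, add_sub_cancel_left, norm_smul, norm_smul, Real.norm_of_nonneg ht.1, Real.norm_of_nonneg hR.le]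
      calc t * (R * ‖u‖) ≤ 1 * (R * 1) := by gcongr; exact ht.2
        _ = R := by ring
    have := dist_triangle (x + t • R • u) x x0
    linarith
  have hxin : x ∈ Metric.ball x0 ρ2 := Metric.ball_subset_ball (by linarith) hxρ2
  have hRu : ∀ u ∈ Metric.closedBall (0 : Fin d → ℝ) 1, ‖R • u‖ ≤ R := by
    intro u hu
    rw [mem_closedBall_zero_iff] at hu
    rw [norm_smul, Real.norm_of_nonneg hR.le]
    exact mul_le_of_le_one_right hR.le hu
  refine ⟨taylorP F (n + 2) x R, taylorP_deg F _ x R, ?_, ?_, ?_⟩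
  · intro u hu i
    have h := taylor_bound F (n + 1) x (R • u) η (fun t ht => by
      have := hFat _ (hb2 _ (hin u hu t ht)).2.2
      exact_mod_cast this) (fun t ht => hdist _ _ _ (hb2 _ (hin u hu t ht)).1 (hb2 _ hxin).1)
    have h2 := (norm_le_pi_norm _ i).trans h
    rw [taylorP_eval]
    have e : (F (x + R • u) - ∑ k ∈ Finset.range (n + 1 + 2), (k.factorial : ℝ)⁻¹ • iteratedFDeriv ℝ k F x (fun _ => R • u)) i =
      F (x + R • u) i - ∑ k ∈ Finset.range (n + 2 + 1), ((k.factorial : ℝ)⁻¹ * R ^ k) * iteratedFDeriv ℝ k F x (fun _ => u) i := by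
      simp only [Pi.sub_apply, Finset.sum_apply, Pi.smul_apply, smul_eq_mul, diag_smul, mul_assoc]
    rw [e, Real.norm_eq_abs] at h2
    refine h2.trans ?_
    gcongr
    exact hRu u hu
  · intro u hu i j
    have h := taylor_bound (fderiv ℝ F) n x (R • u) η (fun t ht => by
      have := hF2at _ (hb2 _ (hin u hu t ht)).2.2
      exact_mod_cast this) (fun t ht => hdist _ _ _ (hb2 _ (hin u hu t ht)).2.1 (hb2 _ hxin).2.1)
    rw [taylorP_pderiv F V hV _ hF x (hb2 _ hxin).2.2]
    set S := ∑ k ∈ Finset.range (n + 2), (k.factorial : ℝ)⁻¹ • iteratedFDeriv ℝ k (fderiv ℝ F) x (fun _ => R • u)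
    rw [← mul_sub, abs_mul, abs_of_pos hR]
    have h2 : |fderiv ℝ F (x + R • u) (Pi.single j 1) i - S (Pi.single j 1) i| ≤ η * R ^ (n + 1) := by
      have h3 : ‖(fderiv ℝ F (x + R • u) - S) (Pi.single j 1)‖ ≤ η * ‖R • u‖ ^ (n + 1) * 1 :=
        ContinuousLinearMap.le_of_opNorm_le_of_le _ h (by
          rw [Pi.norm_single]; simp)
      have h4 := (norm_le_pi_norm _ i).trans h3
      rw [mul_one] at h4
      refine (show _ = _ from rfl).trans_le (h4.trans ?_)
      gcongr
      exact hRu u hu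
    calc _ ≤ R * (η * R ^ (n + 1)) := by gcongr
      _ = _ := by ring
  · intro c
    by_cases hc : c = 0
    · subst hc; simp
    have hcn : 0 < ‖c‖ := norm_pos_iff.2 hc
    obtain ⟨k, hk, v, hv, hδv⟩ := hlow x hxρ1 (‖c‖⁻¹ • c) (by
      rw [mem_sphere_zero_iff_norm, norm_smul, norm_inv, norm_norm, inv_mul_cancel₀ hcn.ne'])
    set H : ℕ → ℝ := fun k => ∑ i, c i * iteratedFDeriv ℝ k F x (fun _ => v) i with hH
    have hHk : δ * ‖c‖ ≤ |H k| := by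
      have : ∑ i, (‖c‖⁻¹ • c) i * iteratedFDeriv ℝ k F x (fun _ => v) i = ‖c‖⁻¹ * H k := by
        simp only [hH, Finset.mul_sum, Pi.smul_apply, smul_eq_mul, mul_assoc]
      rw [this, abs_mul, abs_inv, abs_norm, inv_mul_eq_div, le_div_iff₀ hcn] at hδv
      exact hδv
    obtain ⟨t, ht, hle⟩ := hcoef (fun k => ((k.factorial : ℝ)⁻¹ * R ^ k) * H k) k hk
    have htv : t • v ∈ Metric.closedBall (0 : Fin d → ℝ) 1 := by
      rw [mem_closedBall_zero_iff] at hv ⊢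
      rw [norm_smul, Real.norm_of_nonneg ht.1]
      exact mul_le_one₀ ht.2 (norm_nonneg _) hv
    have he : toC d (∑ i, c i • taylorP F (n + 2) x R i) ⟨t • v, htv⟩ =
        ∑ k ∈ Finset.range (n + 2 + 1), ((k.factorial : ℝ)⁻¹ * R ^ k) * H k * t ^ k := by
      rw [toC_apply]
      simp only [map_sum, smul_eval, taylorP_eval, hH, Finset.mul_sum, Finset.sum_mul, diag_smul]
      rw [Finset.sum_comm]
      refine Finset.sum_congr rfl fun k _ => Finset.sum_congr rfl fun i _ => ?_
      simp only [Pi.smul_apply, smul_eq_mul]; ring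
    have h2 := ContinuousMap.norm_coe_le_norm (toC d (∑ i, c i • taylorP F (n + 2) x R i)) ⟨t • v, htv⟩
    rw [he, Real.norm_eq_abs] at h2
    refine le_trans ?_ (hle.trans h2)
    rw [abs_mul, abs_of_nonneg (a := (k.factorial : ℝ)⁻¹ * R ^ k) (by positivity)]
    have h3 : ((n + 2).factorial : ℝ)⁻¹ * R ^ (n + 2) ≤ (k.factorial : ℝ)⁻¹ * R ^ k := by
      gcongr ?_ * ?_
      · exact inv_anti₀ (by positivity) (by exact_mod_cast Nat.factorial_le hk)
      · exact pow_le_pow_of_le_one hR.le hR1.le hk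
    calc m * (δ * ((n + 2).factorial : ℝ)⁻¹) * R ^ (n + 2) * ‖c‖ =
        m * ((((n + 2).factorial : ℝ)⁻¹ * R ^ (n + 2)) * (δ * ‖c‖)) := by ring
      _ ≤ _ := by gcongr
end Approx

section GoodF
open MvPolynomial

noncomputable def linF {d : ℕ} {ι : Type} [Fintype ι] (F : (Fin d → ℝ) → ι → ℝ) (c : ι → ℝ) (x : Fin d → ℝ) : ℝ :=
  ∑ i, c i * F x i
noncomputable def dlinF {d : ℕ} {ι : Type} [Fintype ι] (F : (Fin d → ℝ) → ι → ℝ) (c : ι → ℝ) (x : Fin d → ℝ)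
    (j : Fin d) : ℝ := ∑ i, c i * fderiv ℝ F x (Pi.single j 1) i
noncomputable def skewF {d : ℕ} {ι : Type} [Fintype ι] (F : (Fin d → ℝ) → ι → ℝ) (c c' : ι → ℝ) (x : Fin d → ℝ)
    (j : Fin d) : ℝ := linF F c x * dlinF F c' x j - linF F c' x * dlinF F c x j

theorem skewF_eq {d : ℕ} {ι : Type} [Fintype ι] (F : (Fin d → ℝ) → ι → ℝ) (c c' : ι → ℝ) (x : Fin d → ℝ)
    (j : Fin d) : skewF F c c' x j =
      ∑ a, ∑ b, (c a * c' b - c b * c' a) * (F x a * fderiv ℝ F x (Pi.single j 1) b) := by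
  have h : ∀ a b, (c a * c' b - c b * c' a) * (F x a * fderiv ℝ F x (Pi.single j 1) b) =
    (c a * F x a) * (c' b * fderiv ℝ F x (Pi.single j 1) b) - (c' a * F x a) * (c b * fderiv ℝ F x (Pi.single j 1) b) := by
    intro a b; ring
  simp only [h, Finset.sum_sub_distrib]
  simp only [skewF, linF, dlinF, Finset.sum_mul_sum]

theorem poly_weak (d : ℕ) (k : Fin d → ℕ) : ∃ C : ℝ, 0 < C ∧ ∀ q : MvPolynomial (Fin d) ℝ,
    (∀ u i, (lineP u i q).natDegree ≤ k i) → 0 < ‖toC d q‖ → ∀ (x : Fin d → ℝ) (R σ : ℝ), 0 < R → 0 < σ → σ ≤ 1 →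
    volume {y | y ∈ Metric.closedBall x R ∧ |eval (R⁻¹ • (y - x)) q| < σ ^ (∑ i, k i) * ‖toC d q‖} ≤
      ENNReal.ofReal (C * σ) * volume (Metric.closedBall x R) := by
  obtain ⟨C, hC, h⟩ := sublevel_multi d k
  refine ⟨C, hC, fun q hq hpos x R σ hR hσ hσ1 => ?_⟩
  have hne : Nonempty (QQ d) := ⟨⟨0, by simp⟩⟩
  obtain ⟨z, -, hz⟩ := (isCompact_univ (X := QQ d)).exists_isMaxOn univ_nonempty
    (continuous_norm.comp (toC d q).continuous).continuousOn
  have hmax : ‖toC d q‖ ≤ ‖toC d q z‖ := by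
    rw [ContinuousMap.norm_le _ (norm_nonneg _)]
    intro s; exact hz (mem_univ s)
  have := h (fun y => eval (R⁻¹ • (y - x)) q) ((MvPolynomial.continuous_eval q).comp (by fun_prop)) (by
    intro u i
    refine ⟨(lineP (R⁻¹ • (u - x)) i q).comp (Polynomial.C R⁻¹ * (Polynomial.X - Polynomial.C (x i))), ?_, ?_⟩
    · refine (Polynomial.natDegree_comp_le).trans ?_
      have h1 : (Polynomial.C R⁻¹ * (Polynomial.X - Polynomial.C (x i))).natDegree ≤ 1 := by
        refine (Polynomial.natDegree_C_mul_le _ _).trans ?_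
        simp
      calc _ ≤ k i * 1 := Nat.mul_le_mul (hq _ i) h1
        _ = _ := mul_one _
    · intro t
      rw [Polynomial.eval_comp, lineP_eval]
      congr 2
      ext j
      by_cases hj : j = i
      · subst hj; simp
      · simp [hj]) x R ‖toC d q‖ σ hR hpos hσ hσ1 ⟨x + R • z.1, by
        have := z.2
        rw [mem_closedBall_zero_iff] at this
        rw [Metric.mem_closedBall, dist_eq_norm, add_sub_cancel_left, norm_smul, Real.norm_of_nonneg hR.le]
        exact mul_le_of_le_one_right hR.le this, by
        rw [add_sub_cancel_left, smul_smul, inv_mul_cancel₀ hR.ne', one_smul]; exact hmax⟩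
  refine this.trans ?_
  rw [Real.volume_pi_closedBall _ hR.le, ← ENNReal.ofReal_mul (by positivity)]
  apply ENNReal.ofReal_le_ofReal
  simp only [Fintype.card_fin]
  gcongr
  linarith

theorem weak_core {d D : ℕ} {C : ℝ} (k : Fin d → ℕ) (hk : ∑ i, k i ≤ D)
    (hC : ∀ q : MvPolynomial (Fin d) ℝ,
    (∀ u i, (lineP u i q).natDegree ≤ k i) → 0 < ‖toC d q‖ → ∀ (x : Fin d → ℝ) (R σ : ℝ), 0 < R → 0 < σ → σ ≤ 1 →
    volume {y | y ∈ Metric.closedBall x R ∧ |eval (R⁻¹ • (y - x)) q| < σ ^ (∑ i, k i) * ‖toC d q‖} ≤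
      ENNReal.ofReal (C * σ) * volume (Metric.closedBall x R))
    (Φ : (Fin d → ℝ) → ℝ) (x : Fin d → ℝ) (R lam σ : ℝ) (hR : 0 < R) (hl : 0 < lam) (hσ : 0 < σ) (hσ1 : σ ≤ 1)
    (q : MvPolynomial (Fin d) ℝ) (hq : ∀ u i, (lineP u i q).natDegree ≤ k i) (hq0 : 0 < ‖toC d q‖)
    (h1 : ∀ u ∈ Metric.closedBall (0 : Fin d → ℝ) 1, lam * Φ (x + R • u) ≤ 2 * ‖toC d q‖)
    (h2 : ∀ u ∈ Metric.closedBall (0 : Fin d → ℝ) 1, |eval u q| ≤ lam * Φ (x + R • u) + σ ^ D / 4 * ‖toC d q‖)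
    (M : ℝ) (hM : ∃ z ∈ Metric.closedBall x R, M ≤ Φ z) :
    volume {y | y ∈ Metric.closedBall x R ∧ Φ y < σ ^ D / 4 * M} ≤ ENNReal.ofReal (C * σ) * volume (Metric.closedBall x R) := by
  have hch : ∀ y ∈ Metric.closedBall x R, R⁻¹ • (y - x) ∈ Metric.closedBall (0 : Fin d → ℝ) 1 ∧ x + R • (R⁻¹ • (y - x)) = y := by
    intro y hy
    rw [Metric.mem_closedBall, dist_eq_norm] at hy
    refine ⟨?_, ?_⟩
    · rw [mem_closedBall_zero_iff, norm_smul, norm_inv, Real.norm_of_nonneg hR.le, inv_mul_le_iff₀ hR]; linarith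
    · rw [smul_smul, mul_inv_cancel₀ hR.ne', one_smul]; abel
  refine (measure_mono ?_).trans (hC q hq hq0 x R σ hR hσ hσ1)
  rintro y ⟨hy, hy2⟩
  refine ⟨hy, ?_⟩
  obtain ⟨z, hz, hMz⟩ := hM
  have a1 := h1 _ (hch z hz).1
  have a2 := h2 _ (hch y hy).1
  rw [(hch z hz).2] at a1
  rw [(hch y hy).2] at a2
  have hs : 0 < σ ^ D := by positivity
  have hMb : lam * M ≤ 2 * ‖toC d q‖ := (mul_le_mul_of_nonneg_left hMz hl.le).trans a1
  have h3 : lam * Φ y < σ ^ D / 4 * (2 * ‖toC d q‖) := by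
    calc lam * Φ y < lam * (σ ^ D / 4 * M) := by gcongr
      _ = σ ^ D / 4 * (lam * M) := by ring
      _ ≤ _ := by gcongr
  have h4 : σ ^ D * ‖toC d q‖ ≤ σ ^ (∑ i, k i) * ‖toC d q‖ := by
    gcongr ?_ * _
    exact pow_le_pow_of_le_one hσ.le hσ1 hk
  have : 0 < σ ^ D * ‖toC d q‖ := by positivity
  linarith

theorem lin_err {ι : Type} [Fintype ι] (c a b : ι → ℝ) (e : ℝ) (h : ∀ i, |a i - b i| ≤ e) :
    |∑ i, c i * a i - ∑ i, c i * b i| ≤ Fintype.card ι * ‖c‖ * e := by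
  rw [← Finset.sum_sub_distrib]
  calc _ ≤ ∑ i, |c i * a i - c i * b i| := Finset.abs_sum_le_sum_abs _ _
    _ ≤ ∑ i : ι, ‖c‖ * e := by
      refine Finset.sum_le_sum fun i _ => ?_
      rw [← mul_sub, abs_mul]
      exact mul_le_mul (norm_le_pi_norm c i) (h i) (abs_nonneg _) (norm_nonneg _)
    _ = _ := by simp [mul_assoc]
end GoodF

section GoodF2
open MvPolynomial
variable {d : ℕ} {ι : Type} [Fintype ι]

theorem eval_le_toC (p : MvPolynomial (Fin d) ℝ) (u : Fin d → ℝ) (hu : u ∈ Metric.closedBall (0 : Fin d → ℝ) 1) :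
    |eval u p| ≤ ‖toC d p‖ := (toC d p).norm_coe_le_norm ⟨u, hu⟩

theorem skew_diff (L1 D1 L2 D2 a1 b1 a2 b2 s1 s2 e C : ℝ) (he : 0 ≤ e) (he1 : e ≤ 1) (hs1 : 0 ≤ s1) (hs2 : 0 ≤ s2)
    (hC : 0 ≤ C) (h1 : |L1 - a1| ≤ e * s1) (h2 : |L2 - a2| ≤ e * s2) (h3 : |D1 - b1| ≤ e * s1) (h4 : |D2 - b2| ≤ e * s2)
    (h5 : |a1| ≤ s1) (h6 : |a2| ≤ s2) (h7 : |b1| ≤ C * s1) (h8 : |b2| ≤ C * s2) :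
    |(L1 * D2 - L2 * D1) - (a1 * b2 - a2 * b1)| ≤ 2 * e * (C + 2) * (s1 * s2) := by
  have key : ∀ L D a b s t : ℝ, 0 ≤ s → 0 ≤ t → |L - a| ≤ e * s → |D - b| ≤ e * t → |a| ≤ s → |b| ≤ C * t →
      |L * D - a * b| ≤ e * (C + 2) * (s * t) := by
    intro L D a b s t hs ht k1 k2 k3 k4
    have hD : |D| ≤ (C + 1) * t := by
      calc |D| = |(D - b) + b| := by ring_nf
        _ ≤ |D - b| + |b| := abs_add_le _ _
        _ ≤ e * t + C * t := add_le_add k2 k4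
        _ ≤ 1 * t + C * t := by gcongr
        _ = _ := by ring
    calc |L * D - a * b| = |(L - a) * D + a * (D - b)| := by ring_nf
      _ ≤ |(L - a) * D| + |a * (D - b)| := abs_add_le _ _
      _ = |L - a| * |D| + |a| * |D - b| := by rw [abs_mul, abs_mul]
      _ ≤ (e * s) * ((C + 1) * t) + s * (e * t) := by gcongr
      _ = _ := by ring
  have k1 := key L1 D2 a1 b2 s1 s2 hs1 hs2 h1 h4 h5 h8
  have k2 := key L2 D1 a2 b1 s2 s1 hs2 hs1 h2 h3 h6 h7
  calc _ = |(L1 * D2 - a1 * b2) - (L2 * D1 - a2 * b1)| := by ring_nf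
    _ ≤ |L1 * D2 - a1 * b2| + |L2 * D1 - a2 * b1| := abs_sub _ _
    _ ≤ _ := by linarith

noncomputable def PP2 (p : ι → MvPolynomial (Fin d) ℝ) (c : ι → ℝ) : MvPolynomial (Fin d) ℝ := ∑ i, c i • p i

theorem PP2_eval (p : ι → MvPolynomial (Fin d) ℝ) (c : ι → ℝ) (u) : eval u (PP2 p c) = ∑ i, c i * eval u (p i) := by
  simp [PP2, smul_eval]
theorem PP2_pderiv (p : ι → MvPolynomial (Fin d) ℝ) (c : ι → ℝ) (j u) :
    eval u (pderiv j (PP2 p c)) = ∑ i, c i * eval u (pderiv j (p i)) := by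
  simp [PP2, smul_eval]
theorem PP2_deg (p : ι → MvPolynomial (Fin d) ℝ) (c : ι → ℝ) (l : ℕ) (h : ∀ i, (p i).totalDegree ≤ l) :
    (PP2 p c).totalDegree ≤ l :=
  totalDegree_finsetSum_le fun i _ => (totalDegree_smul_le _ _).trans (h i)

theorem minor_le (c c' : ι → ℝ) (a b : ι) : |c a * c' b - c b * c' a| ≤ 2 * (‖c‖ * ‖c'‖) := by
  calc _ ≤ |c a * c' b| + |c b * c' a| := abs_sub _ _
    _ = |c a| * |c' b| + |c b| * |c' a| := by rw [abs_mul, abs_mul]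
    _ ≤ ‖c‖ * ‖c'‖ + ‖c‖ * ‖c'‖ := by
      have hh := fun (c : ι → ℝ) a => norm_le_pi_norm c a
      simp only [Real.norm_eq_abs] at hh
      gcongr <;> exact hh _ _
    _ = _ := by ring

theorem pair_min (p : ι → MvPolynomial (Fin d) ℝ) (k : ℝ) (hk : 0 < k)
    (hp : ∀ c : ι → ℝ, k * ‖c‖ ≤ ‖toC d (PP2 p c)‖) (c c' : ι → ℝ) (a b : ι) (hab : c a * c' b - c b * c' a ≠ 0) :
    ∃ β0 : ℝ, ∀ β : ℝ, ‖toC d (PP2 p (c - β0 • c'))‖ / 2 ≤ ‖toC d (PP2 p (c - β • c'))‖ := by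
  have hc' : 0 < ‖c'‖ := by
    rw [norm_pos_iff]; rintro rfl; simp at hab
  set g : ℝ → ℝ := fun β => ‖toC d (PP2 p (c - β • c'))‖ with hg
  have hlow : ∀ β, k * (|c a * c' b - c b * c' a| / (2 * ‖c'‖)) ≤ g β := by
    intro β
    refine le_trans ?_ (hp _)
    gcongr
    rw [div_le_iff₀ (by positivity)]
    have := minor_le (c - β • c') c' a b
    calc _ = |(c - β • c') a * c' b - (c - β • c') b * c' a| := by congr 1; simp; ring
      _ ≤ _ := this
      _ = _ := by ring
  have hbdd : BddBelow (range g) := ⟨_, by rintro _ ⟨β, rfl⟩; exact hlow β⟩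
  have hI : 0 < sInf (range g) := lt_of_lt_of_le (show 0 < k * (|c a * c' b - c b * c' a| / (2 * ‖c'‖)) by
    have := abs_pos.2 hab; positivity) (le_csInf (range_nonempty g) (by rintro _ ⟨β, rfl⟩; exact hlow β))
  obtain ⟨_, ⟨β0, rfl⟩, h0⟩ := exists_lt_of_csInf_lt (range_nonempty g) (show sInf (range g) < 2 * sInf (range g) by linarith)
  refine ⟨β0, fun β => ?_⟩
  have := csInf_le hbdd ⟨β, rfl⟩
  change g β0 / 2 ≤ g β
  linarith

theorem skewF_shift (F : (Fin d → ℝ) → ι → ℝ) (c c' : ι → ℝ) (β : ℝ) (x : Fin d → ℝ) (j : Fin d) :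
    skewF F (c - β • c') c' x j = skewF F c c' x j := by
  rw [skewF_eq, skewF_eq]
  refine Finset.sum_congr rfl fun a _ => Finset.sum_congr rfl fun b _ => ?_
  simp only [Pi.sub_apply, Pi.smul_apply, smul_eq_mul]; ring

noncomputable def phiSk (F : (Fin d → ℝ) → ι → ℝ) (c c' : ι → ℝ) (x : Fin d → ℝ) : ℝ := ‖fun j => skewF F c c' x j‖
noncomputable def phiLin (F : (Fin d → ℝ) → ι → ℝ) (c : ι → ℝ) (x : Fin d → ℝ) : ℝ := |linF F c x|

set_option maxHeartbeats 400000 in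
theorem pair_lemma (F : (Fin d → ℝ) → ι → ℝ) (l : ℕ) (hl : 1 ≤ l) (hd : 1 ≤ d) (x0 : Fin d → ℝ) (h : ApproxAt F l x0) :
    ∃ c1 : ℝ, 0 < c1 ∧ ∀ th : ℝ, 0 < th → th ≤ 1 → ∃ ρ : ℝ, 0 < ρ ∧ ∀ x ∈ Metric.ball x0 ρ, ∀ R : ℝ, 0 < R → R < ρ →
      (∀ c : ι → ℝ, c ≠ 0 → ∃ q : MvPolynomial (Fin d) ℝ, q.totalDegree ≤ l ∧ 0 < ‖toC d q‖ ∧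
        (∀ u ∈ Metric.closedBall (0 : Fin d → ℝ) 1, phiLin F c (x + R • u) ≤ 2 * ‖toC d q‖) ∧
        (∀ u ∈ Metric.closedBall (0 : Fin d → ℝ) 1, |eval u q| ≤ phiLin F c (x + R • u) + th * ‖toC d q‖) ∧
        c1 * R ^ l * ‖c‖ ≤ ‖toC d q‖) ∧
      (∀ c c' : ι → ℝ, (∃ a b, c a * c' b - c b * c' a ≠ 0) → ∃ (j0 : Fin d) (q : MvPolynomial (Fin d) ℝ),
        (∀ u j, (lineP u j q).natDegree ≤ skewDeg d l j0 j) ∧ 0 < ‖toC d q‖ ∧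
        (∀ u ∈ Metric.closedBall (0 : Fin d → ℝ) 1, R * phiSk F c c' (x + R • u) ≤ 2 * ‖toC d q‖) ∧
        (∀ u ∈ Metric.closedBall (0 : Fin d → ℝ) 1, |eval u q| ≤ R * phiSk F c c' (x + R • u) + th * ‖toC d q‖) ∧
        ∀ a b, c1 * R ^ (2 * l) * |c a * c' b - c b * c' a| ≤ ‖toC d q‖) := by
  obtain ⟨c0, hc0, h⟩ := h
  obtain ⟨CM, hCM, hmk⟩ := markov d l
  obtain ⟨cs, hcs, hsk⟩ := skew_lower d l hd
  refine ⟨min c0 (cs * c0 ^ 2 / 2), by positivity, fun th hth hth1 => ?_⟩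
  set e : ℝ := min th (th * cs / (2 * (CM + 2))) with he
  have he0 : 0 < e := by positivity
  have heth : e ≤ th := min_le_left _ _
  have hecs : 2 * e * (CM + 2) ≤ th * cs := by
    have : e ≤ th * cs / (2 * (CM + 2)) := min_le_right _ _
    rw [le_div_iff₀ (by positivity)] at this; linarith
  obtain ⟨ρ, hρ, h⟩ := h (e * c0 / (Fintype.card ι + 1)) (by positivity)
  refine ⟨ρ, hρ, fun x hx R hR hRρ => ?_⟩
  obtain ⟨p, hdeg, hv, hdv, hlow⟩ := h x hx R hR hRρ
  have hN : ∀ c : ι → ℝ, c0 * R ^ l * ‖c‖ ≤ ‖toC d (PP2 p c)‖ := hlow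
  have hbd : ∀ c : ι → ℝ, Fintype.card ι * ‖c‖ * (e * c0 / (Fintype.card ι + 1) * R ^ l) ≤ e * ‖toC d (PP2 p c)‖ := by
    intro c
    calc _ = e * (Fintype.card ι / (Fintype.card ι + 1)) * (c0 * R ^ l * ‖c‖) := by ring
      _ ≤ e * 1 * ‖toC d (PP2 p c)‖ := by
        gcongr
        · rw [div_le_one (by positivity)]; linarith
        · exact hN c
      _ = _ := by ring
  have e1 : ∀ c u, u ∈ Metric.closedBall (0 : Fin d → ℝ) 1 →
      |linF F c (x + R • u) - eval u (PP2 p c)| ≤ e * ‖toC d (PP2 p c)‖ := by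
    intro c u hu
    rw [PP2_eval]
    exact (lin_err c _ _ _ (hv u hu)).trans (hbd c)
  have e2 : ∀ c u j, u ∈ Metric.closedBall (0 : Fin d → ℝ) 1 →
      |R * dlinF F c (x + R • u) j - eval u (pderiv j (PP2 p c))| ≤ e * ‖toC d (PP2 p c)‖ := by
    intro c u j hu
    rw [PP2_pderiv]
    have := (lin_err c _ _ _ (fun i => hdv u hu i j)).trans (hbd c)
    have h3 : R * dlinF F c (x + R • u) j = ∑ i, c i * (R * fderiv ℝ F (x + R • u) (Pi.single j 1) i) := by
      rw [dlinF, Finset.mul_sum]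
      exact Finset.sum_congr rfl fun i _ => by ring
    rw [h3]; exact this
  constructor
  · intro c hc
    have hcn : 0 < ‖c‖ := norm_pos_iff.2 hc
    have hp0 : 0 < ‖toC d (PP2 p c)‖ := lt_of_lt_of_le (by positivity) (hN c)
    refine ⟨PP2 p c, PP2_deg p c l hdeg, hp0, ?_, ?_, ?_⟩
    · intro u hu
      have a1 := e1 c u hu
      have a2 := eval_le_toC (PP2 p c) u hu
      have a3 := abs_sub_abs_le_abs_sub (linF F c (x + R • u)) (eval u (PP2 p c))
      unfold phiLin
      nlinarith
    · intro u hu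
      have a1 := e1 c u hu
      have a3 := abs_sub_abs_le_abs_sub (eval u (PP2 p c)) (linF F c (x + R • u))
      rw [abs_sub_comm] at a3
      unfold phiLin
      nlinarith
    · refine le_trans ?_ (hN c)
      gcongr
      exact min_le_left _ _
  · rintro c c' ⟨a, b, hab⟩
    obtain ⟨β0, hβ⟩ := pair_min p (c0 * R ^ l) (by positivity) hN c c' a b hab
    set c2 := c - β0 • c' with hc2
    have hmin : ∀ a b, c2 a * c' b - c2 b * c' a = c a * c' b - c b * c' a := by
      intro a b; simp [hc2]; ring
    set s1 := ‖toC d (PP2 p c2)‖ with hs1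
    set s2 := ‖toC d (PP2 p c')‖ with hs2
    have hlo := hsk (PP2 p c2) (PP2 p c') (PP2_deg _ _ _ hdeg) (PP2_deg _ _ _ hdeg) (by
      intro β
      have : PP2 p c2 - β • PP2 p c' = PP2 p (c - (β0 + β) • c') := by
        simp only [PP2, Finset.smul_sum, ← Finset.sum_sub_distrib, hc2]
        refine Finset.sum_congr rfl fun i _ => ?_
        rw [smul_smul, ← sub_smul]; congr 1; simp; ring
      rw [this]; exact hβ _)
    obtain ⟨i1, hi1⟩ := hlo
    have : Nonempty (Fin d) := ⟨i1⟩
    obtain ⟨j0, hj0⟩ := Finite.exists_max (fun j => ‖toC d (skewP j (PP2 p c2) (PP2 p c'))‖)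
    obtain ⟨sk, hsk2⟩ : ∃ sk : Fin d → MvPolynomial (Fin d) ℝ, sk = fun j => skewP j (PP2 p c2) (PP2 p c') := ⟨_, rfl⟩
    have hsk3 : ∀ j, skewP j (PP2 p c2) (PP2 p c') = sk j := fun j => by rw [hsk2]
    simp only [hsk3] at hi1 hj0
    obtain ⟨Q, hQ⟩ : ∃ Q, Q = ‖toC d (sk j0)‖ := ⟨_, rfl⟩
    rw [← hQ] at hj0
    have hQs : cs * (s1 * s2) ≤ Q := hi1.trans (hj0 i1)
    have hs10 : 0 ≤ s1 := norm_nonneg _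
    have hs20 : 0 ≤ s2 := norm_nonneg _
    have hminor : ∀ a b, cs * c0 ^ 2 / 2 * R ^ (2 * l) * |c a * c' b - c b * c' a| ≤ Q := by
      intro a b
      rw [← hmin a b]
      calc _ ≤ cs * c0 ^ 2 / 2 * R ^ (2 * l) * (2 * (‖c2‖ * ‖c'‖)) := by
            gcongr; exact minor_le _ _ _ _
        _ = cs * ((c0 * R ^ l * ‖c2‖) * (c0 * R ^ l * ‖c'‖)) := by rw [two_mul l, pow_add]; ring
        _ ≤ cs * (s1 * s2) := by
          gcongr
          · exact hN c2
          · exact hN c'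
        _ ≤ Q := hQs
    have hQ0 : 0 ≤ Q := by rw [hQ]; exact norm_nonneg _
    have hd1 : ∀ u ∈ Metric.closedBall (0 : Fin d → ℝ) 1, ∀ j,
        |R * skewF F c c' (x + R • u) j - eval u (sk j)| ≤ th * Q := by
      intro u hu j
      have := skew_diff _ _ _ _ _ _ _ _ s1 s2 e CM he0.le (heth.trans hth1) hs10 hs20 hCM.le (e1 c2 u hu) (e1 c' u hu)
        (e2 c2 u j hu) (e2 c' u j hu) (eval_le_toC _ u hu) (eval_le_toC _ u hu)
        ((eval_le_toC _ u hu).trans (hmk _ (PP2_deg _ _ _ hdeg) j)) ((eval_le_toC _ u hu).trans (hmk _ (PP2_deg _ _ _ hdeg) j))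
      rw [← skewF_shift F c c' β0]
      calc _ = _ := by
            congr 1
            simp only [← hsk3, skewF, skewP, map_sub, map_mul]; ring
        _ ≤ _ := this
        _ ≤ th * cs * (s1 * s2) := by gcongr
        _ = th * (cs * (s1 * s2)) := by ring
        _ ≤ _ := by gcongr
    refine ⟨j0, sk j0, fun u j => hsk3 j0 ▸ skewP_line hl j0 _ _ (PP2_deg _ _ _ hdeg) (PP2_deg _ _ _ hdeg) u j,
      by rw [← hQ]; exact lt_of_lt_of_le (by have := abs_pos.2 hab; positivity) (hminor a b), ?_, ?_, ?_⟩
    · rw [← hQ]; intro u hu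
      have : phiSk F c c' (x + R • u) ≤ 2 * Q / R := by
        refine (pi_norm_le_iff_of_nonneg (by positivity)).2 fun j => ?_
        rw [le_div_iff₀ hR, Real.norm_eq_abs]
        have a1 := hd1 u hu j
        have a2 := eval_le_toC (sk j) u hu
        have a3 := abs_sub_abs_le_abs_sub (R * skewF F c c' (x + R • u) j) (eval u (sk j))
        rw [abs_mul, abs_of_pos hR] at a3
        have a4 := hj0 j
        have : th * Q ≤ 1 * Q := by gcongr
        have e3 : ‖toC d (sk j)‖ ≤ Q := a4
        linarith
      rw [le_div_iff₀ hR] at this; linarith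
    · rw [← hQ]; intro u hu
      have a1 := hd1 u hu j0
      have a3 := abs_sub_abs_le_abs_sub (eval u (sk j0)) (R * skewF F c c' (x + R • u) j0)
      rw [abs_sub_comm, abs_mul, abs_of_pos hR] at a3
      have a4 : |skewF F c c' (x + R • u) j0| ≤ phiSk F c c' (x + R • u) :=
        norm_le_pi_norm (fun j => skewF F c c' (x + R • u) j) j0
      have : R * |skewF F c c' (x + R • u) j0| ≤ R * phiSk F c c' (x + R • u) := by gcongr
      linarith
    · rw [← hQ]; intro a b
      refine le_trans ?_ (hminor a b)
      gcongr
      exact min_le_right _ _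
end GoodF2

section GoodF3
open MvPolynomial
variable {d : ℕ} {ι : Type} [Fintype ι]

theorem ball_sub_lt (hd : 1 ≤ d) (x x0 : Fin d → ℝ) (R ρ : ℝ) (hR : 0 < R) (h : Metric.closedBall x R ⊆ Metric.ball x0 ρ) :
    x ∈ Metric.ball x0 ρ ∧ R < ρ := by
  refine ⟨h (Metric.mem_closedBall_self hR.le), ?_⟩
  have : Nonempty (Fin d) := ⟨⟨0, hd⟩⟩
  have n1 : ‖(1 : Fin d → ℝ)‖ = 1 := by simp
  have h1 : x + R • (1 : Fin d → ℝ) ∈ Metric.ball x0 ρ := h (by simp [norm_smul, abs_of_pos hR])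
  have h2 : x - R • (1 : Fin d → ℝ) ∈ Metric.ball x0 ρ := h (by simp [norm_smul, abs_of_pos hR])
  have h3 := dist_triangle_right (x + R • (1 : Fin d → ℝ)) (x - R • (1 : Fin d → ℝ)) x0
  rw [Metric.mem_ball] at h1 h2
  have h4 : dist (x + R • (1 : Fin d → ℝ)) (x - R • (1 : Fin d → ℝ)) = 2 * R := by
    rw [dist_eq_norm, show x + R • (1 : Fin d → ℝ) - (x - R • (1 : Fin d → ℝ)) = (2 * R) • (1 : Fin d → ℝ) by
      rw [mul_smul, two_smul]; abel, norm_smul, n1]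
    simp [abs_of_pos hR]
  linarith

theorem toC_attain (q : MvPolynomial (Fin d) ℝ) : ∃ u ∈ Metric.closedBall (0 : Fin d → ℝ) 1, ‖toC d q‖ ≤ |eval u q| := by
  have hne : Nonempty (QQ d) := ⟨⟨0, by simp⟩⟩
  obtain ⟨z, -, hz⟩ := (isCompact_univ (X := QQ d)).exists_isMaxOn univ_nonempty
    (continuous_norm.comp (toC d q).continuous).continuousOn
  refine ⟨z.1, z.2, ?_⟩
  rw [ContinuousMap.norm_le _ (abs_nonneg _)]
  intro s; exact hz (mem_univ s)

theorem good_all (F : (Fin d → ℝ) → ι → ℝ) (l : ℕ) (hl : 2 ≤ l) (hd : 1 ≤ d) (x0 : Fin d → ℝ) (V : Set (Fin d → ℝ))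
    (hV : IsOpen V) (hF : ContDiffOn ℝ l F V) (hx0 : x0 ∈ V) (h : ApproxAt F l x0) :
    ∃ ρ : ℝ, 0 < ρ ∧ ∃ C : ℝ, 0 < C ∧ Metric.ball x0 ρ ⊆ V ∧
      (∀ c, ContinuousOn (phiLin F c) (Metric.ball x0 ρ)) ∧ (∀ c c', ContinuousOn (phiSk F c c') (Metric.ball x0 ρ)) ∧
      (∀ c, GoodG (phiLin F c) (Metric.ball x0 ρ) C (((d * (2 * l - 1) : ℕ) : ℝ)⁻¹)) ∧
      (∀ c c', GoodG (phiSk F c c') (Metric.ball x0 ρ) C (((d * (2 * l - 1) : ℕ) : ℝ)⁻¹)) ∧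
      ∀ R0, 0 < R0 → R0 < ρ → ∃ cl : ℝ, 0 < cl ∧ (∀ c, ∃ z ∈ Metric.closedBall x0 R0, cl * ‖c‖ ≤ phiLin F c z) ∧
        ∀ c c' a b, ∃ z ∈ Metric.closedBall x0 R0, cl * |c a * c' b - c b * c' a| ≤ phiSk F c c' z := by
  obtain ⟨D, hD⟩ : ∃ D : ℕ, D + 1 = d * (2 * l - 1) :=
    ⟨d * (2 * l - 1) - 1, by have : 0 < d * (2 * l - 1) := Nat.mul_pos (by omega) (by omega); omega⟩
  rw [← hD]
  obtain ⟨N, hN, hwg⟩ := weak_to_good d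
  obtain ⟨c1, hc1, hpair⟩ := pair_lemma F l (by omega) hd x0 h
  obtain ⟨Cl, hCl, hwl⟩ := poly_weak d (fun _ => l)
  choose Cs hCs hws using fun j0 : Fin d => poly_weak d (skewDeg d l j0)
  set C' : ℝ := Cl + ∑ j, Cs j with hC'
  have hCs0 : ∀ j, 0 ≤ Cs j := fun j => (hCs j).le
  have hsum0 : 0 ≤ ∑ j, Cs j := Finset.sum_nonneg fun j _ => hCs0 j
  have hC'0 : 0 < C' := by positivity
  have hlC : Cl ≤ C' := by linarith
  have hsC : ∀ j, Cs j ≤ C' := fun j => by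
    have := Finset.single_le_sum (fun j _ => hCs0 j) (Finset.mem_univ j); linarith
  set B : ℝ := 4 ^ d * N * C' with hB
  have hN0 : (0 : ℝ) < N := by have : (1 : ℝ) ≤ N := by exact_mod_cast hN
                               linarith
  have hB0 : 0 < B := by positivity
  set σ : ℝ := min (1 / 2) (min (1 / (4 * B ^ (D + 1))) (1 / (2 * (C' * 20 ^ d)))) with hσ
  have hσ0 : 0 < σ := by positivity
  have hσ1 : σ ≤ 1 / 2 := min_le_left _ _
  have hσ2 : σ * (4 * B ^ (D + 1)) ≤ 1 := by
    rw [← le_div_iff₀ (by positivity)]; exact (min_le_right _ _).trans (min_le_left _ _)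
  have hσ3 : σ * (2 * (C' * 20 ^ d)) ≤ 1 := by
    rw [← le_div_iff₀ (by positivity)]; exact (min_le_right _ _).trans (min_le_right _ _)
  have hσD : σ ^ D ≤ 1 := pow_le_one₀ hσ0.le (by linarith)
  set τ : ℝ := σ ^ D / 4 with hτ
  have hτ0 : 0 < τ := by positivity
  have hτ1 : τ < 1 := by linarith
  obtain ⟨ρ1, hρ1, hpair⟩ := hpair τ hτ0 hτ1.le
  obtain ⟨ρ2, hρ2, hρV⟩ := Metric.isOpen_iff.1 hV x0 hx0
  set ρ := min ρ1 ρ2 with hρ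
  have hbV : Metric.ball x0 ρ ⊆ V := (Metric.ball_subset_ball (min_le_right _ _)).trans hρV
  have hFc : ContinuousOn F (Metric.ball x0 ρ) := hF.continuousOn.mono hbV
  have hFd : ContinuousOn (fderiv ℝ F) (Metric.ball x0 ρ) :=
    (hF.continuousOn_fderiv_of_isOpen hV (by norm_cast; omega)).mono hbV
  have hlin : ∀ c, ContinuousOn (linF F c) (Metric.ball x0 ρ) := by
    intro c
    refine continuousOn_finsetSum _ fun i _ => ?_
    exact continuousOn_const.mul ((continuous_apply i).comp_continuousOn hFc)
  have hdlin : ∀ c j, ContinuousOn (fun x => dlinF F c x j) (Metric.ball x0 ρ) := by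
    intro c j
    refine continuousOn_finsetSum _ fun i _ => ?_
    exact continuousOn_const.mul ((continuous_apply i).comp_continuousOn (hFd.clm_apply continuousOn_const))
  have hcl : ∀ c, ContinuousOn (phiLin F c) (Metric.ball x0 ρ) := fun c => (hlin c).abs
  have hcs : ∀ c c', ContinuousOn (phiSk F c c') (Metric.ball x0 ρ) := by
    intro c c'
    refine ContinuousOn.norm (continuousOn_pi.2 fun j => ?_)
    exact ((hlin c).mul (hdlin c' j)).sub ((hlin c').mul (hdlin c j))
  have hρ0 : 0 < ρ := lt_min hρ1 hρ2
  have hcond : 4 ^ d * N * (C' * σ) ≤ τ ^ (((D + 1 : ℕ) : ℝ)⁻¹) := by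
    rw [Real.le_rpow_inv_iff_of_pos (by positivity) hτ0.le (by positivity), Real.rpow_natCast]
    calc (4 ^ d * N * (C' * σ)) ^ (D + 1) = (B * σ) ^ (D + 1) := by rw [hB]; ring
      _ = σ * (4 * B ^ (D + 1)) * (σ ^ D / 4) := by ring
      _ ≤ 1 * (σ ^ D / 4) := by gcongr
      _ = τ := by rw [hτ, one_mul]
  have hk20 : C' * σ * 20 ^ d < 1 := by
    have : 0 < σ * (C' * 20 ^ d) := by positivity
    nlinarith
  have hfin : ∀ Φ : (Fin d → ℝ) → ℝ, ContinuousOn Φ (Metric.ball x0 ρ) → WeakG Φ (Metric.ball x0 ρ) τ (C' * σ) →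
      GoodG Φ (Metric.ball x0 ρ) (τ ^ (-(((D + 1 : ℕ) : ℝ)⁻¹))) (((D + 1 : ℕ) : ℝ)⁻¹) := by
    intro Φ h1 h2
    exact hwg Φ _ h1 τ _ _ hτ0 hτ1 (by positivity) hk20 (by positivity) hcond h2
  have hwk : ∀ (C : ℝ) (x : Fin d → ℝ) (R : ℝ), C ≤ C' → ENNReal.ofReal (C * σ) * volume (Metric.closedBall x R) ≤
      ENNReal.ofReal (C' * σ) * volume (Metric.closedBall x R) := by
    intro C x R hC
    gcongr
  refine ⟨ρ, hρ0, τ ^ (-(((D + 1 : ℕ) : ℝ)⁻¹)), by positivity, hbV, hcl, hcs, fun c => hfin _ (hcl c) ?_,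
    fun c c' => hfin _ (hcs c c') ?_, ?_⟩
  · intro x R hR hsub M hM hz
    obtain ⟨hx, hRρ⟩ := ball_sub_lt hd x x0 R ρ hR hsub
    by_cases hc : c = 0
    · obtain ⟨z, -, hz⟩ := hz
      simp [phiLin, linF, hc] at hz; linarith
    obtain ⟨q, hq, hq0, h1, h2, -⟩ := (hpair x (Metric.ball_subset_ball (min_le_left _ _) hx) R hR
      (hRρ.trans_le (min_le_left _ _))).1 c hc
    refine le_trans ?_ (hwk Cl x R hlC)
    refine weak_core (fun _ => l) (D := D) ?_ hwl (phiLin F c) x R 1 σ hR one_pos hσ0 (by linarith) q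
      (fun u i => lineP_natDegree u i q l hq) hq0 (by simpa using h1) (by simpa using h2) M hz
    simp only [Finset.sum_const, Finset.card_univ, Fintype.card_fin, smul_eq_mul]
    have : d * l + d ≤ d * (2 * l - 1) := by rw [← Nat.mul_succ]; exact Nat.mul_le_mul_left _ (by omega)
    omega
  · intro x R hR hsub M hM hz
    obtain ⟨hx, hRρ⟩ := ball_sub_lt hd x x0 R ρ hR hsub
    by_cases hc : ∃ a b, c a * c' b - c b * c' a ≠ 0
    · obtain ⟨j0, q, hq, hq0, h1, h2, -⟩ := (hpair x (Metric.ball_subset_ball (min_le_left _ _) hx) R hR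
        (hRρ.trans_le (min_le_left _ _))).2 c c' hc
      refine le_trans ?_ (hwk (Cs j0) x R (hsC j0))
      refine weak_core (skewDeg d l j0) (D := D) ?_ (hws j0) (phiSk F c c') x R R σ hR hR hσ0 (by linarith) q
        hq hq0 h1 h2 M hz
      rw [skewDeg_sum d l (by omega)]; omega
    · push Not at hc
      obtain ⟨z, -, hz⟩ := hz
      have : phiSk F c c' z = 0 := by
        unfold phiSk
        rw [norm_eq_zero]; ext j; rw [skewF_eq]; simp [hc]
      linarith
  · intro R0 hR0 hR0ρ
    have hp := hpair x0 (Metric.mem_ball_self hρ1) R0 hR0 (hR0ρ.trans_le (min_le_left _ _))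
    have hτ4 : τ ≤ 1 / 4 := by rw [hτ]; linarith
    refine ⟨min (c1 * R0 ^ l / 2) (c1 * R0 ^ (2 * l) / (2 * R0)), by positivity, fun c => ?_, fun c c' a b => ?_⟩
    · by_cases hc : c = 0
      · exact ⟨x0, Metric.mem_closedBall_self hR0.le, by simp [hc, phiLin]⟩
      obtain ⟨q, -, hq0, -, h2, h3⟩ := hp.1 c hc
      obtain ⟨u, hu, hu2⟩ := toC_attain q
      refine ⟨x0 + R0 • u, by
        rw [mem_closedBall_zero_iff] at hu
        rw [Metric.mem_closedBall, dist_eq_norm, add_sub_cancel_left, norm_smul, Real.norm_of_nonneg hR0.le]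
        exact mul_le_of_le_one_right hR0.le hu, ?_⟩
      have h4 := h2 u hu
      have h5 : min (c1 * R0 ^ l / 2) (c1 * R0 ^ (2 * l) / (2 * R0)) * ‖c‖ ≤ c1 * R0 ^ l / 2 * ‖c‖ := by
        gcongr; exact min_le_left _ _
      have h6 : τ * ‖toC d q‖ ≤ 1 / 4 * ‖toC d q‖ := by gcongr
      nlinarith
    · by_cases hc : c a * c' b - c b * c' a = 0
      · exact ⟨x0, Metric.mem_closedBall_self hR0.le, by simp [hc, phiSk]⟩
      obtain ⟨j0, q, -, hq0, -, h2, h3⟩ := hp.2 c c' ⟨a, b, hc⟩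
      obtain ⟨u, hu, hu2⟩ := toC_attain q
      refine ⟨x0 + R0 • u, by
        rw [mem_closedBall_zero_iff] at hu
        rw [Metric.mem_closedBall, dist_eq_norm, add_sub_cancel_left, norm_smul, Real.norm_of_nonneg hR0.le]
        exact mul_le_of_le_one_right hR0.le hu, ?_⟩
      have h4 := h2 u hu
      have h6 : τ * ‖toC d q‖ ≤ 1 / 4 * ‖toC d q‖ := by gcongr
      have h7 := h3 a b
      calc _ ≤ c1 * R0 ^ (2 * l) / (2 * R0) * |c a * c' b - c b * c' a| := by
            gcongr; exact min_le_right _ _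
        _ = c1 * R0 ^ (2 * l) * |c a * c' b - c b * c' a| / 2 / R0 := by field_simp
        _ ≤ _ := by
          rw [div_le_iff₀ hR0]
          linarith
end GoodF3

section LatA

theorem alt_decomp {k : ℕ} (M0 : Matrix (Fin k) (Fin k) ℝ) (i1 i2 : Fin k) (h12 : i1 ≠ i2) :
    ∃ α β : (Fin k → ℝ) →ₗ[ℝ] ℝ, ∀ r r', ((M0.updateRow i1 r).updateRow i2 r').det = α r * β r' - β r * α r' := by
  by_cases hz : ∀ r r', ((M0.updateRow i1 r).updateRow i2 r').det = 0
  · exact ⟨0, 0, fun r r' => by simp [hz]⟩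
  push Not at hz
  obtain ⟨s, s', hs⟩ := hz
  set M := (M0.updateRow i1 s).updateRow i2 s' with hM
  have hu : IsUnit M.det := isUnit_iff_ne_zero.2 hs
  have hMM : ∀ r r', (M0.updateRow i1 r).updateRow i2 r' = (M.updateRow i1 r).updateRow i2 r' := by
    intro r r'
    ext i j
    simp only [hM, Matrix.updateRow_apply]
    split_ifs <;> rfl
  set γ : (Fin k → ℝ) →ₗ[ℝ] (Fin k → ℝ) := Matrix.vecMulLinear M⁻¹ with hγ
  have hγr : ∀ r, r = ∑ j, γ r j • M j := by
    intro r
    have : Matrix.vecMul (γ r) M = r := by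
      rw [hγ, Matrix.vecMulLinear_apply, Matrix.vecMul_vecMul, Matrix.nonsing_inv_mul _ hu, Matrix.vecMul_one]
    conv_lhs => rw [← this]
    rw [Matrix.vecMul_eq_sum]
  have h1 : ∀ r i, (M.updateRow i r).det = γ r i * M.det := by
    intro r i
    conv_lhs => rw [hγr r]
    rw [Matrix.det_updateRow_sum]; rfl
  refine ⟨(LinearMap.proj i1).comp γ, M.det • (LinearMap.proj i2).comp γ, fun r r' => ?_⟩
  rw [hMM]
  set A := M.updateRow i1 r with hA
  have hlin : (A.updateRow i2 r').det = ∑ j, γ r' j * (A.updateRow i2 (M j)).det := by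
    conv_lhs => rw [hγr r']
    have h3 : ∀ y, (A.updateRow i2 y).det = (Matrix.detRowAlternating (n := Fin k) (R := ℝ)).toMultilinearMap.toLinearMap A i2 y :=
      fun y => rfl
    rw [h3, map_sum]
    refine Finset.sum_congr rfl fun j _ => ?_
    rw [map_smul, ← h3, smul_eq_mul]
  rw [hlin, ← Finset.add_sum_erase _ _ (Finset.mem_univ i1),
    ← Finset.add_sum_erase _ _ (Finset.mem_erase.2 ⟨h12.symm, Finset.mem_univ i2⟩), Finset.sum_eq_zero]
  · have e1 : A.updateRow i2 (M i2) = M.updateRow i1 r := by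
      rw [hA]; ext i j
      simp only [Matrix.updateRow_apply]
      split_ifs with ha hb
      · exact absurd (hb.symm.trans ha) h12
      · rw [ha]
      · rfl
      · rfl
    have e2 : (A.updateRow i2 (M i1)).det = - (M.updateRow i2 r).det := by
      have h4 := Matrix.det_permute (Equiv.swap i1 i2) (M.updateRow i2 r)
      rw [Equiv.Perm.sign_swap h12] at h4
      have h5 : A.updateRow i2 (M i1) = (M.updateRow i2 r).submatrix (Equiv.swap i1 i2) id := by
        ext i j
        simp only [hA, Matrix.updateRow_apply, Matrix.submatrix_apply, id, Equiv.swap_apply_def]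
        by_cases a1 : i = i2
        · simp [a1, h12, h12.symm]
        · by_cases a2 : i = i1
          · simp [a2, h12]
          · simp [a1, a2]
      rw [h5, h4]; simp
    rw [e1, e2, h1, h1]
    simp; ring
  · intro j hj
    simp only [Finset.mem_erase, Finset.mem_univ, and_true] at hj
    rw [Matrix.det_zero_of_row_eq (i := i2) (j := j) (Ne.symm hj.1), mul_zero]
    ext c
    simp [hA, Matrix.updateRow_apply, hj.1, hj.2]

theorem exists_minor {𝕜 : Type} [Field 𝕜] {ι : Type} [Fintype ι] {k : ℕ} (b : Fin k → ι → 𝕜) (hb : LinearIndependent 𝕜 b) :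
    ∃ a : Fin k → ι, (Matrix.of fun i j => b j (a i)).det ≠ 0 := by
  set B : Matrix ι (Fin k) 𝕜 := Matrix.of fun p j => b j p with hB
  have hr : B.rank = k := by
    have h := LinearIndependent.rank_matrix (M := B.transpose) hb
    rw [Matrix.rank_transpose] at h
    simpa using h
  rw [Matrix.rank_eq_finrank_span_row] at hr
  obtain ⟨f, hf, -, hli⟩ := Submodule.exists_fun_fin_finrank_span_eq 𝕜 (range B.row)
  choose a ha using hf
  refine ⟨a ∘ (finCongr hr.symm), ?_⟩
  have h2 := hli.comp (finCongr hr.symm) (finCongr hr.symm).injective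
  have h3 := Matrix.linearIndependent_rows_iff_isUnit.1 (show LinearIndependent 𝕜
    (Matrix.of fun i j => b j ((a ∘ (finCongr hr.symm)) i)).row by
    have h4 : (Matrix.of fun i j => b j ((a ∘ (finCongr hr.symm)) i)).row = f ∘ (finCongr hr.symm) := by
      ext i j
      simp only [Function.comp, ← ha]; rfl
    rw [h4]; exact h2)
  exact ((Matrix.isUnit_iff_isUnit_det _).1 h3).ne_zero

def castQ {ι : Type} (v : ι → ℤ) : ι → ℚ := fun p => (v p : ℚ)
def castR {ι : Type} (v : ι → ℤ) : ι → ℝ := fun p => (v p : ℝ)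

def Tup {ι : Type} (V : Submodule ℚ (ι → ℚ)) (k : ℕ) (b : Fin k → ι → ℤ) : Prop :=
  LinearIndependent ℚ (fun j => castQ (b j)) ∧ ∀ j, castQ (b j) ∈ V

theorem tup_compare {ι : Type} [Fintype ι] (V : Submodule ℚ (ι → ℚ)) (k : ℕ) (hk : Module.finrank ℚ V = k)
    (b b' : Fin k → ι → ℤ) (hb : Tup V k b) (hb' : Tup V k b') : ∃ c : ℝ, ∀ L : Fin k → (ι → ℝ) →ₗ[ℝ] ℝ,
      (Matrix.of fun i j => L i (castR (b' j))).det = c * (Matrix.of fun i j => L i (castR (b j))).det := by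
  have hspan : Submodule.span ℚ (range fun j => castQ (b j)) = V := by
    refine Submodule.eq_of_le_of_finrank_eq (Submodule.span_le.2 (by rintro _ ⟨j, rfl⟩; exact hb.2 j)) ?_
    rw [finrank_span_eq_card hb.1, hk]; simp
  have hm : ∀ j, ∃ m : Fin k → ℚ, ∑ i, m i • castQ (b i) = castQ (b' j) := by
    intro j
    have := hb'.2 j
    rw [← hspan] at this
    exact (Submodule.mem_span_range_iff_exists_fun ℚ).1 this
  choose m hm using hm
  refine ⟨(Matrix.of fun i j => ((m j i : ℚ) : ℝ)).det, fun L => ?_⟩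
  rw [mul_comm, ← Matrix.det_mul]
  congr 1
  ext i j
  have h1 : castR (b' j) = ∑ a, ((m j a : ℚ) : ℝ) • castR (b a) := by
    ext p
    have := congrFun (hm j) p
    simp only [Finset.sum_apply, Pi.smul_apply, castQ, castR, smul_eq_mul] at this ⊢
    have h2 := congrArg (fun q : ℚ => (q : ℝ)) this
    push_cast at h2
    exact h2.symm
  rw [Matrix.of_apply, h1, map_sum, Matrix.mul_apply]
  refine Finset.sum_congr rfl fun a _ => ?_
  rw [map_smul]; simp [mul_comm]

theorem exists_tuple {ι : Type} [Fintype ι] (V : Submodule ℚ (ι → ℚ)) :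
    ∃ b : Fin (Module.finrank ℚ V) → ι → ℤ, Tup V _ b := by
  set v := Module.finBasis ℚ V with hv
  have h := fun j => IsLocalization.exist_integer_multiples_of_finite (nonZeroDivisors ℤ) (fun p => (v j : ι → ℚ) p)
  choose D hD using h
  choose b hb using hD
  have hbv : ∀ j, castQ (b j) = ((D j : ℤ) : ℚ) • (v j : ι → ℚ) := by
    intro j; ext p
    have := hb j p
    simpa [castQ] using this
  have hD0 : ∀ j, ((D j : ℤ) : ℚ) ≠ 0 := fun j => by
    have := nonZeroDivisors.ne_zero (D j).2
    exact_mod_cast this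
  refine ⟨b, ?_, fun j => ?_⟩
  · have h1 : LinearIndependent ℚ (fun j => (v j : ι → ℚ)) :=
      v.linearIndependent.map' V.subtype (by simp)
    have h2 := h1.units_smul (fun j => Units.mk0 _ (hD0 j))
    convert h2 using 1
    ext1 j; rw [hbv]; rfl
  · rw [hbv]; exact V.smul_mem _ (v j).2

noncomputable def minorSum {ι : Type} [Fintype ι] {k : ℕ} (b : Fin k → ι → ℤ) : ℕ :=
  ∑ a : Fin k → ι, ((Matrix.of fun i j => b j (a i)).det).natAbs

theorem det_castR {ι : Type} {k : ℕ} (b : Fin k → ι → ℤ) (a : Fin k → ι) :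
    (Matrix.of fun i j => castR (b j) (a i)).det = (((Matrix.of fun i j => b j (a i)).det : ℤ) : ℝ) := by
  have := Int.cast_det (R := ℝ) (Matrix.of fun i j => b j (a i))
  rw [this]; rfl

theorem minor_ne {ι : Type} [Fintype ι] {k : ℕ} {V : Submodule ℚ (ι → ℚ)} (b : Fin k → ι → ℤ) (hb : Tup V k b) :
    ∃ a : Fin k → ι, (Matrix.of fun i j => b j (a i)).det ≠ 0 := by
  obtain ⟨a, ha⟩ := exists_minor _ hb.1
  refine ⟨a, fun h => ha ?_⟩
  have := Int.cast_det (R := ℚ) (Matrix.of fun i j => b j (a i))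
  rw [h] at this
  rw [Int.cast_zero] at this
  exact this.symm

theorem exists_min_tuple {ι : Type} [Fintype ι] (V : Submodule ℚ (ι → ℚ)) :
    ∃ kb : Σ k : ℕ, (Fin k → ι → ℤ), Module.finrank ℚ V = kb.1 ∧ Tup V kb.1 kb.2 ∧
      ∀ b' : Fin kb.1 → ι → ℤ, Tup V kb.1 b' → ∃ c : ℝ, 1 ≤ |c| ∧ ∀ L : Fin kb.1 → (ι → ℝ) →ₗ[ℝ] ℝ,
      (Matrix.of fun i j => L i (castR (b' j))).det = c * (Matrix.of fun i j => L i (castR (kb.2 j))).det := by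
  classical
  have hne : {b : Fin (Module.finrank ℚ V) → ι → ℤ | Tup V _ b}.Nonempty := exists_tuple V
  obtain ⟨b, hb, hmin⟩ := exists_minimalFor_of_wellFoundedLT (fun b : Fin (Module.finrank ℚ V) → ι → ℤ => Tup V _ b) minorSum hne
  refine ⟨⟨_, b⟩, rfl, hb, fun b' hb' => ?_⟩
  obtain ⟨c, hc⟩ := tup_compare V _ rfl b b' hb hb'
  refine ⟨c, ?_, hc⟩
  have hle : minorSum b ≤ minorSum b' := by
    by_contra hlt
    push Not at hlt
    exact absurd (hmin hb' hlt.le) (not_le.2 hlt)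
  have hsum : ∀ b : Fin (Module.finrank ℚ V) → ι → ℤ, (minorSum b : ℝ) =
      ∑ a : Fin (Module.finrank ℚ V) → ι, |(Matrix.of fun i j => castR (b j) (a i)).det| := by
    intro b
    unfold minorSum
    push_cast
    refine Finset.sum_congr rfl fun a _ => ?_
    rw [det_castR, Nat.cast_natAbs]; simp
  have heq : (minorSum b' : ℝ) = |c| * minorSum b := by
    rw [hsum, hsum, Finset.mul_sum]
    refine Finset.sum_congr rfl fun a _ => ?_
    rw [← abs_mul]; congr 1
    exact hc fun i => LinearMap.proj (a i)
  have hpos : (0 : ℝ) < minorSum b := by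
    obtain ⟨a, ha⟩ := minor_ne b hb
    have : 0 < minorSum b := lt_of_lt_of_le (Int.natAbs_pos.2 ha)
      (Finset.single_le_sum (f := fun a => ((Matrix.of fun i j => b j (a i)).det).natAbs) (fun _ _ => Nat.zero_le _) (Finset.mem_univ a))
    exact_mod_cast this
  have hle' : (minorSum b : ℝ) ≤ minorSum b' := by exact_mod_cast hle
  rw [heq] at hle'
  by_contra hlt
  push Not at hlt
  nlinarith
end LatA

section LatB
variable {d : ℕ} {ι : Type} [Fintype ι]

noncomputable def ellw (F : (Fin d → ℝ) → ι → ℝ) (wv wn we : ℝ) (x : Fin d → ℝ) :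
    Fin d ⊕ Option ι → (ι → ℝ) →ₗ[ℝ] ℝ
  | .inl i => wn • ∑ p, fderiv ℝ F x (Pi.single i 1) p • LinearMap.proj p
  | .inr none => wv • ∑ p, F x p • LinearMap.proj p
  | .inr (some p) => we • LinearMap.proj p

theorem ellw_inl (F : (Fin d → ℝ) → ι → ℝ) (wv wn we : ℝ) (x : Fin d → ℝ) (i : Fin d) (y : ι → ℝ) :
    ellw F wv wn we x (.inl i) y = wn * dlinF F y x i := by
  simp [ellw, dlinF, mul_comm]
theorem ellw_none (F : (Fin d → ℝ) → ι → ℝ) (wv wn we : ℝ) (x : Fin d → ℝ) (y : ι → ℝ) :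
    ellw F wv wn we x (.inr none) y = wv * linF F y x := by
  simp [ellw, linF, mul_comm]
theorem ellw_some (F : (Fin d → ℝ) → ι → ℝ) (wv wn we : ℝ) (x : Fin d → ℝ) (p : ι) (y : ι → ℝ) :
    ellw F wv wn we x (.inr (some p)) y = we * y p := by
  simp [ellw]

noncomputable def compN (F : (Fin d → ℝ) → ι → ℝ) (wv wn we : ℝ) {k : ℕ} (b : Fin k → ι → ℤ)
    (a : Fin k → Fin d ⊕ Option ι) (x : Fin d → ℝ) : ℝ :=
  (Matrix.of fun i j => ellw F wv wn we x (a i) (castR (b j))).det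

def admN {k : ℕ} (a : Fin k → Fin d ⊕ Option ι) : Prop := ∀ i i' u u', a i = .inl u → a i' = .inl u' → i = i'

open Classical in
noncomputable def nuN (F : (Fin d → ℝ) → ι → ℝ) (wv wn we : ℝ) {k : ℕ} (b : Fin k → ι → ℤ) (x : Fin d → ℝ) : ℝ :=
  ‖fun a : Fin k → Fin d ⊕ Option ι => if admN a then compN F wv wn we b a x else 0‖

theorem compN_le (F : (Fin d → ℝ) → ι → ℝ) (wv wn we : ℝ) {k : ℕ} (b : Fin k → ι → ℤ) (x : Fin d → ℝ)
    (a : Fin k → Fin d ⊕ Option ι) (ha : admN a) : |compN F wv wn we b a x| ≤ nuN F wv wn we b x := by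
  classical
  have := norm_le_pi_norm (fun a : Fin k → Fin d ⊕ Option ι => if admN a then compN F wv wn we b a x else 0) a
  simp only [ha, if_true, Real.norm_eq_abs] at this
  refine this.trans (le_of_eq ?_)
  unfold nuN
  congr! 3

theorem nuN_le (F : (Fin d → ℝ) → ι → ℝ) (wv wn we : ℝ) {k : ℕ} (b : Fin k → ι → ℤ) (x : Fin d → ℝ) (B : ℝ) (hB : 0 ≤ B)
    (h : ∀ a : Fin k → Fin d ⊕ Option ι, admN a → |compN F wv wn we b a x| ≤ B) : nuN F wv wn we b x ≤ B := by
  classical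
  refine (pi_norm_le_iff_of_nonneg hB).2 fun a => ?_
  by_cases ha : admN a
  · simp only [ha, if_true, Real.norm_eq_abs]; exact h a ha
  · simp [ha, hB]

theorem nuN_nonneg (F : (Fin d → ℝ) → ι → ℝ) (wv wn we : ℝ) {k : ℕ} (b : Fin k → ι → ℤ) (x : Fin d → ℝ) :
    0 ≤ nuN F wv wn we b x := norm_nonneg _

theorem nuN_attain (F : (Fin d → ℝ) → ι → ℝ) (wv wn we : ℝ) {k : ℕ} (b : Fin k → ι → ℤ) (x : Fin d → ℝ) (M : ℝ)
    (hM : 0 < M) (h : M ≤ nuN F wv wn we b x) : ∃ a : Fin k → Fin d ⊕ Option ι, admN a ∧ M ≤ |compN F wv wn we b a x| := by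
  by_contra hc
  push Not at hc
  classical
  have : nuN F wv wn we b x < M := by
    refine (pi_norm_lt_iff hM).2 fun a => ?_
    by_cases ha : admN a
    · simp only [ha, if_true, Real.norm_eq_abs]; exact hc a ha
    · simp [ha, hM]
  linarith

theorem nuN_cons (F : (Fin d → ℝ) → ι → ℝ) (wv wn we : ℝ) {k : ℕ} (b : Fin k → ι → ℤ) (x : Fin d → ℝ) (v : ι → ℤ)
    (η : ℝ) (hη : 0 ≤ η) (hv : ∀ a, |ellw F wv wn we x a (castR v)| ≤ η) :
    nuN F wv wn we (Fin.cons v b : Fin (k + 1) → ι → ℤ) x ≤ (k + 1) * η * nuN F wv wn we b x := by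
  have h0 := nuN_nonneg F wv wn we b x
  refine nuN_le _ _ _ _ _ _ _ (by positivity) fun a ha => ?_
  unfold compN
  rw [Matrix.det_succ_column_zero]
  refine (Finset.abs_sum_le_sum_abs _ _).trans ?_
  calc _ ≤ ∑ i : Fin (k + 1), η * nuN F wv wn we b x := by
        refine Finset.sum_le_sum fun i _ => ?_
        rw [abs_mul, abs_mul, abs_pow, abs_neg, abs_one, one_pow, one_mul]
        refine mul_le_mul ?_ ?_ (abs_nonneg _) hη
        · simpa using hv (a i)
        · refine le_trans (le_of_eq ?_) (compN_le F wv wn we b x (a ∘ i.succAbove) ?_)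
          · unfold compN; congr 2
          · intro j j' u u' h1 h2
            exact Fin.succAbove_right_injective (ha _ _ _ _ h1 h2)
    _ = _ := by simp; ring

theorem nuN_scale (F : (Fin d → ℝ) → ι → ℝ) (wv wn we : ℝ) {k : ℕ} (b b' : Fin k → ι → ℤ) (x : Fin d → ℝ) (c : ℝ)
    (hc : 1 ≤ |c|) (h : ∀ L : Fin k → (ι → ℝ) →ₗ[ℝ] ℝ,
      (Matrix.of fun i j => L i (castR (b' j))).det = c * (Matrix.of fun i j => L i (castR (b j))).det) :
    nuN F wv wn we b x ≤ nuN F wv wn we b' x := by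
  refine nuN_le _ _ _ _ _ _ _ (nuN_nonneg _ _ _ _ _ _) fun a ha => ?_
  refine le_trans ?_ (compN_le F wv wn we b' x a ha)
  have := h fun i => ellw F wv wn we x (a i)
  unfold compN
  rw [this, abs_mul]
  exact le_mul_of_one_le_left (abs_nonneg _) hc

theorem nuN_zero (F : (Fin d → ℝ) → ι → ℝ) (wv wn we : ℝ) (b : Fin 0 → ι → ℤ) (x : Fin d → ℝ) :
    nuN F wv wn we b x ≤ 1 :=
  nuN_le _ _ _ _ _ _ _ zero_le_one fun a _ => by simp [compN]

noncomputable def eMat (we : ℝ) {k : ℕ} (b : Fin k → ι → ℤ) (a : Fin k → Fin d ⊕ Option ι) : Matrix (Fin k) (Fin k) ℝ :=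
  Matrix.of fun i j => match a i with
    | .inr (some p) => we * castR (b j) p
    | _ => 0

def rowB {k : ℕ} (b : Fin k → ι → ℤ) (p : ι) : Fin k → ℝ := fun j => castR (b j) p

theorem row_val (F : (Fin d → ℝ) → ι → ℝ) (wv wn we : ℝ) {k : ℕ} (b : Fin k → ι → ℤ) (x : Fin d → ℝ)
    (α : (Fin k → ℝ) →ₗ[ℝ] ℝ) :
    α (fun j => ellw F wv wn we x (.inr none) (castR (b j))) = wv * linF F (fun p => α (rowB b p)) x := by
  have : (fun j => ellw F wv wn we x (.inr none) (castR (b j))) = wv • ∑ p, F x p • rowB b p := by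
    ext j; rw [ellw_none]; simp [linF, rowB, mul_comm]
  rw [this, map_smul, map_sum]
  simp [linF, mul_comm]

theorem row_grad (F : (Fin d → ℝ) → ι → ℝ) (wv wn we : ℝ) {k : ℕ} (b : Fin k → ι → ℤ) (x : Fin d → ℝ) (i : Fin d)
    (α : (Fin k → ℝ) →ₗ[ℝ] ℝ) :
    α (fun j => ellw F wv wn we x (.inl i) (castR (b j))) = wn * dlinF F (fun p => α (rowB b p)) x i := by
  have : (fun j => ellw F wv wn we x (.inl i) (castR (b j))) =
      wn • ∑ p, fderiv ℝ F x (Pi.single i 1) p • rowB b p := by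
    ext j; rw [ellw_inl]; simp [dlinF, rowB, mul_comm]
  rw [this, map_smul, map_sum]
  simp [dlinF, mul_comm]

theorem linF_smul (F : (Fin d → ℝ) → ι → ℝ) (c : ℝ) (y : ι → ℝ) (x) : linF F (c • y) x = c * linF F y x := by
  simp [linF, Finset.mul_sum, mul_assoc]
theorem dlinF_smul (F : (Fin d → ℝ) → ι → ℝ) (c : ℝ) (y : ι → ℝ) (x j) : dlinF F (c • y) x j = c * dlinF F y x j := by
  simp [dlinF, Finset.mul_sum, mul_assoc]

theorem skew_rep (F : (Fin d → ℝ) → ι → ℝ) (wv wn we : ℝ) {k : ℕ} (b : Fin k → ι → ℤ)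
    (a : Fin k → Fin d ⊕ Option ι) (i1 i2 : Fin k) (h12 : i1 ≠ i2)
    (he : ∀ i, i ≠ i1 → i ≠ i2 → ∃ p, a i = .inr (some p)) :
    ∃ y y' : ι → ℝ, (∀ x i, compN F wv wn we b (Function.update (Function.update a i1 (.inr none)) i2 (.inl i)) x =
      skewF F y y' x i) ∧ ∀ p q, y p * y' q - y q * y' p =
        wv * wn * (((eMat we b a).updateRow i1 (rowB b p)).updateRow i2 (rowB b q)).det := by
  obtain ⟨α, β, hab⟩ := alt_decomp (eMat we b a) i1 i2 h12
  refine ⟨(wv * wn) • fun p => α (rowB b p), fun p => β (rowB b p), fun x i => ?_, fun p q => ?_⟩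
  · have : compN F wv wn we b (Function.update (Function.update a i1 (.inr none)) i2 (.inl i)) x =
      (((eMat we b a).updateRow i1 (fun j => ellw F wv wn we x (.inr none) (castR (b j)))).updateRow i2
        (fun j => ellw F wv wn we x (.inl i) (castR (b j)))).det := by
      unfold compN
      congr 1
      ext r c
      simp only [Matrix.of_apply, Matrix.updateRow_apply, Function.update_apply]
      by_cases h2 : r = i2
      · simp [h2]
      · by_cases h1 : r = i1
        · simp [h1, h12]
        · obtain ⟨p, hp⟩ := he r h1 h2
          simp [h1, h2, hp, eMat, ellw_some]
    rw [this, hab, row_val, row_grad, row_val, row_grad]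
    simp only [skewF, linF_smul, dlinF_smul]
    ring
  · rw [hab]
    simp only [Pi.smul_apply, smul_eq_mul]; ring

theorem good_cover (F : (Fin d → ℝ) → ι → ℝ) (wv wn we : ℝ) {k : ℕ} (b : Fin k → ι → ℤ) (o : ι)
    (hFo : ∀ x, F x o = 1) (hdo : ∀ x j, fderiv ℝ F x (Pi.single j 1) o = 0) 
    (a : Fin k → Fin d ⊕ Option ι) (ha : admN a) :
    (∃ y, ∀ x, |compN F wv wn we b a x| ≤ phiLin F y x ∧ phiLin F y x ≤ nuN F wv wn we b x) ∨
    (∃ y y', ∀ x, |compN F wv wn we b a x| ≤ phiSk F y y' x ∧ phiSk F y y' x ≤ nuN F wv wn we b x) := by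
  classical
  by_cases hrep : ∃ i1 i1', i1 ≠ i1' ∧ a i1 = .inr none ∧ a i1' = .inr none
  · obtain ⟨i1, i1', hne, h1, h1'⟩ := hrep
    refine Or.inl ⟨0, fun x => ?_⟩
    have h0 : compN F wv wn we b a x = 0 := Matrix.det_zero_of_row_eq hne (by ext j; simp [h1, h1'])
    have : phiLin F 0 x = 0 := by simp [phiLin, linF]
    rw [h0, this]; simp [nuN_nonneg]
  push Not at hrep
  have hlinrow : ∀ i2 : Fin k, ∃ lam : (Fin k → ℝ) →ₗ[ℝ] ℝ, ∀ r, ((eMat we b a).updateRow i2 r).det = lam r := fun i2 =>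
    ⟨(Matrix.detRowAlternating (n := Fin k) (R := ℝ)).toMultilinearMap.toLinearMap (eMat we b a) i2, fun r => rfl⟩
  by_cases hg : ∃ i2 u, a i2 = .inl u
  · right
    obtain ⟨i2, u, h2⟩ := hg
    have hadm : ∀ i, admN (Function.update a i2 (.inl i)) := by
      intro i j j' v v' hj hj'
      simp only [Function.update_apply] at hj hj'
      split_ifs at hj hj' with e1 e2 e2
      · rw [e1, e2]
      · rw [e1]; exact ha _ _ _ _ h2 hj'
      · rw [e2]; exact ha _ _ _ _ hj h2
      · exact ha _ _ _ _ hj hj'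
    suffices h : ∃ y y', ∀ x i, compN F wv wn we b (Function.update a i2 (.inl i)) x = skewF F y y' x i by
      obtain ⟨y, y', h⟩ := h
      refine ⟨y, y', fun x => ⟨?_, ?_⟩⟩
      · have := h x u
        rw [← h2, Function.update_eq_self] at this
        rw [this]
        exact norm_le_pi_norm (fun j => skewF F y y' x j) u
      · refine (pi_norm_le_iff_of_nonneg (nuN_nonneg _ _ _ _ _ _)).2 fun i => ?_
        rw [← h]
        exact compN_le _ _ _ _ _ _ _ (hadm i)
    by_cases hv : ∃ i1, a i1 = .inr none
    · obtain ⟨i1, h1⟩ := hv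
      have h12 : i1 ≠ i2 := by rintro rfl; rw [h1] at h2; simp at h2
      obtain ⟨y, y', hy, -⟩ := skew_rep F wv wn we b a i1 i2 h12 (by
        intro i hi1 hi2
        rcases hai : a i with u' | (_ | p)
        · exact absurd (ha _ _ _ _ hai h2) hi2
        · exact absurd hai (fun h => hrep i i1 hi1 h h1)
        · exact ⟨p, rfl⟩)
      refine ⟨y, y', fun x i => ?_⟩
      rw [← hy, ← h1, Function.update_eq_self]
    · push Not at hv
      obtain ⟨lam, hlam⟩ := hlinrow i2
      refine ⟨Pi.single o 1, fun p => wn * lam (rowB b p), fun x i => ?_⟩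
      have e1 : linF F (Pi.single o 1) x = 1 := by simp [linF, Pi.single_apply, hFo]
      have e2 : dlinF F (Pi.single o 1) x i = 0 := by simp [dlinF, Pi.single_apply, hdo]
      have e3 := dlinF_smul F wn (fun p => lam (rowB b p)) x i
      rw [skewF, e1, e2, one_mul, mul_zero, sub_zero]
      refine Eq.trans ?_ e3.symm
      rw [← row_grad F wv wn we b x i lam, ← hlam]
      unfold compN
      congr 1
      ext r c
      simp only [Matrix.of_apply, Matrix.updateRow_apply, Function.update_apply]
      by_cases hr2 : r = i2
      · simp [hr2]
      · rcases hai : a r with u' | (_ | p)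
        · exact absurd (ha _ _ _ _ hai h2) hr2
        · exact absurd hai (hv r)
        · simp [hr2, hai, eMat, ellw_some]
  · left
    push Not at hg
    suffices h : ∃ y, ∀ x, compN F wv wn we b a x = linF F y x by
      obtain ⟨y, h⟩ := h
      refine ⟨y, fun x => ?_⟩
      rw [phiLin, ← h]
      exact ⟨le_rfl, compN_le _ _ _ _ _ _ _ ha⟩
    by_cases hv : ∃ i1, a i1 = .inr none
    · obtain ⟨i1, h1⟩ := hv
      obtain ⟨lam, hlam⟩ := hlinrow i1
      refine ⟨wv • fun p => lam (rowB b p), fun x => ?_⟩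
      rw [linF_smul, ← row_val F wv wn we b x lam, ← hlam]
      unfold compN
      congr 1
      ext r c
      simp only [Matrix.of_apply, Matrix.updateRow_apply]
      by_cases hr2 : r = i1
      · simp [hr2, h1]
      · rcases hai : a r with u' | (_ | p)
        · exact absurd hai (hg r u')
        · exact absurd hai (fun h => hrep r i1 hr2 h h1)
        · simp [hr2, hai, eMat, ellw_some]
    · push Not at hv
      refine ⟨Pi.single o ((eMat we b a).det), fun x => ?_⟩
      have : linF F (Pi.single o ((eMat we b a).det)) x = (eMat we b a).det := by
        simp [linF, Pi.single_apply, hFo]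
      rw [this]
      unfold compN
      congr 1
      ext r c
      rcases hai : a r with u' | (_ | p)
      · exact absurd hai (hg r u')
      · exact absurd hai (hv r)
      · simp [hai, eMat, ellw_some]

theorem nuN_good (F : (Fin d → ℝ) → ι → ℝ) (wv wn we : ℝ) {k : ℕ} (b : Fin k → ι → ℤ) (o : ι)
    (hFo : ∀ x, F x o = 1) (hdo : ∀ x j, fderiv ℝ F x (Pi.single j 1) o = 0) (W : Set (Fin d → ℝ)) (C α : ℝ)
    (h1 : ∀ c, GoodG (phiLin F c) W C α) (h2 : ∀ c c', GoodG (phiSk F c c') W C α) :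
    GoodG (nuN F wv wn we b) W C α := by
  intro x R hR hW M ε hM hε hz
  obtain ⟨z, hz, hMz⟩ := hz
  obtain ⟨a, ha, haM⟩ := nuN_attain F wv wn we b z M hM hMz
  rcases good_cover F wv wn we b o hFo hdo a ha with ⟨y, hy⟩ | ⟨y, y', hy⟩
  · refine (measure_mono ?_).trans (h1 y x R hR hW M ε hM hε ⟨z, hz, haM.trans (hy z).1⟩)
    rintro w ⟨hw, hw2⟩
    exact ⟨hw, lt_of_le_of_lt (hy w).2 hw2⟩
  · refine (measure_mono ?_).trans (h2 y y' x R hR hW M ε hM hε ⟨z, hz, haM.trans (hy z).1⟩)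
    rintro w ⟨hw, hw2⟩
    exact ⟨hw, lt_of_le_of_lt (hy w).2 hw2⟩

theorem nuN_cont (F : (Fin d → ℝ) → ι → ℝ) (wv wn we : ℝ) {k : ℕ} (b : Fin k → ι → ℤ) (W : Set (Fin d → ℝ))
    (h1 : ContinuousOn F W) (h2 : ContinuousOn (fderiv ℝ F) W) : ContinuousOn (nuN F wv wn we b) W := by
  classical
  have hell : ∀ a y, ContinuousOn (fun x => ellw F wv wn we x a y) W := by
    intro a y
    rcases a with i | (_ | p)
    · simp only [ellw_inl]
      refine continuousOn_const.mul (continuousOn_finsetSum _ fun p _ => ?_)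
      exact continuousOn_const.mul ((continuous_apply p).comp_continuousOn (h2.clm_apply continuousOn_const))
    · simp only [ellw_none]
      refine continuousOn_const.mul (continuousOn_finsetSum _ fun p _ => ?_)
      exact continuousOn_const.mul ((continuous_apply p).comp_continuousOn h1)
    · simp only [ellw_some]; exact continuousOn_const
  unfold nuN
  refine ContinuousOn.norm (continuousOn_pi.2 fun a => ?_)
  by_cases ha : admN a
  · simp only [ha, if_true, compN]
    simp only [Matrix.det_apply]
    refine continuousOn_finsetSum _ fun σ _ => ContinuousOn.const_smul ?_ _
    exact continuousOn_finsetProd _ fun i _ => hell _ _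
  · simp only [ha, if_false]; exact continuousOn_const

end LatB

section LatC
variable {d : ℕ} {ι : Type} [Fintype ι]

theorem nuN_lower (F : (Fin d → ℝ) → ι → ℝ) (wv wn we : ℝ) (hwv : 0 < wv) (hwn : 0 < wn) (hwe : 0 < we)
    (D : Set (Fin d → ℝ)) (cl : ℝ) (hcl : 0 < cl)
    (h1 : ∀ c, ∃ z ∈ D, cl * ‖c‖ ≤ phiLin F c z)
    (h2 : ∀ c c' a b, ∃ z ∈ D, cl * |c a * c' b - c b * c' a| ≤ phiSk F c c' z)
    {k : ℕ} {V : Submodule ℚ (ι → ℚ)} (b : Fin k → ι → ℤ) (hb : Tup V k b) (hk : k ≠ 0) (ρ : ℝ)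
    (hρ1 : ρ ≤ cl * wv) (hρ2 : ∀ k', k' + 2 = k → ρ ≤ cl * (wv * wn * we ^ k')) :
    ∃ z ∈ D, ρ ≤ nuN F wv wn we b z := by
  classical
  obtain _ | _ | k := k
  · exact absurd rfl hk
  · obtain ⟨z, hz, hz'⟩ := h1 (castR (b 0))
    refine ⟨z, hz, ?_⟩
    have hn : 1 ≤ ‖castR (b 0)‖ := by
      have : b 0 ≠ 0 := fun h => hb.1.ne_zero 0 (by simp only [h]; rfl)
      obtain ⟨p, hp⟩ := Function.ne_iff.1 this
      refine le_trans ?_ (norm_le_pi_norm _ p)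
      simp only [castR, Real.norm_eq_abs, ← Int.cast_abs]
      exact_mod_cast Int.one_le_abs hp
    have := compN_le F wv wn we b z (fun _ => .inr none) (by intro i i' u u' h; simp at h)
    refine le_trans ?_ this
    have hc : compN F wv wn we b (fun _ => .inr none) z = wv * linF F (castR (b 0)) z := by
      unfold compN
      rw [← ellw_none F wv wn we]
      exact Matrix.det_fin_one _
    rw [hc, abs_mul, abs_of_pos hwv]
    unfold phiLin at hz'
    nlinarith [mul_le_mul_of_nonneg_left hn hcl.le]
  · obtain ⟨a0, ha0⟩ := minor_ne b hb
    obtain ⟨y, y', hy1, hy2⟩ := skew_rep F wv wn we b (fun i => .inr (some (a0 i))) 0 1 (by simp)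
      (fun i _ _ => ⟨_, rfl⟩)
    obtain ⟨z, hz, hz'⟩ := h2 y y' (a0 0) (a0 1)
    refine ⟨z, hz, ?_⟩
    have hS : phiSk F y y' z ≤ nuN F wv wn we b z := by
      unfold phiSk
      refine (pi_norm_le_iff_of_nonneg (nuN_nonneg _ _ _ _ _ _)).2 fun j => ?_
      rw [← hy1, Real.norm_eq_abs]
      refine compN_le _ _ _ _ _ _ _ ?_
      intro i i' u u' h h'
      by_cases hi : i = 1
      · by_cases hi' : i' = 1
        · rw [hi, hi']
        · by_cases h0 : i' = 0
          · subst h0; simp at h'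
          · simp [Function.update_of_ne hi', Function.update_of_ne h0] at h'
      · by_cases h0 : i = 0
        · subst h0; simp at h
        · simp [Function.update_of_ne hi, Function.update_of_ne h0] at h
    refine le_trans ?_ (hz'.trans hS)
    rw [hy2]
    have hdet : (((eMat we b (fun i => (.inr (some (a0 i)) : Fin d ⊕ Option ι))).updateRow 0 (rowB b (a0 0))).updateRow 1
        (rowB b (a0 1))).det = we ^ k * (Matrix.of fun i j => castR (b j) (a0 i)).det := by
      have hM : (((eMat we b (fun i => (.inr (some (a0 i)) : Fin d ⊕ Option ι))).updateRow 0 (rowB b (a0 0))).updateRow 1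
        (rowB b (a0 1))) = Matrix.of fun i j => (if i = 0 ∨ i = 1 then 1 else we) *
            (Matrix.of fun i j => castR (b j) (a0 i)) i j := by
        ext i j
        by_cases hi : i = 1
        · subst hi; simp [rowB]
        · by_cases h0 : i = 0
          · subst h0; simp [rowB, Matrix.updateRow_ne]
          · simp [Matrix.updateRow_ne, hi, h0, eMat]
      rw [hM, Matrix.det_mul_column]
      congr 1
      rw [Fin.prod_univ_succ, Fin.prod_univ_succ]
      simp [Fin.ext_iff]
    rw [hdet, det_castR, abs_mul (wv * wn), abs_mul (we ^ k), abs_of_pos (mul_pos hwv hwn), abs_of_pos (pow_pos hwe k), ← Int.cast_abs]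
    have h1' : (1 : ℝ) ≤ ((|(Matrix.of fun i j => b j (a0 i)).det| : ℤ) : ℝ) := by
      exact_mod_cast Int.one_le_abs ha0
    refine (hρ2 k rfl).trans ?_
    have hp : 0 < wv * wn * we ^ k := by positivity
    rw [← mul_assoc (wv * wn)]
    exact mul_le_mul_of_nonneg_left (le_mul_of_one_le_right hp.le h1') hcl.le

theorem castQ_inj {v : ι → ℤ} (h : castQ v = 0) : v = 0 := by
  ext p; have := congrFun h p; simpa [castQ] using this

noncomputable def kbC (V : Submodule ℚ (ι → ℚ)) : Σ k : ℕ, (Fin k → ι → ℤ) := (exists_min_tuple V).choose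

theorem kbC_min (F : (Fin d → ℝ) → ι → ℝ) (wv wn we : ℝ) (V : Submodule ℚ (ι → ℚ)) {k : ℕ} (b' : Fin k → ι → ℤ)
    (hk : Module.finrank ℚ V = k) (hb' : Tup V k b') (x) :
    nuN F wv wn we (kbC V).2 x ≤ nuN F wv wn we b' x := by
  have h := (exists_min_tuple V).choose_spec
  change Module.finrank ℚ V = (kbC V).1 ∧ Tup V (kbC V).1 (kbC V).2 ∧ _ at h
  have h3 := h.2.2
  have hk' : (kbC V).1 = k := h.1.symm.trans hk
  subst hk'
  obtain ⟨c, hc, hL⟩ := h3 b' hb'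
  exact nuN_scale F wv wn we _ _ x c hc hL

theorem kbC_rank (V : Submodule ℚ (ι → ℚ)) : Module.finrank ℚ V = (kbC V).1 := (exists_min_tuple V).choose_spec.1
theorem kbC_tup (V : Submodule ℚ (ι → ℚ)) : Tup V (kbC V).1 (kbC V).2 := (exists_min_tuple V).choose_spec.2.1

theorem marked_min (F : (Fin d → ℝ) → ι → ℝ) (wv wn we ε ρs : ℝ) (x : Fin d → ℝ)
    (hM : MarkedKM (fun (V : {V : Submodule ℚ (ι → ℚ) // V ≠ ⊥}) x => nuN F wv wn we (kbC V.1).2 x) ε ρs x)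
    (v : ι → ℤ) (hv : v ≠ 0) (η : ℝ) (hη : 0 ≤ η) (h : ∀ a, |ellw F wv wn we x a (castR v)| ≤ η) :
    min ε ρs ≤ Fintype.card ι * η := by
  classical
  obtain ⟨G, hG, hG1, hG2⟩ := hM
  have hs0 : ∃ s0 : Submodule ℚ (ι → ℚ), castQ v ∉ s0 ∧ (∀ s ∈ G, castQ v ∉ s.1 → s.1 ≤ s0) ∧
      (∀ s ∈ G, castQ v ∈ s.1 → s0 ≤ s.1) ∧ nuN F wv wn we (kbC s0).2 x ≤ 1 := by
    by_cases hne : (G.filter fun s => castQ v ∉ s.1).Nonempty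
    · obtain ⟨s0, hs0, hmax⟩ := Finset.exists_maximal hne
      rw [Finset.mem_filter] at hs0
      refine ⟨s0.1, hs0.2, fun s hs hvs => ?_, fun s hs hvs => ?_, (hG1 s0 hs0.1).2⟩
      · rcases hG.total (Finset.mem_coe.2 hs) (Finset.mem_coe.2 hs0.1) with h' | h'
        · exact h'
        · exact hmax (Finset.mem_filter.2 ⟨hs, hvs⟩) h'
      · rcases hG.total (Finset.mem_coe.2 hs) (Finset.mem_coe.2 hs0.1) with h' | h'
        · exact absurd (h' hvs) hs0.2
        · exact h'
    · rw [Finset.not_nonempty_iff_eq_empty] at hne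
      have hr : (kbC (⊥ : Submodule ℚ (ι → ℚ))).1 = 0 := by rw [← kbC_rank]; simp
      refine ⟨⊥, fun hc => hv (castQ_inj ((Submodule.mem_bot ℚ).1 hc)), fun s hs hvs => ?_, fun s hs _ => bot_le, ?_⟩
      · have : s ∈ G.filter fun s => castQ v ∉ s.1 := Finset.mem_filter.2 ⟨hs, hvs⟩
        rw [hne] at this; simp at this
      · revert hr
        generalize kbC (⊥ : Submodule ℚ (ι → ℚ)) = kb
        obtain ⟨k, b⟩ := kb
        intro hk
        change k = 0 at hk
        subst hk
        exact nuN_zero _ _ _ _ _ _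
  obtain ⟨s0, hvs, hlt, hgt, hn1⟩ := hs0
  set V : Submodule ℚ (ι → ℚ) := s0 ⊔ Submodule.span ℚ {castQ v} with hV
  have hvV : castQ v ∈ V := Submodule.mem_sup_right (Submodule.mem_span_singleton_self _)
  have hVb : V ≠ ⊥ := fun hc => hv (castQ_inj ((Submodule.mem_bot ℚ).1 (hc ▸ hvV)))
  have hlow : min ε ρs ≤ nuN F wv wn we (kbC V).2 x := by
    by_cases hVG : (⟨V, hVb⟩ : {V : Submodule ℚ (ι → ℚ) // V ≠ ⊥}) ∈ G
    · exact (min_le_left _ _).trans (hG1 _ hVG).1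
    · refine (min_le_right _ _).trans (hG2 ⟨V, hVb⟩ hVG (hG.insert fun s hs _ => ?_))
      by_cases hvs' : castQ v ∈ s.1
      · exact Or.inl (sup_le (hgt s hs hvs') ((Submodule.span_singleton_le_iff_mem _ _).2 hvs'))
      · exact Or.inr ((hlt s hs hvs').trans le_sup_left)
  have hT := kbC_tup s0
  have hsp : Submodule.span ℚ (range fun j => castQ ((kbC s0).2 j)) ≤ s0 :=
    Submodule.span_le.2 (by rintro _ ⟨j, rfl⟩; exact hT.2 j)
  have hcons : (fun j => castQ ((Fin.cons v (kbC s0).2 : Fin ((kbC s0).1 + 1) → ι → ℤ) j)) =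
      (Fin.cons (castQ v) (fun j => castQ ((kbC s0).2 j)) : Fin ((kbC s0).1 + 1) → ι → ℚ) := by
    ext j : 1
    refine Fin.cases ?_ (fun j => ?_) j <;> simp
  have hTV : Tup V ((kbC s0).1 + 1) (Fin.cons v (kbC s0).2) := by
    refine ⟨?_, fun j => ?_⟩
    · rw [hcons, linearIndependent_finCons]
      exact ⟨hT.1, fun hc => hvs (hsp hc)⟩
    · refine Fin.cases ?_ (fun j => ?_) j
      · simpa using hvV
      · simpa using Submodule.mem_sup_left (hT.2 j)
  have hrk : Module.finrank ℚ V = (kbC s0).1 + 1 := by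
    refine le_antisymm ?_ ?_
    · refine (Submodule.finrank_add_le_finrank_add_finrank _ _).trans ?_
      rw [kbC_rank s0, finrank_span_singleton (fun hc => hv (castQ_inj hc))]
    · have := hTV.1.fintype_card_le_finrank (R := ℚ)
      have h2 : LinearIndependent ℚ (fun j => (⟨_, hTV.2 j⟩ : V)) :=
        LinearIndependent.of_comp V.subtype hTV.1
      simpa using h2.fintype_card_le_finrank
  have hN : ((kbC s0).1 : ℝ) + 1 ≤ Fintype.card ι := by
    have := Submodule.finrank_le V
    rw [hrk, Module.finrank_fintype_fun_eq_card] at this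
    exact_mod_cast this
  have h1 := kbC_min F wv wn we V _ hrk hTV x
  have h2 := nuN_cons F wv wn we (kbC s0).2 x v η hη h
  have h3 := nuN_nonneg F wv wn we (kbC s0).2 x
  have h4 : ((kbC s0).1 + 1 : ℝ) * η * nuN F wv wn we (kbC s0).2 x ≤ Fintype.card ι * η * 1 := by gcongr
  linarith

theorem chain_card (G : Finset {V : Submodule ℚ (ι → ℚ) // V ≠ ⊥}) (hG : IsChain (· ≤ ·) (↑G : Set {V : Submodule ℚ (ι → ℚ) // V ≠ ⊥})) :
    G.card ≤ Fintype.card ι := by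
  have hlt : ∀ s : {V : Submodule ℚ (ι → ℚ) // V ≠ ⊥}, Module.finrank ℚ s.1 ∈ Finset.Icc 1 (Fintype.card ι) := by
    intro s
    have := Submodule.finrank_le s.1
    rw [Module.finrank_fintype_fun_eq_card] at this
    exact Finset.mem_Icc.2 ⟨Nat.one_le_iff_ne_zero.2 fun h => s.2 (Submodule.finrank_eq_zero.1 h), this⟩
  have := Finset.card_le_card_of_injOn (s := G) (t := Finset.Icc 1 (Fintype.card ι)) (fun s => Module.finrank ℚ s.1)
    (fun s _ => hlt s) (fun s hs t ht hst => ?_)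
  · simpa using this
  · rcases hG.total hs ht with h | h
    · exact Subtype.ext (Submodule.eq_of_le_of_finrank_eq h hst)
    · exact (Subtype.ext (Submodule.eq_of_le_of_finrank_eq h hst.symm)).symm

theorem quant_nondiv (F : (Fin d → ℝ) → ι → ℝ) (l : ℕ) (hl : 2 ≤ l) (hd : 1 ≤ d) (x0 : Fin d → ℝ) (V : Set (Fin d → ℝ))
    (hV : IsOpen V) (hF : ContDiffOn ℝ l F V) (hx0 : x0 ∈ V) (h : ApproxAt F l x0) (o : ι)
    (hFo : ∀ x, F x o = 1) (hdo : ∀ x j, fderiv ℝ F x (Pi.single j 1) o = 0) :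
    ∃ ρ > 0, ∃ c0 > 0, ∃ C > 0, ∀ δ K T A : ℝ, 0 < δ → 0 < K → 1 ≤ T → 1 ≤ A → A * δ ≤ c0 →
      A ^ Fintype.card ι * δ * K * T ^ (Fintype.card ι - 2) ≤ c0 →
      volume {x | x ∈ Metric.closedBall x0 ρ ∧ ∃ v : ι → ℤ, v ≠ 0 ∧ |linF F (castR v) x| ≤ δ ∧
        (∀ i, |dlinF F (castR v) x i| ≤ K) ∧ ∀ p, |(v p : ℝ)| ≤ T} ≤
      ENNReal.ofReal (C * A ^ (-(((d * (2 * l - 1) : ℕ) : ℝ)⁻¹))) := by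
  classical
  obtain ⟨ρ, hρ, C, hC, hsub, -, -, hg1, hg2, hlow⟩ := good_all F l hl hd x0 V hV hF hx0 h
  set α : ℝ := (((d * (2 * l - 1) : ℕ) : ℝ)⁻¹) with hα
  have hα0 : 0 < α := by
    have : 0 < d * (2 * l - 1) := Nat.mul_pos (by omega) (by omega)
    positivity
  set N := Fintype.card ι with hN
  have hN1 : (1 : ℝ) ≤ N := by
    have : 0 < N := Fintype.card_pos_iff.2 ⟨o⟩
    exact_mod_cast this
  obtain ⟨ρs, hρs, Cj, hCj, hkm⟩ := km_abstract d C α hC hα0 N N 1 one_pos le_rfl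
  set R := ρ / (8 * (N + 1)) with hR
  have hR0 : 0 < R := by positivity
  have hRρ : 7 * ((N : ℝ) + 1) * R < ρ := by
    have : 7 * ((N : ℝ) + 1) * R = 7 / 8 * ρ := by rw [hR]; field_simp
    rw [this]; linarith
  obtain ⟨cl, hcl, hl1, hl2⟩ := hlow R hR0 (by nlinarith)
  set B := Metric.closedBall x0 R with hB
  have hBtop : volume B ≠ ∞ := by
    rw [hB]; exact measure_closedBall_lt_top.ne
  refine ⟨R, hR0, cl, hcl, (Cj * (2 * N) ^ α + (2 * N / ρs) ^ α) * (volume B).toReal + 1, by positivity,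
    fun δ K T A hδ hK hT hA hAδ hbig => ?_⟩
  have hA0 : 0 < A := by linarith
  have hT0 : 0 < T := by linarith
  have hAα : 0 < A ^ (-α) := Real.rpow_pos_of_pos hA0 _
  suffices hmain : volume {x | x ∈ B ∧ ∃ v : ι → ℤ, v ≠ 0 ∧ |linF F (castR v) x| ≤ δ ∧
        (∀ i, |dlinF F (castR v) x i| ≤ K) ∧ ∀ p, |(v p : ℝ)| ≤ T} ≤
        ENNReal.ofReal ((Cj * (2 * N) ^ α + (2 * N / ρs) ^ α) * A ^ (-α)) * volume B by
    refine hmain.trans ?_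
    rw [← ENNReal.ofReal_toReal hBtop, ← ENNReal.ofReal_mul (by positivity)]
    apply ENNReal.ofReal_le_ofReal
    rw [ENNReal.toReal_ofReal ENNReal.toReal_nonneg]
    nlinarith
  set ε : ℝ := 2 * N / A with hε
  have hε0 : 0 < ε := by positivity
  by_cases hερ : ρs < ε
  · refine (measure_mono (fun x hx => hx.1)).trans ?_
    refine le_mul_of_one_le_left (zero_le) ?_
    rw [ENNReal.one_le_ofReal, add_mul]
    have h1 : 1 ≤ (2 * N / ρs) ^ α * A ^ (-α) := by
      rw [Real.rpow_neg hA0.le, ← div_eq_mul_inv, ← Real.div_rpow (by positivity) hA0.le]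
      refine Real.one_le_rpow ?_ hα0.le
      rw [hε, lt_div_iff₀ hA0] at hερ
      rw [div_div, le_div_iff₀ (by positivity)]; linarith
    have h2 : 0 ≤ Cj * (2 * N : ℝ) ^ α * A ^ (-α) := by positivity
    linarith
  push Not at hερ
  set wv := 1 / (A * δ)
  set wn := 1 / (A * K)
  set we := 1 / (A * T)
  have hwv : 0 < wv := by positivity
  have hwn : 0 < wn := by positivity
  have hwe : 0 < we := by positivity
  have hl0 : 1 ≤ cl * wv := by
    rw [mul_one_div, le_div_iff₀ (by positivity)]; linarith
  have hcF := hF.continuousOn.mono hsub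
  have hcF' := (hF.continuousOn_fderiv_of_isOpen hV (by exact_mod_cast (by omega : 1 ≤ l))).mono hsub
  have key := hkm {V : Submodule ℚ (ι → ℚ) // V ≠ ⊥} (fun V x => nuN F wv wn we (kbC V.1).2 x) (Metric.ball x0 ρ)
    (fun s => nuN_cont F wv wn we _ _ hcF hcF') (fun s => nuN_good F wv wn we _ o hFo hdo _ _ _ hg1 hg2)
    (fun G hG => chain_card G hG) ∅ (by simp [IsChain]) (by simp) x0 R hR0
    (Metric.closedBall_subset_ball hRρ) (fun s _ _ => ?_) ε hε0
  · refine le_trans (measure_mono ?_) (key.trans ?_)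
    · rintro x ⟨hxB, v, hv, hv1, hv2, hv3⟩
      refine ⟨hxB, by simp, fun hM => ?_⟩
      have := marked_min F wv wn we ε ρs x hM v hv (1 / A) (by positivity) ?_
      · rw [min_eq_left hερ, hε, mul_one_div, div_le_div_iff_of_pos_right hA0] at this
        linarith
      · intro a
        rcases a with i | (_ | p)
        · rw [ellw_inl, abs_mul, abs_of_pos hwn]
          calc wn * |dlinF F (castR v) x i| ≤ wn * K := by gcongr; exact hv2 i
            _ = 1 / A := by simp only [wn]; field_simp
        · rw [ellw_none, abs_mul, abs_of_pos hwv]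
          calc wv * |linF F (castR v) x| ≤ wv * δ := by gcongr
            _ = 1 / A := by simp only [wv]; field_simp
        · rw [ellw_some, abs_mul, abs_of_pos hwe]
          calc we * |castR v p| ≤ we * T := by gcongr; exact hv3 p
            _ = 1 / A := by simp only [we]; field_simp
    · refine mul_le_mul_left (ENNReal.ofReal_le_ofReal ?_) _
      rw [hε, Real.div_rpow (by positivity) hA0.le, div_eq_mul_inv, ← Real.rpow_neg hA0.le, add_mul, mul_assoc]
      have : 0 ≤ (2 * N / ρs : ℝ) ^ α * A ^ (-α) := by positivity
      linarith
  · refine nuN_lower F wv wn we hwv hwn hwe B cl hcl hl1 hl2 (kbC s.1).2 (kbC_tup s.1) ?_ 1 hl0 ?_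
    · rw [← kbC_rank]; exact fun h => s.2 (Submodule.finrank_eq_zero.1 h)
    · intro k' hk'
      have hk2 : k' + 2 ≤ N := by
        rw [hk', ← kbC_rank]
        refine (Submodule.finrank_le s.1).trans ?_
        rw [Module.finrank_fintype_fun_eq_card]
      have e1 : wv * wn * we ^ k' = 1 / (A ^ (k' + 2) * δ * K * T ^ k') := by
        simp only [wv, wn, we, div_pow, mul_pow, one_pow, pow_add]; field_simp
      rw [e1, mul_one_div, le_div_iff₀ (by positivity), one_mul]
      refine le_trans ?_ hbig
      gcongr
      omega
end LatC

section CountA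
variable {ι : Type} [Fintype ι]

noncomputable def chr (v : ι → ℤ) (y : ι → ℝ) : ℂ := ∏ i, Complex.exp (2 * Real.pi * Complex.I * v i * y i)

theorem chr_eq (v : ι → ℤ) (y : ι → ℝ) : chr v y = Complex.exp ((2 * Real.pi * ∑ i, v i * y i : ℝ) * Complex.I) := by
  unfold chr
  rw [← Complex.exp_sum]
  congr 1
  push_cast
  rw [Finset.mul_sum, Finset.sum_mul]
  exact Finset.sum_congr rfl fun i _ => by ring

theorem chr_cont (v : ι → ℤ) : Continuous (chr v) := by unfold chr; fun_prop

theorem chr_int (w : ι → ℤ) : ∫ y in Set.pi Set.univ fun _ : ι => Set.Ico (0 : ℝ) 1, chr w y = if w = 0 then 1 else 0 := by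
  rw [volume_pi, Measure.restrict_pi_pi]
  unfold chr
  rw [integral_fintype_prod_eq_prod (fun i (t : ℝ) => Complex.exp (2 * Real.pi * Complex.I * w i * t))]
  have h1 : ∀ i, ∫ t : ℝ in Set.Ico 0 1, Complex.exp (2 * Real.pi * Complex.I * w i * t) = if w i = 0 then 1 else 0 := by
    intro i
    rw [integral_Ico_eq_integral_Ioc, ← intervalIntegral.integral_of_le zero_le_one]
    by_cases hw : w i = 0
    · simp [hw]
    · have hpi : (Real.pi : ℂ) ≠ 0 := by exact_mod_cast Real.pi_ne_zero
      have hw' : (w i : ℂ) ≠ 0 := by exact_mod_cast hw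
      rw [integral_exp_mul_complex (by simp [hpi, hw', Complex.I_ne_zero])]
      have : (2 * Real.pi * Complex.I * w i * ((1 : ℝ) : ℂ)) = w i * (2 * Real.pi * Complex.I) := by push_cast; ring
      rw [this, Complex.exp_int_mul_two_pi_mul_I]
      simp [hw]
  rw [Finset.prod_congr rfl fun i _ => h1 i]
  by_cases hw : w = 0
  · simp [hw]
  · obtain ⟨i, hi⟩ := Function.ne_iff.1 hw
    rw [if_neg hw]
    exact Finset.prod_eq_zero (Finset.mem_univ i) (if_neg hi)

theorem chr_mul_conj (v w : ι → ℤ) (y : ι → ℝ) : chr v y * (starRingEnd ℂ) (chr w y) = chr (v - w) y := by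
  rw [chr_eq, chr_eq, chr_eq, ← Complex.exp_conj, ← Complex.exp_add]
  congr 1
  simp only [map_mul, Complex.conj_ofReal, Complex.conj_I, Pi.sub_apply, Int.cast_sub, sub_mul, Finset.sum_sub_distrib]
  push_cast; ring

theorem count_fourier (S : Finset (ι → ℤ)) (P : Set (ι → ℝ)) (hP : MeasurableSet P)
    (hPP : ∀ y ∈ P, ∀ y' ∈ P, ∀ g : ι → ℤ, y' - y = castR g → g = 0) (v0 : ι → ℤ)
    (hS : ∀ v ∈ S, ∀ y ∈ P, |∑ i, ((v i - v0 i : ℤ) : ℝ) * y i| ≤ 1 / 8) :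
    (S.card : ℝ≥0∞) * volume P ≤ 2 := by
  classical
  set h : (ι → ℝ) → ℝ := fun y => ‖∑ v ∈ S, chr v y‖ ^ 2 with hh
  have hcont : Continuous h := by
    have : Continuous fun y => ∑ v ∈ S, chr v y := continuous_finsetSum _ fun v _ => chr_cont v
    exact this.norm.pow 2
  set H : (ι → ℝ) → ℝ≥0∞ := fun y => ENNReal.ofReal (h y) with hH
  have hHm : Measurable H := (hcont.measurable).ennreal_ofReal
  set D : Set (ι → ℝ) := Set.pi Set.univ fun _ : ι => Set.Ico (0 : ℝ) 1 with hD
  have hper : ∀ g : ι → ℤ, ∀ y, h (castR g + y) = h y := by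
    intro g y
    have : ∀ v : ι → ℤ, chr v (castR g + y) = chr v y := by
      intro v
      unfold chr
      refine Finset.prod_congr rfl fun i _ => ?_
      have e : (2 * Real.pi * Complex.I * v i * ((castR g + y) i : ℝ) : ℂ) =
          2 * Real.pi * Complex.I * v i * y i + ((v i * g i : ℤ) : ℂ) * (2 * Real.pi * Complex.I) := by
        simp only [castR, Pi.add_apply]; push_cast; ring
      rw [e, Complex.exp_add, Complex.exp_int_mul_two_pi_mul_I, mul_one]
    simp only [hh, this]
  set ν := (volume : Measure (ι → ℝ)).withDensity H with hν
  set G := Submodule.span ℤ (Set.range (Pi.basisFun ℝ ι)) with hG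
  have hGc : ∀ g : G, ∃ g' : ι → ℤ, (g : ι → ℝ) = castR g' := by
    intro g
    have := ((Pi.basisFun ℝ ι).mem_span_iff_repr_mem ℤ (g : ι → ℝ)).1 g.2
    choose g' hg' using this
    exact ⟨g', by ext i; simpa [castR] using (hg' i).symm⟩
  have : VAddInvariantMeasure G (ι → ℝ) ν := by
    refine ⟨fun g s hs => ?_⟩
    obtain ⟨g', hg'⟩ := hGc g
    have hmp : MeasurePreserving (fun y : ι → ℝ => castR g' + y) volume volume := measurePreserving_add_left _ _
    have e : ((fun x => g +ᵥ x) ⁻¹' s) = (fun y : ι → ℝ => castR g' + y) ⁻¹' s := by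
      ext y; simp only [mem_preimage]; rw [← hg']; rfl
    rw [e, withDensity_apply _ hs, withDensity_apply _ (hmp.measurable hs), ← hmp.setLIntegral_comp_preimage hs hHm]
    simp only [hH, hper]
  have hfund := ZSpan.isAddFundamentalDomain (Pi.basisFun ℝ ι) ν
  have hle : ν P ≤ ν D := by
    by_contra hlt
    push Not at hlt
    rw [hD, ← ZSpan.fundamentalDomain_pi_basisFun] at hlt
    obtain ⟨x, hx, y, hy, g, hg, hxy⟩ := hfund.exists_ne_zero_vadd_eq hP.nullMeasurableSet hlt
    obtain ⟨g', hg'⟩ := hGc g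
    have h0 : g' = 0 := hPP x hx y hy g' (by rw [← hg', ← hxy]; simp [Submodule.vadd_def])
    apply hg
    ext1
    rw [hg', h0]; ext i; simp [castR]
  have hDm : MeasurableSet D := MeasurableSet.univ_pi fun _ => measurableSet_Ico
  have hDfin : volume D ≠ ∞ := by
    rw [hD, volume_pi, Measure.pi_pi]; simp
  have hint : ∀ v : ι → ℤ, IntegrableOn (chr v) D := by
    intro v
    refine (integrableOn_const (C := (1 : ℝ)) hDfin).mono' (chr_cont v).aestronglyMeasurable (ae_of_all _ fun y => ?_)
    rw [chr_eq, Complex.norm_exp_ofReal_mul_I]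
  have hexp : ∀ y, (h y : ℂ) = ∑ v ∈ S, ∑ w ∈ S, chr (v - w) y := by
    intro y
    rw [hh]
    push_cast
    rw [← Complex.mul_conj', map_sum, Finset.sum_mul_sum]
    simp only [chr_mul_conj]
  have hνD : ν D = S.card := by
    rw [withDensity_apply _ hDm, ← ofReal_integral_eq_lintegral_ofReal]
    · have : ((∫ y in D, h y : ℝ) : ℂ) = (S.card : ℝ) := by
        rw [← integral_complex_ofReal]
        simp only [hexp]
        rw [integral_finsetSum _ fun v _ => integrable_finsetSum _ fun w _ => hint _]
        rw [Finset.sum_congr rfl fun v _ => integral_finsetSum _ fun w _ => hint _]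
        simp only [hD, chr_int, sub_eq_zero]
        simp
      rw [Complex.ofReal_inj.1 this]; simp
    · have : IntegrableOn (fun y => (h y : ℂ)) D := by
        simp only [hexp]
        exact integrable_finsetSum _ fun v _ => integrable_finsetSum _ fun w _ => hint _
      exact this.re
    · exact ae_of_all _ fun y => by positivity
  have hlow : ∀ y ∈ P, (S.card : ℝ) ^ 2 / 2 ≤ h y := by
    intro y hy
    have h1 : (S.card : ℝ) * (√2 / 2) ≤ ‖∑ v ∈ S, chr v y‖ := by
      have e : ‖∑ v ∈ S, chr v y‖ = ‖∑ v ∈ S, chr (v - v0) y‖ := by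
        simp only [← chr_mul_conj]
        rw [← Finset.sum_mul, norm_mul]
        rw [chr_eq v0, RCLike.norm_conj, Complex.norm_exp_ofReal_mul_I, mul_one]
      rw [e]
      refine le_trans ?_ (Complex.re_le_norm _)
      rw [Complex.re_sum]
      refine le_trans (by simp) (Finset.card_nsmul_le_sum S _ (√2 / 2) fun v hv => ?_)
      rw [chr_eq, Complex.exp_ofReal_mul_I_re, ← Real.cos_abs, ← Real.cos_pi_div_four]
      have h2 := hS v hv y hy
      have : |2 * Real.pi * ∑ i, (((v - v0) i : ℤ) : ℝ) * y i| ≤ Real.pi / 4 := by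
        rw [abs_mul, abs_of_pos Real.two_pi_pos]
        calc _ ≤ 2 * Real.pi * (1 / 8) := mul_le_mul_of_nonneg_left h2 Real.two_pi_pos.le
          _ = _ := by ring
      exact Real.cos_le_cos_of_nonneg_of_le_pi (abs_nonneg _) (by linarith [Real.pi_pos]) this
    have h3 : 0 ≤ (S.card : ℝ) * (√2 / 2) := by positivity
    calc _ = ((S.card : ℝ) * (√2 / 2)) ^ 2 := by rw [mul_pow, div_pow, Real.sq_sqrt (by norm_num)]; ring
      _ ≤ _ := pow_le_pow_left₀ h3 h1 2
  have hνP : ENNReal.ofReal ((S.card : ℝ) ^ 2 / 2) * volume P ≤ ν P := by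
    rw [withDensity_apply _ hP, ← setLIntegral_const]
    exact setLIntegral_mono hHm fun y hy => ENNReal.ofReal_le_ofReal (hlow y hy)
  by_cases hS0 : S.card = 0
  · simp [hS0]
  have hfin := (hνP.trans hle).trans_eq hνD
  have hc0 : (0 : ℝ) < S.card := by exact_mod_cast Nat.pos_of_ne_zero hS0
  have e : (S.card : ℝ≥0∞) * volume P = ENNReal.ofReal (2 / S.card) * (ENNReal.ofReal ((S.card : ℝ) ^ 2 / 2) * volume P) := by
    rw [← mul_assoc, ← ENNReal.ofReal_mul (by positivity), ← ENNReal.ofReal_natCast]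
    congr 2; field_simp
  rw [e]
  calc _ ≤ ENNReal.ofReal (2 / S.card) * S.card := mul_le_mul_right hfin _
    _ = 2 := by
      rw [← ENNReal.ofReal_natCast, ← ENNReal.ofReal_mul (by positivity), div_mul_cancel₀ _ hc0.ne']; simp
end CountA

section BoxA
variable {d : ℕ} {ι : Type} [Fintype ι] [DecidableEq ι]

theorem ext_det {k : ℕ} (u : Fin k → ι → ℝ) (hu : LinearIndependent ℝ u) : ∃ σ : Fin k → ι, Function.Injective σ ∧
    (Matrix.of (Function.extend σ u fun p => Pi.single p 1)).det ≠ 0 := by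
  obtain ⟨σ, hσ⟩ := exists_minor u hu
  have hinj : Function.Injective σ := by
    intro i j hij
    by_contra hne
    exact hσ (Matrix.det_zero_of_row_eq hne (by ext c; simp [hij]))
  refine ⟨σ, hinj, fun h0 => ?_⟩
  obtain ⟨a, ha, hMa⟩ := Matrix.exists_mulVec_eq_zero_iff.2 h0
  apply ha
  have hout : ∀ p, (¬ ∃ k, σ k = p) → a p = 0 := by
    intro p hp
    have := congrFun hMa p
    simpa [Matrix.mulVec, dotProduct, Function.extend_apply' _ _ _ hp, Pi.single_apply] using this
  have hz : (Matrix.of fun i j => u j (σ i)).transpose.mulVec (a ∘ σ) = 0 := by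
    ext k
    have := congrFun hMa (σ k)
    simp only [Matrix.mulVec, dotProduct, Matrix.of_apply, hinj.extend_apply] at this
    refine Eq.trans ?_ this
    simp only [Matrix.mulVec, dotProduct, Matrix.transpose_apply, Matrix.of_apply, Function.comp]
    rw [← Finset.sum_subset (Finset.subset_univ (Finset.univ.image σ)) (fun p _ hp => ?_),
      Finset.sum_image fun _ _ _ _ h => hinj h]
    rw [hout p (fun ⟨k, hk⟩ => hp (Finset.mem_image.2 ⟨k, Finset.mem_univ _, hk⟩)), mul_zero]
  have hz2 : a ∘ σ = 0 := by
    by_contra hne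
    exact hσ (by rw [← Matrix.det_transpose]; exact Matrix.exists_mulVec_eq_zero_iff.1 ⟨_, hne, hz⟩)
  ext p
  by_cases hp : ∃ k, σ k = p
  · obtain ⟨k, rfl⟩ := hp; exact congrFun hz2 k
  · exact hout p hp

theorem ext_prod {k : ℕ} (σ : Fin k → ι) (hσ : Function.Injective σ) (ω : Fin k → ℝ) (T : ℝ) :
    ∏ p, Function.extend σ ω (fun _ => T) p = (∏ j, ω j) * T ^ (Fintype.card ι - k) := by
  rw [← Finset.prod_mul_prod_compl (Finset.univ.image σ), Finset.prod_image fun _ _ _ _ h => hσ h]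
  congr 1
  · exact Finset.prod_congr rfl fun j _ => hσ.extend_apply _ _ _
  · rw [Finset.prod_congr rfl (g := fun _ => T)]
    · rw [Finset.prod_const, Finset.card_compl, Finset.card_image_of_injective _ hσ]; simp
    · intro p hp
      refine Function.extend_apply' _ _ _ fun ⟨k, hk⟩ => ?_
      simp only [Finset.mem_compl, Finset.mem_image, Finset.mem_univ, true_and, not_exists] at hp
      exact hp k hk

noncomputable def uRow (F : (Fin d → ℝ) → ι → ℝ) (x : Fin d → ℝ) : Fin (d + 1) → ι → ℝ :=
  Fin.cons (F x) (fun i => fderiv ℝ F x (Pi.single i 1))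

theorem local_box (F : (Fin d → ℝ) → ι → ℝ) (x0 : Fin d → ℝ) (h1 : ContinuousAt F x0) (h2 : ContinuousAt (fderiv ℝ F) x0)
    (hli : LinearIndependent ℝ (uRow F x0)) : ∃ r > 0, ∃ c > 0, ∃ C > 0, ∀ x ∈ Metric.ball x0 r, ∀ δ K T : ℝ,
      0 < δ → 0 < K → 0 < T → δ ≤ T → K ≤ T → ∃ P : Set (ι → ℝ), MeasurableSet P ∧
        ENNReal.ofReal (c * (δ * K ^ d * T ^ (Fintype.card ι - (d + 1)))) ≤ volume P ∧
        ∀ a ∈ P, |linF F a x| ≤ δ ∧ (∀ i, |dlinF F a x i| ≤ K) ∧ ‖a‖ ≤ C * T := by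
  obtain ⟨σ, hσ, hdet⟩ := ext_det _ hli
  obtain ⟨M, hM⟩ : ∃ M : (Fin d → ℝ) → Matrix ι ι ℝ, M = fun x =>
    Matrix.of (Function.extend σ (uRow F x) fun p => Pi.single p 1) := ⟨_, rfl⟩
  have hMdet : (M x0).det ≠ 0 := by rw [hM]; exact hdet
  have hMc : ContinuousAt M x0 := by
    refine continuousAt_pi.2 fun p => ?_
    by_cases hp : ∃ k, σ k = p
    · obtain ⟨k, rfl⟩ := hp
      have : (fun x => M x (σ k)) = fun x => uRow F x k := by
        ext x : 1; rw [hM]; exact hσ.extend_apply (uRow F x) (fun p => Pi.single p 1) k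
      rw [this]
      refine Fin.cases ?_ (fun i => ?_) k
      · simpa [uRow] using h1
      · simpa [uRow] using h2.clm_apply continuousAt_const
    · have : (fun x => M x p) = fun x => Pi.single p 1 := by
        ext x : 1; rw [hM]; exact Function.extend_apply' (uRow F x) (fun p => Pi.single p 1) p hp
      rw [this]; exact continuousAt_const
  have hev : ∀ᶠ x in 𝓝 x0, (M x).det ≠ 0 ∧ |(M x).det| < |(M x0).det| + 1 ∧ ∃ B : (ι → ℝ) →L[ℝ] (ι → ℝ),
      ‖B‖ < ‖(Matrix.toLin' (M x0)⁻¹).toContinuousLinearMap‖ + 1 ∧ ∀ a, B ((M x).mulVec a) = a := by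
    have hd : ContinuousAt (fun x => (M x).det) x0 := (continuous_id.matrix_det).continuousAt.comp hMc
    have hinv : ContinuousAt (fun x => (Matrix.toLin' (M x)⁻¹).toContinuousLinearMap) x0 := by
      have e : (fun x => (Matrix.toLin' (M x)⁻¹).toContinuousLinearMap) = fun x =>
        (((M x).det)⁻¹) • (Matrix.toLin' (M x).adjugate).toContinuousLinearMap := by
        ext x : 1; rw [Matrix.inv_def]; simp
      rw [e]
      refine (hd.inv₀ hMdet).smul ?_
      have hl : Continuous (LinearMap.toContinuousLinearMap.toLinearMap ∘ₗ (Matrix.toLin' (R := ℝ) (m := ι) (n := ι)).toLinearMap) :=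
        LinearMap.continuous_of_finiteDimensional _
      exact (hl.comp (continuous_id.matrix_adjugate)).continuousAt.comp hMc
    filter_upwards [hd.eventually_ne hMdet, hd.abs.eventually_lt_const (lt_add_one _),
      hinv.norm.eventually_lt_const (lt_add_one _)] with x hx1 hx2 hx3
    refine ⟨hx1, hx2, _, hx3, fun a => ?_⟩
    simp [Matrix.mulVec_mulVec, Matrix.nonsing_inv_mul _ (Ne.isUnit hx1)]
  obtain ⟨r, hr, hball⟩ := Metric.eventually_nhds_iff_ball.1 hev
  obtain ⟨Bn, hBn⟩ : ∃ b : ℝ, b = ‖(Matrix.toLin' (M x0)⁻¹).toContinuousLinearMap‖ + 1 := ⟨_, rfl⟩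
  have hBn0 : 0 < Bn := by rw [hBn]; positivity
  refine ⟨r, hr, (|(M x0).det| + 1)⁻¹, by positivity, Bn, hBn0, fun x hx δ K T hδ hK hT hδT hKT => ?_⟩
  obtain ⟨hx1, hx2, B, hB, hBM⟩ := hball x hx
  rw [← hBn] at hB
  set ω : Fin (d + 1) → ℝ := Fin.cons δ (fun _ => K) with hω
  set w : ι → ℝ := Function.extend σ ω (fun _ => T) with hw
  have hωb : ∀ k, 0 < ω k ∧ ω k ≤ T := fun k => by
    refine Fin.cases ?_ (fun i => ?_) k
    · simpa [hω] using ⟨hδ, hδT⟩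
    · simpa [hω] using ⟨hK, hKT⟩
  have hwb : ∀ p, 0 < w p ∧ w p ≤ T := fun p => by
    by_cases hp : ∃ k, σ k = p
    · obtain ⟨k, rfl⟩ := hp
      rw [hw, hσ.extend_apply]; exact hωb k
    · rw [hw, Function.extend_apply' _ _ _ hp]; exact ⟨hT, le_rfl⟩
  have hmem : ∀ a, a ∈ (Matrix.toLin' (M x)) ⁻¹' (Set.Icc (-w) w) → ∀ p, |(M x).mulVec a p| ≤ w p := by
    intro a ha p
    rw [mem_preimage, Matrix.toLin'_apply] at ha
    exact abs_le.2 ⟨ha.1 p, ha.2 p⟩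
  refine ⟨(Matrix.toLin' (M x)) ⁻¹' (Set.Icc (-w) w), ?_, ?_, fun a ha => ⟨?_, fun i => ?_, ?_⟩⟩
  · exact (LinearMap.continuous_of_finiteDimensional _).measurable measurableSet_Icc
  · rw [Measure.addHaar_preimage_linearMap _ (by rwa [LinearMap.det_toLin'])]
    rw [LinearMap.det_toLin', Real.volume_Icc_pi, ← ENNReal.ofReal_prod_of_nonneg, ← ENNReal.ofReal_mul (by positivity)]
    · apply ENNReal.ofReal_le_ofReal
      have e1 : ∏ p, w p = δ * K ^ d * T ^ (Fintype.card ι - (d + 1)) := by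
        rw [hw, ext_prod σ hσ, hω, Fin.prod_univ_succ]; simp
      rw [abs_inv, ← e1]
      have hp : ∏ p, w p ≤ ∏ p, (w p - (-w) p) :=
        Finset.prod_le_prod (fun p _ => (hwb p).1.le) fun p _ => by simp only [Pi.neg_apply]; linarith [(hwb p).1]
      have hp0 : 0 ≤ ∏ p, w p := Finset.prod_nonneg fun p _ => (hwb p).1.le
      have : 0 < |(M x).det| := abs_pos.2 hx1
      gcongr
    · intro p _; simp only [Pi.neg_apply]; linarith [(hwb p).1]
  · have := hmem a ha (σ 0)
    rw [hw, hσ.extend_apply, hM] at this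
    simp only [Matrix.mulVec, dotProduct, Matrix.of_apply, hσ.extend_apply] at this
    simpa [linF, uRow, hω, mul_comm] using this
  · have := hmem a ha (σ i.succ)
    rw [hw, hσ.extend_apply, hM] at this
    simp only [Matrix.mulVec, dotProduct, Matrix.of_apply, hσ.extend_apply] at this
    simpa [dlinF, uRow, hω, mul_comm] using this
  · have h3 : ‖(M x).mulVec a‖ ≤ T := (pi_norm_le_iff_of_nonneg hT.le).2 fun p => (hmem a ha p).trans (hwb p).2
    calc ‖a‖ = ‖B ((M x).mulVec a)‖ := by rw [hBM]
      _ ≤ ‖B‖ * ‖(M x).mulVec a‖ := B.le_opNorm _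
      _ ≤ Bn * T := by gcongr
end BoxA

section GenA
variable {d : ℕ} {ι : Type} [Fintype ι] [DecidableEq ι]

theorem generic_count (F : (Fin d → ℝ) → ι → ℝ) (x0 : Fin d → ℝ) (Θ : ι → ℝ) (r B : ℝ) (hr : 0 < r) (hB : 0 ≤ B)
    (htay : ∀ x ∈ Metric.ball x0 r, ∀ x1 ∈ Metric.ball x0 r, ∀ p,
      |F x1 p - F x p - fderiv ℝ F x (x1 - x) p| ≤ B * ‖x1 - x‖ ^ 2)
    (h1 : ContinuousAt F x0) (h2 : ContinuousAt (fderiv ℝ F) x0)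
    (hli : LinearIndependent ℝ (uRow F x0)) :
    ∃ r' > 0, r' ≤ r ∧ ∃ c1 > 0, ∃ C ≥ (1 : ℝ), ∀ x ∈ Metric.ball x0 r', ∀ ε Q : ℝ, 0 < ε → ε ≤ 1 → 1 ≤ Q →
      (∀ v : ι → ℤ, |linF F (castR v) x| ≤ 2 * (c1 / Q) → (∀ i, |dlinF F (castR v) x i| ≤ 2 * (c1 / √(ε * Q))) →
        (∀ p, |(v p : ℝ)| ≤ C / ε) → v = 0) → ∀ S : Finset (ι → ℤ),
      (∀ v ∈ S, ∃ q x1, |q| ≤ 3 * Q ∧ x1 ∈ Metric.ball x0 r ∧ ‖x1 - x‖ ≤ √(ε / Q) ∧ ∀ p, |q * F x1 p - v p - Θ p| ≤ ε) →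
      (S.card : ℝ) ≤ C * (Q * √(ε * Q) ^ d * ε ^ (Fintype.card ι - (d + 1))) := by
  obtain ⟨r1, hr1, c, hc, C0, hC0, hbox⟩ := local_box F x0 h1 h2 hli
  obtain ⟨N, hN⟩ : ∃ N : ℝ, N = Fintype.card ι := ⟨_, rfl⟩
  have hN0 : 0 ≤ N := by rw [hN]; positivity
  obtain ⟨Z, hZ⟩ : ∃ Z : ℝ, Z = 3 + 3 * d + N * C0 + 3 * N * C0 * B := ⟨_, rfl⟩
  have hZ0 : 0 < Z := by rw [hZ]; positivity
  obtain ⟨c1, hc1⟩ : ∃ c1 : ℝ, c1 = 1 / (16 * Z) := ⟨_, rfl⟩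
  have hc10 : 0 < c1 := by rw [hc1]; positivity
  obtain ⟨e, he⟩ : ∃ e : ℕ, e = Fintype.card ι - (d + 1) := ⟨_, rfl⟩
  refine ⟨min r r1, lt_min hr hr1, min_le_left _ _, c1, hc10, 1 + 2 * (C0 * c1) + 2 / (c * (c1 * c1 ^ d * c1 ^ e)), ?_,
    fun x hx ε Q hε hε1 hQ hgen S hS => ?_⟩
  · have : 0 < 2 * (C0 * c1) + 2 / (c * (c1 * c1 ^ d * c1 ^ e)) := by positivity
    linarith
  have hQ0 : 0 < Q := by linarith
  have hxr := Metric.ball_subset_ball (min_le_left r r1) hx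
  have hεQ : 0 < √(ε * Q) := Real.sqrt_pos.2 (by positivity)
  have hεle : ε ≤ √(ε * Q) := Real.le_sqrt_of_sq_le (by nlinarith)
  obtain ⟨δ, hδ⟩ : ∃ δ, δ = c1 / Q := ⟨_, rfl⟩
  obtain ⟨K, hK⟩ : ∃ K, K = c1 / √(ε * Q) := ⟨_, rfl⟩
  obtain ⟨T, hT⟩ : ∃ T, T = c1 / ε := ⟨_, rfl⟩
  have hδ0 : 0 < δ := by rw [hδ]; positivity
  have hK0 : 0 < K := by rw [hK]; positivity
  have hT0 : 0 < T := by rw [hT]; positivity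
  obtain ⟨P, hPm, hPv, hP⟩ := hbox x (Metric.ball_subset_ball (min_le_right r r1) hx) δ K T hδ0 hK0 hT0
    (by rw [hδ, hT]; gcongr; linarith) (by rw [hK, hT]; gcongr)
  rw [← hδ, ← hK] at hgen
  have hlin : ∀ a b : ι → ℝ, linF F (a - b) x = linF F a x - linF F b x := fun a b => by
    simp [linF, sub_mul]
  have hdlin : ∀ (a b : ι → ℝ) i, dlinF F (a - b) x i = dlinF F a x i - dlinF F b x i := fun a b i => by
    simp [dlinF, sub_mul]
  have hpos2 : 0 < 2 / (c * (c1 * c1 ^ d * c1 ^ e)) := by positivity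
  have hPP : ∀ y ∈ P, ∀ y' ∈ P, ∀ g : ι → ℤ, y' - y = castR g → g = 0 := by
    intro y hy y' hy' g hg
    obtain ⟨ha, hb, hc'⟩ := hP y hy
    obtain ⟨ha', hb', hc''⟩ := hP y' hy'
    refine hgen g ?_ (fun i => ?_) fun p => ?_
    · rw [← hg, hlin]; exact (abs_sub _ _).trans (by linarith)
    · rw [← hg, hdlin]; exact (abs_sub _ _).trans (by linarith [hb i, hb' i])
    · have h3 : |(g p : ℝ)| ≤ ‖y' - y‖ := by rw [hg]; exact norm_le_pi_norm (castR g) p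
      refine h3.trans ((norm_sub_le _ _).trans ?_)
      have : C0 * T = C0 * c1 / ε := by rw [hT]; ring
      calc ‖y'‖ + ‖y‖ ≤ 2 * (C0 * c1) / ε := by rw [mul_div_assoc, ← this]; linarith
        _ ≤ _ := by gcongr; linarith
  obtain ⟨ρ, hρ⟩ : ∃ ρ, ρ = √(ε / Q) := ⟨_, rfl⟩
  have hρ0 : 0 ≤ ρ := by rw [hρ]; positivity
  have hρ2 : Q * ρ ^ 2 = ε := by rw [hρ, Real.sq_sqrt (by positivity)]; field_simp
  have hρK : Q * ρ * K = c1 := by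
    have : Q * ρ = √(ε * Q) := by
      rw [hρ]
      have : ε * Q = (ε / Q) * Q ^ 2 := by field_simp
      rw [this, Real.sqrt_mul (by positivity), Real.sqrt_sq hQ0.le, mul_comm]
    rw [this, hK]; field_simp
  have hkey : ∀ v ∈ S, ∀ y ∈ P, |∑ i, (v i : ℝ) * y i + ∑ i, Θ i * y i| ≤ 1 / 16 := by
    intro v hv y hy
    obtain ⟨q, x1, hq, hx1, hxx, hw⟩ := hS v hv
    rw [← hρ] at hxx
    obtain ⟨hy1, hy2, hy3⟩ := hP y hy
    have hT3 : ∀ p, |y p| ≤ C0 * T := fun p => (norm_le_pi_norm y p).trans hy3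
    have e1 : ∑ i, (v i : ℝ) * y i + ∑ i, Θ i * y i = q * linF F y x1 - ∑ p, y p * (q * F x1 p - v p - Θ p) := by
      rw [linF, Finset.mul_sum, ← Finset.sum_add_distrib, ← Finset.sum_sub_distrib]
      exact Finset.sum_congr rfl fun p _ => by ring
    have e2 : linF F y x1 = linF F y x + ∑ i, (x1 - x) i * dlinF F y x i +
        ∑ p, y p * (F x1 p - F x p - fderiv ℝ F x (x1 - x) p) := by
      have e3 : ∀ p, fderiv ℝ F x (x1 - x) p = ∑ i, (x1 - x) i * fderiv ℝ F x (Pi.single i 1) p := by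
        intro p
        conv_lhs => rw [pi_eq_sum_univ' (x1 - x), map_sum]
        rw [Finset.sum_apply]
        refine Finset.sum_congr rfl fun i _ => ?_
        rw [map_smul]; rfl
      have e4 : ∑ i, (x1 - x) i * dlinF F y x i = ∑ p, y p * fderiv ℝ F x (x1 - x) p := by
        simp only [e3, dlinF, Finset.mul_sum]
        rw [Finset.sum_comm]
        exact Finset.sum_congr rfl fun p _ => Finset.sum_congr rfl fun i _ => by ring
      rw [e4, linF, linF, ← Finset.sum_add_distrib, ← Finset.sum_add_distrib]
      exact Finset.sum_congr rfl fun p _ => by ring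
    have b1 : |∑ i, (x1 - x) i * dlinF F y x i| ≤ d * (ρ * K) := by
      refine (Finset.abs_sum_le_sum_abs _ _).trans ((Finset.sum_le_card_nsmul _ _ (ρ * K) fun i _ => ?_).trans (by simp))
      rw [abs_mul]
      exact mul_le_mul ((norm_le_pi_norm (x1 - x) i).trans hxx) (hy2 i) (abs_nonneg _) hρ0
    have b2 : |∑ p, y p * (F x1 p - F x p - fderiv ℝ F x (x1 - x) p)| ≤ N * (C0 * T * (B * ρ ^ 2)) := by
      refine (Finset.abs_sum_le_sum_abs _ _).trans ((Finset.sum_le_card_nsmul _ _ (C0 * T * (B * ρ ^ 2)) fun p _ => ?_).trans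
        (by simp [hN]))
      rw [abs_mul]
      refine mul_le_mul (hT3 p) ((htay x hxr x1 hx1 p).trans ?_) (abs_nonneg _) (by positivity)
      gcongr
    have b3 : |∑ p, y p * (q * F x1 p - v p - Θ p)| ≤ N * (C0 * T * ε) := by
      refine (Finset.abs_sum_le_sum_abs _ _).trans ((Finset.sum_le_card_nsmul _ _ (C0 * T * ε) fun p _ => ?_).trans
        (by simp [hN]))
      rw [abs_mul]
      exact mul_le_mul (hT3 p) (hw p) (abs_nonneg _) (by positivity)
    have b4 : |linF F y x1| ≤ δ + d * (ρ * K) + N * (C0 * T * (B * ρ ^ 2)) := by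
      rw [e2]
      exact (abs_add_le _ _).trans (add_le_add ((abs_add_le _ _).trans (add_le_add hy1 b1)) b2)
    have b5 : |q * linF F y x1| ≤ 3 * Q * (δ + d * (ρ * K) + N * (C0 * T * (B * ρ ^ 2))) := by
      rw [abs_mul]; exact mul_le_mul hq b4 (abs_nonneg _) (by positivity)
    have hTε : T * ε = c1 := by rw [hT]; field_simp
    have hQδ : Q * δ = c1 := by rw [hδ]; field_simp
    rw [e1]
    refine (abs_sub _ _).trans ((add_le_add b5 b3).trans (le_of_eq ?_))
    calc _ = 3 * (Q * δ) + 3 * d * (Q * ρ * K) + 3 * N * C0 * B * (T * (Q * ρ ^ 2)) + N * C0 * (T * ε) := by ring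
      _ = c1 * Z := by rw [hQδ, hρK, hρ2, hTε, hZ]; ring
      _ = 1 / 16 := by rw [hc1]; field_simp
  rcases S.eq_empty_or_nonempty with rfl | ⟨v0, hv0⟩
  · simp only [Finset.card_empty, Nat.cast_zero]; positivity
  have hcount := count_fourier S P hPm hPP v0 fun v hv y hy => by
    have e1 := hkey v hv y hy
    have e2 := hkey v0 hv0 y hy
    have e3 : ∑ i, ((v i - v0 i : ℤ) : ℝ) * y i = (∑ i, (v i : ℝ) * y i + ∑ i, Θ i * y i) -
        (∑ i, (v0 i : ℝ) * y i + ∑ i, Θ i * y i) := by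
      push_cast; simp only [sub_mul, Finset.sum_sub_distrib]; ring
    rw [e3]; exact (abs_sub _ _).trans (by linarith)
  have h3 := (mul_le_mul_right hPv (S.card : ℝ≥0∞)).trans hcount
  rw [← ENNReal.ofReal_natCast, ← ENNReal.ofReal_mul (by positivity), ← ENNReal.ofReal_ofNat 2,
    ENNReal.ofReal_le_ofReal_iff (by norm_num), ← he] at h3
  rw [← he]
  have e5 : δ * K ^ d * T ^ e = (c1 * c1 ^ d * c1 ^ e) / (Q * √(ε * Q) ^ d * ε ^ e) := by
    rw [hδ, hK, hT]; simp only [div_pow]; field_simp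
  rw [e5] at h3
  obtain ⟨Y, hY⟩ : ∃ Y, Y = Q * √(ε * Q) ^ d * ε ^ e := ⟨_, rfl⟩
  have hY0 : 0 < Y := by rw [hY]; positivity
  obtain ⟨X, hX⟩ : ∃ X, X = c1 * c1 ^ d * c1 ^ e := ⟨_, rfl⟩
  have hX0 : 0 < X := by rw [hX]; positivity
  rw [← hY, ← hX] at h3 ⊢
  have h4 : (S.card : ℝ) ≤ 2 / (c * X) * Y := by
    rw [div_mul_eq_mul_div, le_div_iff₀ (by positivity)]
    have : (S.card : ℝ) * (c * (X / Y)) = S.card * (c * X) / Y := by ring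
    rw [this, div_le_iff₀ hY0] at h3
    linarith
  refine h4.trans ?_
  gcongr
  have : 0 < C0 * c1 := by positivity
  linarith
end GenA

theorem nongen_vol (n : ℕ) (hn : 2 ≤ n) (a c0 Cq M c1 C : ℝ) (ha : 0 < a) (hc0 : 0 < c0) (hCq : 0 < Cq) (hM : 0 < M)
    (hc1 : 0 < c1) (hC : 1 ≤ C) (S : ℝ → ℝ → ℝ → ℝ≥0∞) (hSM : ∀ δ K T, S δ K T ≤ ENNReal.ofReal M)
    (hS : ∀ δ K T A : ℝ, 0 < δ → 0 < K → 1 ≤ T → 1 ≤ A → A * δ ≤ c0 → A ^ (n + 1) * δ * K * T ^ (n + 1 - 2) ≤ c0 →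
      S δ K T ≤ ENNReal.ofReal (Cq * A ^ (-a))) :
    ∃ C' > 0, ∀ ε Q : ℝ, 0 < ε → ε ≤ 1 → 1 ≤ Q → S (2 * (c1 / Q)) (2 * (c1 / √(ε * Q))) (C / ε) ≤
      ENNReal.ofReal (C' * (Q * √(ε * Q) * ε ^ (n - 1)) ^ (-(a / (n + 1)))) := by
  obtain ⟨c5, hc5⟩ : ∃ c5 : ℝ, c5 = min ((c0 / (2 * c1)) ^ (n + 1)) (c0 / (4 * c1 ^ 2 * C ^ (n - 1))) := ⟨_, rfl⟩
  have hC0 : 0 < C := by linarith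
  have h5 : 0 < c5 := by rw [hc5]; exact lt_min (by positivity) (by positivity)
  have h5a : c5 * (2 * c1) ^ (n + 1) ≤ c0 ^ (n + 1) := by
    have : c5 ≤ (c0 / (2 * c1)) ^ (n + 1) := by rw [hc5]; exact min_le_left _ _
    rw [div_pow, le_div_iff₀ (by positivity)] at this
    exact this
  have h5b : c5 * (4 * c1 ^ 2 * C ^ (n - 1)) ≤ c0 := by
    have : c5 ≤ c0 / (4 * c1 ^ 2 * C ^ (n - 1)) := by rw [hc5]; exact min_le_right _ _
    rwa [le_div_iff₀ (by positivity)] at this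
  refine ⟨max Cq M * c5 ^ (-(a / (n + 1))), by positivity, fun ε Q hε hε1 hQ => ?_⟩
  have hQ0 : 0 < Q := by linarith
  obtain ⟨w, hw⟩ : ∃ w, w = √(ε * Q) := ⟨_, rfl⟩
  have hw0 : 0 < w := by rw [hw]; positivity
  rw [← hw]
  obtain ⟨G, hG⟩ : ∃ G, G = Q * w * ε ^ (n - 1) := ⟨_, rfl⟩
  have hG0 : 0 < G := by rw [hG]; positivity
  have hwQ : w ≤ Q := by
    rw [hw, Real.sqrt_le_left (by linarith)]
    nlinarith
  have hGQ : G ≤ Q ^ (n + 1) := by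
    calc G ≤ Q * Q * 1 := by
          rw [hG]; gcongr; exact pow_le_one₀ hε.le hε1
      _ = Q ^ 2 := by ring
      _ ≤ _ := pow_le_pow_right₀ hQ (by omega)
  rw [← hG, mul_assoc, ← Real.mul_rpow h5.le hG0.le]
  have hg0 : 0 < c5 * G := by positivity
  by_cases h : 1 ≤ c5 * G
  · have hA1 : 1 ≤ (c5 * G) ^ ((1 : ℝ) / (n + 1)) := Real.one_le_rpow h (by positivity)
    obtain ⟨A, hA⟩ : ∃ A, A = (c5 * G) ^ ((1 : ℝ) / (n + 1)) := ⟨_, rfl⟩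
    rw [← hA] at hA1
    have hAp : A ^ (n + 1) = c5 * G := by
      rw [hA, ← Real.rpow_natCast, ← Real.rpow_mul hg0.le]
      have : (1 : ℝ) / (n + 1) * ((n + 1 : ℕ) : ℝ) = 1 := by push_cast; field_simp
      rw [this, Real.rpow_one]
    refine (hS _ _ _ A (by positivity) (by positivity) ?_ hA1 ?_ ?_).trans ?_
    · rw [le_div_iff₀ hε]; linarith
    · refine le_of_pow_le_pow_left₀ (n := n + 1) (by omega) hc0.le ?_
      rw [mul_pow, hAp]
      calc c5 * G * (2 * (c1 / Q)) ^ (n + 1) ≤ c5 * Q ^ (n + 1) * (2 * (c1 / Q)) ^ (n + 1) := by gcongr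
        _ = c5 * (2 * c1) ^ (n + 1) := by
          rw [mul_assoc, ← mul_pow]; congr 2; field_simp
        _ ≤ _ := h5a
    · rw [hAp, hG, show n + 1 - 2 = n - 1 by omega]
      refine le_trans (le_of_eq ?_) h5b
      rw [div_pow]; field_simp; ring
    · apply ENNReal.ofReal_le_ofReal
      rw [hA, ← Real.rpow_mul hg0.le, show (1 : ℝ) / (n + 1) * -a = -(a / (n + 1)) by ring]
      gcongr; exact le_max_left _ _
  · push Not at h
    refine (hSM _ _ _).trans (ENNReal.ofReal_le_ofReal ?_)
    have : 1 ≤ (c5 * G) ^ (-(a / (n + 1))) :=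
      Real.one_le_rpow_of_pos_of_le_one_of_nonpos hg0 h.le (by rw [neg_nonpos]; positivity)
    calc M ≤ max Cq M * 1 := by rw [mul_one]; exact le_max_right _ _
      _ ≤ _ := by gcongr

section Cover
variable {d : ℕ}

def cubeZ (r : ℝ) (z : Fin d → ℤ) : Set (Fin d → ℝ) := Set.pi univ (fun i => Ico (z i * r) ((z i + 1) * r))

theorem cubeZ_dist {r : ℝ} {z : Fin d → ℤ} (hr : 0 < r) {x y : Fin d → ℝ} (hx : x ∈ cubeZ r z) (hy : y ∈ cubeZ r z) :
    ‖x - y‖ ≤ r := by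
  rw [pi_norm_le_iff_of_nonneg hr.le]
  intro i
  have h1 := hx i (mem_univ i)
  have h2 := hy i (mem_univ i)
  simp only [mem_Ico] at h1 h2
  rw [Real.norm_eq_abs, abs_le, Pi.sub_apply]
  constructor <;> nlinarith

theorem cubeZ_cover {r : ℝ} (hr : 0 < r) (x : Fin d → ℝ) : ∃ z, x ∈ cubeZ r z := by
  refine ⟨fun i => ⌊x i / r⌋, fun i _ => ⟨?_, ?_⟩⟩
  · have := Int.floor_le (x i / r)
    rwa [le_div_iff₀ hr] at this
  · have := Int.lt_floor_add_one (x i / r)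
    rwa [div_lt_iff₀ hr] at this

theorem cubeZ_disj {r : ℝ} (hr : 0 < r) : Pairwise (Function.onFun Disjoint (cubeZ (d := d) r)) := by
  intro z w hzw
  rw [Function.onFun, Set.disjoint_left]
  intro x hx hy
  apply hzw
  funext i
  have h1 := hx i (mem_univ i)
  have h2 := hy i (mem_univ i)
  simp only [mem_Ico] at h1 h2
  have h3 : (z i : ℝ) < w i + 1 := by
    have := h1.1.trans_lt h2.2
    exact lt_of_mul_lt_mul_right this hr.le
  have h4 : (w i : ℝ) < z i + 1 := by
    have := h2.1.trans_lt h1.2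
    exact lt_of_mul_lt_mul_right this hr.le
  have h3' : z i < w i + 1 := by exact_mod_cast h3
  have h4' : w i < z i + 1 := by exact_mod_cast h4
  omega

theorem cubeZ_vol {r : ℝ} (hr : 0 < r) (z : Fin d → ℤ) : volume (cubeZ r z) = ENNReal.ofReal (r ^ d) := by
  rw [cubeZ, Real.volume_pi_Ico]
  rw [Finset.prod_congr rfl (g := fun _ => ENNReal.ofReal r) (fun i _ => by congr 1; ring)]
  rw [Finset.prod_const, Finset.card_univ, Fintype.card_fin, ENNReal.ofReal_pow hr.le]

open Classical in
theorem cubeZ_sum {r κ : ℝ} (hr : 0 < r) (hκ : 0 ≤ κ) (P : (Fin d → ℤ) → Prop) (W : Set (Fin d → ℝ)) (hP : ∀ z, P z → cubeZ r z ⊆ W) :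
    ∑' z, (if P z then ENNReal.ofReal κ else 0) ≤ ENNReal.ofReal (κ / r ^ d) * volume W := by
  have hm : ∀ z : Fin d → ℤ, MeasurableSet (if P z then cubeZ r z else ∅) := by
    intro z
    split_ifs
    · exact MeasurableSet.univ_pi fun i => measurableSet_Ico
    · exact MeasurableSet.empty
  have hdj : Pairwise (Function.onFun Disjoint (fun z : Fin d → ℤ => if P z then cubeZ r z else ∅)) := by
    intro z w hzw
    have := cubeZ_disj hr hzw
    simp only [Function.onFun] at this ⊢
    split_ifs <;> simp [this]
  have h1 := tsum_meas_le_meas_iUnion_of_disjoint volume hm hdj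
  have h2 : volume (⋃ z, if P z then cubeZ r z else ∅) ≤ volume W := by
    refine measure_mono (iUnion_subset fun z => ?_)
    split_ifs with h
    · exact hP z h
    · exact empty_subset _
  refine le_trans (le_of_eq ?_) (mul_le_mul_right (h1.trans h2) _)
  rw [← ENNReal.tsum_mul_left]
  congr 1; funext z
  split_ifs
  · rw [cubeZ_vol hr, ← ENNReal.ofReal_mul (by positivity), div_mul_cancel₀ _ (by positivity)]
  · simp

theorem cover_lem {V : Type} (Wit : V → (Fin d → ℝ) → Prop) (Gen : Set (Fin d → ℝ)) (x0 : Fin d → ℝ)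
    (R r D s cnt : ℝ) (hr : 0 < r) (hrR : r ≤ R) (hD : 0 ≤ D) (hs : 0 < s) (hcnt0 : 0 ≤ cnt)
    (hcnt : ∀ x ∈ Gen, x ∈ Metric.closedBall x0 (2 * R) → ∀ S : Finset V,
      (∀ v ∈ S, ∃ x1 ∈ Metric.closedBall x0 R, ‖x1 - x‖ ≤ r ∧ Wit v x1) → (S.card : ℝ) ≤ cnt)
    (hdiam : ∀ v, ∀ x ∈ Metric.closedBall x0 R, ∀ y ∈ Metric.closedBall x0 R, Wit v x → Wit v y → ‖x - y‖ ≤ D) :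
    ∃ c : ((Fin d → ℤ) × V) ⊕ (Fin d → ℤ) → Set (Fin d → ℝ),
      {x | x ∈ Metric.closedBall x0 R ∧ ∃ v, Wit v x} ⊆ ⋃ i, c i ∧
      (∀ i, Metric.ediam (c i) ≤ ENNReal.ofReal (max r D)) ∧
      ∑' i, Metric.ediam (c i) ^ s ≤ ENNReal.ofReal (cnt * D ^ s / r ^ d) * volume (Metric.closedBall x0 (2 * R)) +
        ENNReal.ofReal (r ^ s / r ^ d) * volume (Metric.closedBall x0 (2 * R) \ Gen) := by
  classical
  obtain ⟨B, hB⟩ : ∃ B, B = Metric.closedBall x0 R := ⟨_, rfl⟩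
  simp only [← hB] at hcnt hdiam ⊢
  have hcB : ∀ z, (cubeZ r z ∩ B).Nonempty → cubeZ r z ⊆ Metric.closedBall x0 (2 * R) := by
    rintro z ⟨y, hy, hyB⟩ x hx
    rw [hB, mem_closedBall_iff_norm] at hyB
    rw [mem_closedBall_iff_norm]
    have h1 := cubeZ_dist hr hx hy
    have h2 := norm_add_le (x - y) (y - x0)
    rw [sub_add_sub_cancel] at h2
    linarith
  obtain ⟨g, hg⟩ : ∃ g : (Fin d → ℤ) → Prop, g = fun z => (cubeZ r z ∩ B).Nonempty ∧ (cubeZ r z ∩ Gen).Nonempty := ⟨_, rfl⟩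
  obtain ⟨b, hb⟩ : ∃ b : (Fin d → ℤ) → Prop, b = fun z => (cubeZ r z ∩ B).Nonempty ∧ ¬ (cubeZ r z ∩ Gen).Nonempty := ⟨_, rfl⟩
  obtain ⟨w, hw⟩ : ∃ w : (Fin d → ℤ) → V → Set (Fin d → ℝ), w = fun z v => {x | x ∈ cubeZ r z ∩ B ∧ Wit v x} := ⟨_, rfl⟩
  have hwd : ∀ z v, Metric.ediam (w z v) ≤ ENNReal.ofReal D := by
    intro z v
    apply Metric.ediam_le
    intro x hx y hy
    simp only [hw, mem_ofPred_eq] at hx hy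
    rw [edist_dist, dist_eq_norm]
    exact ENNReal.ofReal_le_ofReal (hdiam v x hx.1.2 y hy.1.2 hx.2 hy.2)
  have hcd : ∀ z, Metric.ediam (cubeZ (d := d) r z) ≤ ENNReal.ofReal r := by
    intro z
    apply Metric.ediam_le
    intro x hx y hy
    rw [edist_dist, dist_eq_norm]
    exact ENNReal.ofReal_le_ofReal (cubeZ_dist hr hx hy)
  refine ⟨Sum.elim (fun p => if g p.1 then w p.1 p.2 else ∅) (fun z => if b z then cubeZ r z else ∅), ?_, ?_, ?_⟩
  · rintro x ⟨hxB, v, hv⟩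
    obtain ⟨z, hz⟩ := cubeZ_cover hr x
    rw [mem_iUnion]
    by_cases h : (cubeZ r z ∩ Gen).Nonempty
    · refine ⟨Sum.inl (z, v), ?_⟩
      have : g z := by rw [hg]; exact ⟨⟨x, hz, hxB⟩, h⟩
      simp only [Sum.elim_inl, if_pos this, hw]
      exact ⟨⟨hz, hxB⟩, hv⟩
    · refine ⟨Sum.inr z, ?_⟩
      have : b z := by rw [hb]; exact ⟨⟨x, hz, hxB⟩, h⟩
      simp only [Sum.elim_inr, if_pos this]
      exact hz
  · rintro (⟨z, v⟩ | z)
    · simp only [Sum.elim_inl]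
      split_ifs
      · exact (hwd z v).trans (ENNReal.ofReal_le_ofReal (le_max_right _ _))
      · simp
    · simp only [Sum.elim_inr]
      split_ifs
      · exact (hcd z).trans (ENNReal.ofReal_le_ofReal (le_max_left _ _))
      · simp
  · rw [ENNReal.summable.tsum_sum ENNReal.summable]
    simp only [Sum.elim_inl, Sum.elim_inr]
    gcongr ?_ + ?_
    · rw [ENNReal.tsum_prod (f := fun z v => Metric.ediam (if g z then w z v else ∅) ^ s)]
      refine le_trans (ENNReal.tsum_le_tsum fun z => ?_) (cubeZ_sum hr (by positivity : 0 ≤ cnt * D ^ s) g _ ?_)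
      · split_ifs with h
        · rw [ENNReal.tsum_eq_iSup_sum]
          refine iSup_le fun S => ?_
          have h1 : ∑ v ∈ S, Metric.ediam (w z v) ^ s ≤ ∑ v ∈ S.filter (fun v => (w z v).Nonempty), ENNReal.ofReal D ^ s := by
            rw [Finset.sum_filter]
            refine Finset.sum_le_sum fun v _ => ?_
            split_ifs with hne
            · exact ENNReal.rpow_le_rpow (hwd z v) hs.le
            · rw [not_nonempty_iff_eq_empty.1 hne, Metric.ediam_empty, ENNReal.zero_rpow_of_pos hs]
          refine h1.trans ?_
          rw [Finset.sum_const, nsmul_eq_mul, ENNReal.ofReal_rpow_of_nonneg hD hs.le, ENNReal.ofReal_mul hcnt0]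
          gcongr
          rw [← ENNReal.ofReal_natCast]
          apply ENNReal.ofReal_le_ofReal
          rw [hg] at h
          obtain ⟨hzB, x, hxz, hxG⟩ := h
          refine hcnt x hxG (hcB z hzB hxz) _ fun v hv => ?_
          obtain ⟨x1, hx1⟩ := (Finset.mem_filter.1 hv).2
          simp only [hw, mem_ofPred_eq] at hx1
          exact ⟨x1, hx1.1.2, cubeZ_dist hr hx1.1.1 hxz, hx1.2⟩
        · simp [ENNReal.zero_rpow_of_pos hs]
      · intro z hz
        rw [hg] at hz
        exact hcB z hz.1
    · refine le_trans (ENNReal.tsum_le_tsum fun z => ?_) (cubeZ_sum hr (by positivity : 0 ≤ r ^ s) b _ ?_)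
      · split_ifs with h
        · rw [← ENNReal.ofReal_rpow_of_nonneg hr.le hs.le]
          exact ENNReal.rpow_le_rpow (hcd z) hs.le
        · simp [ENNReal.zero_rpow_of_pos hs]
      · intro z hz
        rw [hb] at hz
        intro x hx
        exact ⟨hcB z hz.1 hx, fun hxG => hz.2 ⟨x, hx, hxG⟩⟩

theorem haus_limsup {X J : Type} [EMetricSpace X] [MeasurableSpace X] [BorelSpace X] [Countable J] (s : ℝ)
    (Λ : ℕ → Set X) (c : ℕ → J → Set X) (ρ a : ℕ → ℝ≥0∞)
    (t0 : ℕ) (hc : ∀ t ≥ t0, Λ t ⊆ ⋃ j, c t j) (hρ : ∀ t ≥ t0, ∀ j, Metric.ediam (c t j) ≤ ρ t) (hρ0 : Tendsto ρ atTop (𝓝 0))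
    (ha : ∀ t ≥ t0, ∑' j, Metric.ediam (c t j) ^ s ≤ a t) (has : ∑' t, a t ≠ ∞) :
    μH[s] {x | ∃ᶠ t in atTop, x ∈ Λ t} = 0 := by
  obtain ⟨r, hr⟩ : ∃ r : ℕ → ℝ≥0∞, r = fun N => ⨆ t, ρ (t + N) := ⟨_, rfl⟩
  have hr0 : Tendsto r atTop (𝓝 0) := by
    rw [ENNReal.tendsto_atTop_zero] at hρ0 ⊢
    intro ε hε
    obtain ⟨N, hN⟩ := hρ0 ε hε
    exact ⟨N, fun n hn => by rw [hr]; exact iSup_le fun t => hN _ (by omega)⟩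
  have hs0 : Tendsto (fun N => ∑' t, a (t + N)) atTop (𝓝 0) := ENNReal.tendsto_sum_nat_add a has
  have key := Measure.hausdorffMeasure_le_liminf_tsum (β := ℕ) (ι := fun _ => ℕ × J) s {x | ∃ᶠ t in atTop, x ∈ Λ t} (l := atTop) r hr0
    (fun (N : ℕ) (p : ℕ × J) => c (p.1 + N) p.2) ?_ ?_
  · refine le_antisymm (key.trans ?_) (zero_le)
    have : Tendsto (fun N => ∑' p : ℕ × J, Metric.ediam (c (p.1 + N) p.2) ^ s) atTop (𝓝 0) := by
      refine tendsto_of_tendsto_of_tendsto_of_le_of_le' tendsto_const_nhds hs0 (Eventually.of_forall fun _ => zero_le) ?_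
      filter_upwards [eventually_ge_atTop t0] with N hN
      rw [ENNReal.tsum_prod (f := fun t j => Metric.ediam (c (t + N) j) ^ s)]
      exact ENNReal.tsum_le_tsum fun t => ha _ (by omega)
    rw [this.liminf_eq]
  · filter_upwards [eventually_ge_atTop t0] with N hN p
    refine (hρ _ (by omega) _).trans ?_
    rw [hr]
    exact le_iSup (fun t => ρ (t + N)) p.1
  · filter_upwards [eventually_ge_atTop t0] with N hN x hx
    obtain ⟨t, ht, hxt⟩ := (frequently_atTop.1 hx) N
    have := hc t (by omega) hxt
    rw [mem_iUnion] at this ⊢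
    obtain ⟨j, hj⟩ := this
    exact ⟨(t - N, j), by simpa [Nat.sub_add_cancel ht] using hj⟩

end Cover

section Loc
variable {d n : ℕ}

noncomputable def augF (f : (Fin d → ℝ) → Fin n → ℝ) (x : Fin d → ℝ) : Option (Fin n) → ℝ :=
  fun o => o.elim 1 (f x)

theorem augF_deriv (f : (Fin d → ℝ) → Fin n → ℝ) (x : Fin d → ℝ) (h : DifferentiableAt ℝ (augF f) x) (v : Fin d → ℝ) :
    fderiv ℝ (augF f) x v none = 0 ∧ ∀ j, fderiv ℝ (augF f) x v (some j) = fderiv ℝ f x v j := by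
  have h1 := hasFDerivAt_pi'.1 h.hasFDerivAt
  constructor
  · have := (h1 none).unique (hasFDerivAt_const (1 : ℝ) x)
    exact DFunLike.congr_fun this v
  · intro j
    have hf : HasFDerivAt f (ContinuousLinearMap.pi fun j => (ContinuousLinearMap.proj (some j)).comp (fderiv ℝ (augF f) x)) x := by
      rw [hasFDerivAt_pi]
      exact fun j => h1 (some j)
    rw [hf.fderiv]; rfl

theorem augF_contDiff {l : ℕ} (f : (Fin d → ℝ) → Fin n → ℝ) (V : Set (Fin d → ℝ)) (h : ContDiffOn ℝ l f V) :
    ContDiffOn ℝ l (augF f) V := by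
  rw [contDiffOn_pi]
  rintro (_ | j)
  · exact contDiffOn_const
  · exact contDiffOn_pi.1 h j

theorem listPDeriv_iterL (f : (Fin d → ℝ) → Fin n → ℝ) (β : List (Fin d)) :
    listPDeriv β f = iterL (β.map fun i => Pi.single i (1 : ℝ)) f := by
  induction β with
  | nil => rfl
  | cons i β ih => simp only [listPDeriv, List.map_cons, iterL, ih]

theorem nd_aug {l : ℕ} (f : (Fin d → ℝ) → Fin n → ℝ) (V : Set (Fin d → ℝ)) (hV : IsOpen V) (h : ContDiffOn ℝ l f V)
    (x0 : Fin d → ℝ) (hx0 : x0 ∈ V) (hsp : Submodule.span ℝ {v : Fin n → ℝ | ∃ β : List (Fin d),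
      1 ≤ β.length ∧ β.length ≤ l ∧ v = listPDeriv β f x0} = ⊤) (c : Option (Fin n) → ℝ) (hc : c ≠ 0) :
    ∃ k ≤ l, ∃ v, ∑ i, c i * iteratedFDeriv ℝ k (augF f) x0 (fun _ => v) i ≠ 0 := by
  by_contra hcon
  push Not at hcon
  apply hc
  have hF := augF_contDiff f V h
  have hFat : ContDiffAt ℝ l (augF f) x0 := hF.contDiffAt (hV.mem_nhds hx0)
  have key : ∀ u : Fin n → ℝ, ∑ j, c (some j) * u j = 0 := by
    intro u
    have hu : u ∈ Submodule.span ℝ {v : Fin n → ℝ | ∃ β : List (Fin d),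
      1 ≤ β.length ∧ β.length ≤ l ∧ v = listPDeriv β f x0} := by rw [hsp]; trivial
    induction hu using Submodule.span_induction with
    | mem u hu =>
      obtain ⟨β, hb1, hbl, rfl⟩ := hu
      rw [listPDeriv_iterL, iterL_eq f V hV l h _ (by simpa using hbl) x0 hx0]
      obtain ⟨L, hL⟩ : ∃ L, L = β.map fun i => (Pi.single i (1 : ℝ) : Fin d → ℝ) := ⟨_, rfl⟩
      have hL1 : 1 ≤ L.length := by rw [hL]; simpa using hb1
      have hLl : L.length ≤ l := by rw [hL]; simpa using hbl
      rw [← hL]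
      obtain ⟨P, hP⟩ : ∃ P : (Option (Fin n) → ℝ) →L[ℝ] ℝ, P = ∑ i, c i • ContinuousLinearMap.proj i := ⟨_, rfl⟩
      have hPa : ∀ y, P y = ∑ i, c i * y i := by intro y; simp [hP]
      have h0 := sym_diag_zero (augF f) V hV l hF L.length hLl x0 hx0 P
        (fun v => by rw [hPa]; exact hcon _ hLl v) L.get
      rw [hPa, Fintype.sum_option] at h0
      have hl' : (L.length : WithTop ℕ∞) ≤ l := by exact_mod_cast hLl
      have hn0 : iteratedFDeriv ℝ L.length (augF f) x0 L.get none = 0 := by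
        have h1 := (ContinuousLinearMap.proj (R := ℝ) (φ := fun _ : Option (Fin n) => ℝ) none).iteratedFDeriv_comp_left hFat hl'
        have h2 : ((ContinuousLinearMap.proj (R := ℝ) (φ := fun _ : Option (Fin n) => ℝ) none) ∘ augF f) = fun _ => (1 : ℝ) := rfl
        rw [h2, iteratedFDeriv_const_of_ne (by omega)] at h1
        exact (DFunLike.congr_fun h1 L.get).symm
      have hsj : ∀ j, iteratedFDeriv ℝ L.length (augF f) x0 L.get (some j) = iteratedFDeriv ℝ L.length f x0 L.get j := by
        have h1 := (ContinuousLinearMap.pi (R := ℝ) (fun j : Fin n =>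
          (ContinuousLinearMap.proj (R := ℝ) (φ := fun _ : Option (Fin n) => ℝ) (some j)))).iteratedFDeriv_comp_left hFat hl'
        intro j
        have h3 := congrFun (DFunLike.congr_fun h1 L.get) j
        exact h3.symm
      rw [hn0, mul_zero, zero_add] at h0
      simpa only [hsj] using h0
    | zero => simp
    | add x y _ _ hx hy => simp only [Pi.add_apply, mul_add, Finset.sum_add_distrib, hx, hy, add_zero]
    | smul a x _ hx =>
      simp only [Pi.smul_apply, smul_eq_mul]
      rw [Finset.sum_congr rfl (fun i _ => show c (some i) * (a * x i) = a * (c (some i) * x i) by ring), ← Finset.mul_sum, hx, mul_zero]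
  have hs : ∀ j, c (some j) = 0 := by
    intro j
    have := key (Pi.single j 1)
    simpa [Pi.single_apply] using this
  funext o
  rcases o with _ | j
  · have := hcon 0 (by omega) 0
    rw [Fintype.sum_option] at this
    simpa [hs, augF] using this
  · exact hs j

theorem no_nd_one {l : ℕ} (hl : l < 2) (hdn : d < n) (f : (Fin d → ℝ) → Fin n → ℝ) (x : Fin d → ℝ) : ¬ IsLNondegenerateAt l f x := by
  rintro ⟨-, h⟩
  have h1 : {v : Fin n → ℝ | ∃ β : List (Fin d), 1 ≤ β.length ∧ β.length ≤ l ∧ v = listPDeriv β f x} ⊆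
      range fun i : Fin d => listPDeriv [i] f x := by
    rintro v ⟨β, h1, h2, rfl⟩
    obtain ⟨i, rfl⟩ := List.length_eq_one_iff.1 (show β.length = 1 by omega)
    exact ⟨i, rfl⟩
  have h2 : Submodule.span ℝ (range fun i : Fin d => listPDeriv [i] f x) = ⊤ :=
    top_le_iff.1 (h ▸ Submodule.span_mono h1)
  have h3 := finrank_range_le_card (R := ℝ) (fun i : Fin d => listPDeriv [i] f x)
  rw [Set.finrank, h2, finrank_top, Module.finrank_fin_fun, Fintype.card_fin] at h3
  omega

theorem rank_inj (A : (Fin d → ℝ) →ₗ[ℝ] (Fin n → ℝ)) (h : LinearMap.rank A = (d : Cardinal)) : A.ker = ⊥ := by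
  have h1 := LinearMap.finrank_range_add_finrank_ker A
  have h2 : Module.finrank ℝ A.range = d := by
    rw [Module.finrank, show Module.rank ℝ A.range = (d : Cardinal) from h]; simp
  rw [h2, Module.finrank_fin_fun] at h1
  exact Submodule.finrank_eq_zero.1 (by omega)

theorem uRow_li (f : (Fin d → ℝ) → Fin n → ℝ) (x : Fin d → ℝ) (h : DifferentiableAt ℝ (augF f) x)
    (hk : (fderiv ℝ f x).toLinearMap.ker = ⊥) : LinearIndependent ℝ (uRow (augF f) x) := by
  rw [Fintype.linearIndependent_iff]
  intro g hg
  rw [Fin.sum_univ_succ] at hg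
  simp only [uRow, Fin.cons_zero, Fin.cons_succ] at hg
  have h0 := congrFun hg none
  simp only [Pi.add_apply, Finset.sum_apply, Pi.smul_apply, smul_eq_mul, (augF_deriv f x h _).1, mul_zero,
    Finset.sum_const_zero, add_zero, augF, Option.elim_none, mul_one, Pi.zero_apply] at h0
  have hz : (fderiv ℝ f x).toLinearMap (fun i => g i.succ) = 0 := by
    have hv : (fun i => g i.succ) = ∑ i : Fin d, g i.succ • (Pi.single i (1 : ℝ) : Fin d → ℝ) := by
      funext j; simp [Finset.sum_apply, Pi.single_apply]
    rw [hv, map_sum]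
    funext j
    have hj := congrFun hg (some j)
    simp only [Pi.add_apply, Finset.sum_apply, Pi.smul_apply, smul_eq_mul, (augF_deriv f x h _).2, h0, zero_mul, zero_add,
      Pi.zero_apply] at hj
    simpa [Finset.sum_apply] using hj
  have hz' : (fun i : Fin d => g i.succ) = 0 := LinearMap.ker_eq_bot'.1 hk _ hz
  intro i
  refine Fin.cases h0 (fun i => congrFun hz' i) i

theorem taylor2 {ι : Type} [Fintype ι] (F : (Fin d → ℝ) → ι → ℝ) (x0 : Fin d → ℝ) (h : ContDiffAt ℝ 2 F x0) :
    ∃ r > 0, ∃ B ≥ 0, ∀ x ∈ Metric.ball x0 r, ∀ x1 ∈ Metric.ball x0 r, ∀ p,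
      |F x1 p - F x p - fderiv ℝ F x (x1 - x) p| ≤ B * ‖x1 - x‖ ^ 2 := by
  have h1 : ContDiffAt ℝ 1 (fderiv ℝ F) x0 := h.fderiv_right (by norm_num)
  obtain ⟨K, t, ht, hK⟩ := h1.exists_lipschitzOnWith
  have h2 : ∀ᶠ x in 𝓝 x0, DifferentiableAt ℝ F x := by
    filter_upwards [h.eventually (by simp)] with x hx using hx.differentiableAt (by simp)
  obtain ⟨r, hr, hsub⟩ := Metric.mem_nhds_iff.1 (Filter.inter_mem ht h2)
  refine ⟨r, hr, K, K.2, fun x hx x1 hx1 p => ?_⟩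
  have hseg : segment ℝ x x1 ⊆ Metric.ball x0 r := (convex_ball x0 r).segment_subset hx hx1
  have h3 := Convex.norm_image_sub_le_of_norm_hasFDerivWithin_le' (𝕜 := ℝ) (f := F) (f' := fderiv ℝ F) (φ := fderiv ℝ F x)
    (s := segment ℝ x x1) (C := K * ‖x1 - x‖) (x := x) (y := x1)
    (fun y hy => ((hsub (hseg hy)).2 : DifferentiableAt ℝ F y).hasFDerivAt.hasFDerivWithinAt) ?_ (convex_segment x x1)
    (left_mem_segment ℝ x x1) (right_mem_segment ℝ x x1)
  · have h4 := (norm_le_pi_norm (F x1 - F x - fderiv ℝ F x (x1 - x)) p).trans h3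
    rw [Real.norm_eq_abs] at h4
    calc _ ≤ _ := h4
      _ = _ := by ring
  · intro y hy
    have h5 := hK.norm_sub_le (hsub (hseg hy)).1 (hsub hx).1
    refine h5.trans ?_
    gcongr
    obtain ⟨a, b, ha, hb, hab, rfl⟩ := hy
    have : a • x + b • x1 - x = b • (x1 - x) := by
      have : a = 1 - b := by linarith
      rw [this]; module
    rw [this, norm_smul, Real.norm_eq_abs, abs_of_nonneg hb]
    exact mul_le_of_le_one_left (norm_nonneg _) (by linarith)

theorem bilip (f : (Fin d → ℝ) → Fin n → ℝ) (x0 : Fin d → ℝ) (h : ContDiffAt ℝ 1 f x0)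
    (hk : (fderiv ℝ f x0).toLinearMap.ker = ⊥) : ∃ r > 0, ∃ b > 0, ∀ x ∈ Metric.ball x0 r, ∀ y ∈ Metric.ball x0 r,
      ‖x - y‖ ≤ b * ‖f x - f y‖ := by
  obtain ⟨K, hK, hA⟩ := LinearMap.exists_antilipschitzWith _ hk
  have hK' : (0 : ℝ) < K := hK
  have h1 := (h.hasStrictFDerivAt (by simp)).isLittleO.def (show (0 : ℝ) < 1 / (2 * K) by positivity)
  rw [nhds_prod_eq] at h1
  obtain ⟨t, ht, hsub⟩ := (Filter.eventually_prod_self_iff (r := fun x y => ‖f x - f y - fderiv ℝ f x0 (x - y)‖ ≤ 1 / (2 * K) * ‖x - y‖)).1 h1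
  obtain ⟨r, hr, hrt⟩ := Metric.mem_nhds_iff.1 ht
  refine ⟨r, hr, 2 * K, by positivity, fun x hx y hy => ?_⟩
  have h2 := hsub x (hrt hx) y (hrt hy)
  have h3 : ‖x - y‖ ≤ K * ‖fderiv ℝ f x0 (x - y)‖ := by
    have := hA.le_mul_dist x y
    rw [dist_eq_norm, dist_eq_norm, ← map_sub] at this
    exact this
  have h4 : ‖fderiv ℝ f x0 (x - y)‖ ≤ ‖f x - f y‖ + 1 / (2 * K) * ‖x - y‖ := by
    have := norm_sub_le (f x - f y) (f x - f y - fderiv ℝ f x0 (x - y))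
    rw [sub_sub_cancel] at this
    linarith
  have h5 : (K : ℝ) * (1 / (2 * K) * ‖x - y‖) = ‖x - y‖ / 2 := by field_simp
  nlinarith [mul_le_mul_of_nonneg_left h4 hK'.le]
end Loc

theorem sched (φ g : ℕ → ℝ) (hφ : ∀ q, 0 ≤ φ q) (hs : Summable φ) (hg0 : ∀ t, 0 ≤ g t)
    (hg : ∀ t : ℕ, ∀ q : ℕ, Real.exp t ≤ q → (q : ℝ) ≤ Real.exp (t + 1) → g t ≤ φ q) :
    Summable fun t : ℕ => Real.exp (t + 1) * g t := by
  obtain ⟨u, hu⟩ : ∃ u : ℕ → ℕ, u = fun t : ℕ => ⌈Real.exp (t : ℝ)⌉₊ := ⟨_, rfl⟩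
  have hum : Monotone u := by
    intro a b hab
    rw [hu]; exact Nat.ceil_mono (Real.exp_le_exp.2 (by exact_mod_cast hab))
  have h1 : ∀ t : ℕ, Real.exp (t + 1) * g t ≤ 4 * ∑ q ∈ Finset.Ico (u t) (u (t + 1)), φ q := by
    intro t
    have hc : ((u (t + 1) - u t : ℕ) : ℝ) * g t ≤ ∑ q ∈ Finset.Ico (u t) (u (t + 1)), φ q := by
      rw [← nsmul_eq_mul, ← Nat.card_Ico]
      refine Finset.card_nsmul_le_sum _ _ _ fun q hq => ?_
      rw [Finset.mem_Ico, hu] at hq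
      refine hg t q (Nat.le_of_ceil_le hq.1) ?_
      have := (Nat.lt_ceil.1 hq.2).le
      push_cast at this
      exact this
    have hcard : Real.exp (t + 1) / 4 ≤ ((u (t + 1) - u t : ℕ) : ℝ) := by
      rw [Nat.cast_sub (hum (Nat.le_succ t))]
      have e1 : Real.exp (t + 1) ≤ (u (t + 1) : ℝ) := by
        rw [hu]; have := Nat.le_ceil (Real.exp ((t + 1 : ℕ) : ℝ)); push_cast at this ⊢; exact this
      have e2 : (u t : ℝ) < Real.exp t + 1 := by rw [hu]; exact Nat.ceil_lt_add_one (Real.exp_pos _).le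
      have e3 : Real.exp ((t : ℝ) + 1) = Real.exp t * Real.exp 1 := Real.exp_add _ _
      have e4 := Real.exp_one_gt_d9
      have e5 : 1 ≤ Real.exp (t : ℝ) := Real.one_le_exp (by positivity)
      nlinarith
    have := mul_le_mul_of_nonneg_right hcard (hg0 t)
    linarith
  refine summable_of_sum_range_le (c := 4 * ∑' q, φ q) (fun t => mul_nonneg (Real.exp_pos _).le (hg0 t)) fun N => ?_
  have h2 : ∀ N : ℕ, ∑ t ∈ Finset.range N, ∑ q ∈ Finset.Ico (u t) (u (t + 1)), φ q = ∑ q ∈ Finset.Ico (u 0) (u N), φ q := by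
    intro N
    induction N with
    | zero => simp
    | succ N ih =>
      rw [Finset.sum_range_succ, ih, Finset.sum_Ico_consecutive _ (hum (Nat.zero_le N)) (hum (Nat.le_succ N))]
  calc _ ≤ ∑ t ∈ Finset.range N, 4 * ∑ q ∈ Finset.Ico (u t) (u (t + 1)), φ q := Finset.sum_le_sum fun t _ => h1 t
    _ = 4 * ∑ q ∈ Finset.Ico (u 0) (u N), φ q := by rw [← Finset.mul_sum, h2]
    _ ≤ _ := by
      gcongr
      exact hs.sum_le_tsum _ fun q _ => hφ q

theorem sum_one (n : ℕ) (ψ : ℝ → ℝ) (hψmem : ∀ q : ℝ, 0 < q → ψ q ∈ Set.Ioo (0 : ℝ) 1)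
    (hψanti : AntitoneOn ψ (Set.Ioi 0)) (σ : ℝ) (hσ : 0 ≤ σ)
    (h : Summable (fun q : ℕ => ((q : ℝ) + 1) ^ n * (ψ ((q : ℝ) + 1) / ((q : ℝ) + 1)) ^ σ)) :
    Summable fun t : ℕ => Real.exp (t + 1) ^ (n + 1) * (ψ (Real.exp (t + 1)) / Real.exp (t + 1)) ^ σ := by
  have h1 : Summable (fun q : ℕ => (if q = 0 then 0 else (q : ℝ) ^ n * (ψ q / q) ^ σ)) := by
    rw [← summable_nat_add_iff 1]
    simpa using h
  have hp : ∀ q : ℝ, 0 < q → 0 ≤ q ^ n * (ψ q / q) ^ σ := fun q hq =>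
    mul_nonneg (by positivity) (Real.rpow_nonneg (div_nonneg (hψmem q hq).1.le hq.le) _)
  have h2 := sched _ (fun t => (Real.exp 1)⁻¹ ^ n * (Real.exp (t + 1) ^ n * (ψ (Real.exp (t + 1)) / Real.exp (t + 1)) ^ σ))
    ?_ h1 (fun t => mul_nonneg (by positivity) (hp _ (Real.exp_pos _))) ?_
  · have h3 := h2.mul_left (Real.exp 1 ^ n)
    refine h3.congr fun t => ?_
    rw [inv_pow, pow_succ]; field_simp
  · intro q
    split_ifs with hq
    · exact le_rfl
    · exact hp _ (by positivity)
  · intro t q h1 h2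
    have hq : (0 : ℝ) < q := (Real.exp_pos _).trans_le h1
    have hE := Real.exp_pos ((t : ℝ) + 1)
    have hq0 : q ≠ 0 := by rintro rfl; simp at hq
    rw [if_neg hq0, ← mul_assoc, ← mul_pow]
    have e3 : Real.exp ((t : ℝ) + 1) = Real.exp t * Real.exp 1 := Real.exp_add _ _
    have e4 : (Real.exp 1)⁻¹ * Real.exp (t + 1) = Real.exp t := by rw [e3]; field_simp
    rw [e4]
    have hψ1 := (hψmem _ hE).1.le
    have := hψanti (mem_Ioi.2 hq) (mem_Ioi.2 hE) h2
    have hψ2 := hψ1.trans this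
    gcongr

theorem freq_scale {n : ℕ} (θ y : Fin n → ℝ) (ψ : ℝ → ℝ) (hψmem : ∀ q : ℝ, 0 < q → ψ q ∈ Set.Ioo (0 : ℝ) 1)
    (hψanti : AntitoneOn ψ (Set.Ioi 0)) (hy : y ∈ SApprox n θ ψ) :
    ∃ᶠ t : ℕ in atTop, ∃ (p : Fin n → ℤ) (q : ℤ), Real.exp (t + 1) ≤ q ∧ (q : ℝ) ≤ 3 * Real.exp (t + 1) ∧
      ∀ j, |(q : ℝ) * y j - p j - θ j| ≤ ψ (Real.exp (t + 1)) := by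
  rw [frequently_atTop]
  intro t0
  obtain ⟨M, hM⟩ := exists_nat_ge (Real.exp (t0 + 1))
  have key : ∀ pq : (Fin n → ℤ) × ℕ, (0 < pq.2 ∧ ‖(fun i => y i - ((pq.1 i : ℝ) + θ i) / (pq.2 : ℝ) : Fin n → ℝ)‖ ≤
      ψ (pq.2 : ℝ) / (pq.2 : ℝ)) → ∀ j, |(pq.2 : ℝ) * y j - pq.1 j - θ j| ≤ ψ pq.2 := by
    rintro ⟨p, q⟩ ⟨hq, hle⟩ j
    simp only at hq hle ⊢
    have hq' : (0 : ℝ) < q := by exact_mod_cast hq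
    have h1 := (norm_le_pi_norm _ j).trans hle
    rw [Real.norm_eq_abs, le_div_iff₀ hq'] at h1
    refine le_trans (le_of_eq ?_) h1
    calc _ = |(y j - ((p j : ℝ) + θ j) / q) * q| := ?_
      _ = _ := by rw [abs_mul, abs_of_pos hq']
    congr 1; field_simp; ring
  obtain ⟨N, hN⟩ := exists_nat_ge (M * ‖y‖ + ‖θ‖ + 1)
  have hfin : ((Icc (fun _ => -(N : ℤ)) (fun _ => (N : ℤ)) : Set (Fin n → ℤ)) ×ˢ (Iic M : Set ℕ)).Finite :=
    (Set.finite_Icc _ _).prod (Set.finite_Iic _)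
  obtain ⟨pq, hpq, hnot⟩ := hy.exists_notMem_finset hfin.toFinset
  have hk := key pq hpq
  have hq' : (0 : ℝ) < pq.2 := by exact_mod_cast hpq.1
  have hqM : M < pq.2 := by
    by_contra hcon
    push Not at hcon
    apply hnot
    rw [Set.Finite.mem_toFinset, mem_prod]
    have hb : ∀ j, |pq.1 j| ≤ (N : ℤ) := by
      intro j
      have h1 : |(pq.1 j : ℝ)| ≤ N := by
        refine le_trans ?_ hN
        have h2 := (hk j).trans (hψmem _ hq').2.le
        have h3 : |(pq.2 : ℝ) * y j| ≤ M * ‖y‖ := by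
          rw [abs_mul, abs_of_pos hq']
          gcongr
          exact norm_le_pi_norm y j
        have h4 : |θ j| ≤ ‖θ‖ := norm_le_pi_norm θ j
        rw [abs_le] at h2 h3 h4 ⊢
        constructor <;> linarith
      exact_mod_cast h1
    exact ⟨⟨fun j => (abs_le.1 (hb j)).1, fun j => (abs_le.1 (hb j)).2⟩, hcon⟩
  have hlog : (t0 : ℝ) + 1 ≤ Real.log pq.2 := by
    rw [Real.le_log_iff_exp_le hq']
    exact hM.trans (by exact_mod_cast hqM.le)
  have hfl : t0 + 1 ≤ ⌊Real.log pq.2⌋₊ := Nat.le_floor (by push_cast; exact hlog)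
  obtain ⟨t, ht⟩ : ∃ t, ⌊Real.log pq.2⌋₊ = t + 1 := ⟨⌊Real.log pq.2⌋₊ - 1, by omega⟩
  have ha : (t : ℝ) + 1 ≤ Real.log pq.2 := by
    have := Nat.floor_le (show 0 ≤ Real.log pq.2 by linarith [(Nat.cast_nonneg t0 : (0 : ℝ) ≤ t0)])
    rw [ht] at this; push_cast at this; exact this
  have hb : Real.log pq.2 ≤ (t : ℝ) + 1 + 1 := by
    have := (Nat.lt_floor_add_one (Real.log pq.2)).le
    rw [ht] at this; push_cast at this; exact this
  have ha' : Real.exp (t + 1) ≤ pq.2 := (Real.le_log_iff_exp_le hq').1 ha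
  refine ⟨t, by omega, pq.1, pq.2, by exact_mod_cast ha', ?_, fun j => ?_⟩
  · rw [Int.cast_natCast]
    have h1 := (Real.log_le_iff_le_exp hq').1 hb
    rw [Real.exp_add _ 1] at h1
    have := Real.exp_one_lt_d9
    nlinarith [Real.exp_pos ((t : ℝ) + 1)]
  · rw [Int.cast_natCast]
    exact (hk j).trans (hψanti (mem_Ioi.2 (Real.exp_pos _)) (mem_Ioi.2 hq') ha')

theorem alg1 (d m n : ℕ) (hm : d + m = n) (C ε Q b s : ℝ) (hε : 0 < ε) (hQ : 0 < Q) (hb : 0 < b) :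
    C * (Q * √(ε * Q) ^ d * ε ^ m) * (b * (ε / Q)) ^ s / √(ε / Q) ^ d =
      C * b ^ s * (Q ^ (n + 1) * (ε / Q) ^ (s + (m : ℝ))) := by
  obtain ⟨u, hu⟩ : ∃ u, u = ε / Q := ⟨_, rfl⟩
  have hu0 : 0 < u := by rw [hu]; positivity
  have he : ε = u * Q := by rw [hu]; field_simp
  rw [← hu, he, show u * Q * Q = Q ^ 2 * u by ring, Real.sqrt_mul (by positivity), Real.sqrt_sq hQ.le,
    Real.mul_rpow hb.le hu0.le, Real.rpow_add hu0, Real.rpow_natCast, ← hm]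
  have : √u ^ d ≠ 0 := by positivity
  field_simp
  ring

theorem alg2 (d : ℕ) (u s : ℝ) (hu : 0 < u) : √u ^ s / √u ^ d = u ^ ((s - d) / 2) := by
  rw [Real.sqrt_eq_rpow, ← Real.rpow_natCast, ← Real.rpow_mul hu.le, ← Real.rpow_mul hu.le, ← Real.rpow_sub hu]
  congr 1; ring

theorem alg3 (n : ℕ) (hn : 2 ≤ n) (ε T : ℝ) (hε : 0 < ε) :
    Real.exp T * √(ε * Real.exp T) * ε ^ (n - 1) = ε ^ ((n : ℝ) - 1 / 2) * Real.exp (3 * T / 2) := by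
  rw [Real.sqrt_mul hε.le, Real.sqrt_eq_rpow, Real.sqrt_eq_rpow, ← Real.exp_mul, ← Real.rpow_natCast,
    Nat.cast_sub (by omega), show (n : ℝ) - 1 / 2 = 1 / 2 + ((n : ℝ) - 1) by ring, Real.rpow_add hε,
    show 3 * T / 2 = T + T * (1 / 2) by ring, Real.exp_add]
  push_cast
  ring

theorem local_null {d n m l : ℕ} (hn : 2 ≤ n) (hd : 1 ≤ d) (hm : d + m = n) (hl : 2 ≤ l)
    (θ : Fin n → ℝ) (f : (Fin d → ℝ) → Fin n → ℝ) (ψ : ℝ → ℝ)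
    (hψmem : ∀ q : ℝ, 0 < q → ψ q ∈ Set.Ioo (0 : ℝ) 1) (hψanti : AntitoneOn ψ (Set.Ioi 0))
    (s : ℝ) (hs : 0 < s)
    (hconv1 : Summable (fun q : ℕ =>
      ((q : ℝ) + 1) ^ n * (ψ ((q : ℝ) + 1) / ((q : ℝ) + 1)) ^ (s + (m : ℝ))))
    (hconv2 : Summable (fun t : ℕ =>
      (ψ (Real.exp ((t : ℝ) + 1)) / Real.exp ((t : ℝ) + 1)) ^ ((s - (d : ℝ)) / 2) *
        (ψ (Real.exp ((t : ℝ) + 1)) ^ ((n : ℝ) - 1 / 2) *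
          Real.exp (3 * ((t : ℝ) + 1) / 2)) ^
            (-(1 / ((d : ℝ) * (2 * (l : ℝ) - 1) * ((n : ℝ) + 1))))))
    (x0 : Fin d → ℝ) (hx0 : IsLNondegenerateAt l f x0)
    (hrk : LinearMap.rank (fderiv ℝ f x0).toLinearMap = (d : Cardinal)) :
    ∃ R > 0, μH[s] {x | x ∈ Metric.closedBall x0 R ∧ f x ∈ SApprox n θ ψ} = 0 := by
  obtain ⟨⟨V', hV', hfV'⟩, hsp⟩ := hx0
  obtain ⟨V, hVV', hV, hxV⟩ := mem_nhds_iff.1 hV'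
  have hfV := hfV'.mono hVV'
  have hFV := augF_contDiff f V hfV
  have h2l : (2 : WithTop ℕ∞) ≤ l := by exact_mod_cast hl
  have h1l : (1 : WithTop ℕ∞) ≤ l := by exact_mod_cast (by omega : 1 ≤ l)
  have hF2 : ContDiffAt ℝ 2 (augF f) x0 := (hFV.contDiffAt (hV.mem_nhds hxV)).of_le h2l
  have hf1 : ContDiffAt ℝ 1 f x0 := (hfV.contDiffAt (hV.mem_nhds hxV)).of_le h1l
  have hker := rank_inj _ hrk
  have hFd : DifferentiableAt ℝ (augF f) x0 := hF2.differentiableAt (by simp)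
  have hap := approxAt_of_nd (augF f) V hV l hl hFV x0 hxV (fun c hc => nd_aug f V hV hfV x0 hxV hsp c hc)
  have hdo : ∀ x j, fderiv ℝ (augF f) x (Pi.single j 1) none = 0 := by
    intro x j
    by_cases h : DifferentiableAt ℝ (augF f) x
    · exact (augF_deriv f x h _).1
    · rw [fderiv_zero_of_not_differentiableAt h]; rfl
  obtain ⟨ρ, hρ, c0, hc0, Cq, hCq, hqn⟩ := quant_nondiv (augF f) l hl hd x0 V hV hFV hxV hap none (fun _ => rfl) hdo
  obtain ⟨r, hr, B, hB, htay⟩ := taylor2 (augF f) x0 hF2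
  obtain ⟨Θ, hΘ⟩ : ∃ Θ : Option (Fin n) → ℝ, Θ = fun o => o.elim 0 θ := ⟨_, rfl⟩
  have hFc : ContinuousAt (fderiv ℝ (augF f)) x0 :=
    (hF2.fderiv_right (m := 1) (by norm_num)).continuousAt
  obtain ⟨r', hr', hr'r, c1, hc1, C, hC, hcount⟩ := generic_count (augF f) x0 Θ r B hr hB htay hFd.continuousAt
    hFc (uRow_li f x0 hFd hker)
  obtain ⟨rb, hrb, b, hb, hbil⟩ := bilip f x0 hf1 hker
  obtain ⟨a, ha⟩ : ∃ a : ℝ, a = ((d * (2 * l - 1) : ℕ) : ℝ)⁻¹ := ⟨_, rfl⟩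
  have ha0 : 0 < a := by
    have : 0 < d * (2 * l - 1) := Nat.mul_pos (by omega) (by omega)
    rw [ha]; positivity
  have hcard : Fintype.card (Option (Fin n)) = n + 1 := by simp
  rw [hcard] at hqn hcount
  obtain ⟨S, hS⟩ : ∃ S : ℝ → ℝ → ℝ → Set (Fin d → ℝ), S = fun δ K T => {x | x ∈ Metric.closedBall x0 ρ ∧
    ∃ v : Option (Fin n) → ℤ, v ≠ 0 ∧ |linF (augF f) (castR v) x| ≤ δ ∧
        (∀ i, |dlinF (augF f) (castR v) x i| ≤ K) ∧ ∀ p, |(v p : ℝ)| ≤ T} := ⟨_, rfl⟩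
  obtain ⟨C', hC', hng⟩ := nongen_vol n hn a c0 Cq ((volume (Metric.closedBall x0 ρ)).toReal + 1) c1 C ha0 hc0 hCq
    (by positivity) hc1 hC (fun δ K T => volume (S δ K T)) (by
      intro δ K T
      refine (measure_mono (t := Metric.closedBall x0 ρ) ?_).trans ?_
      · rw [hS]; exact fun x hx => hx.1
      · rw [← ENNReal.ofReal_toReal (measure_closedBall_lt_top (μ := volume) (x := x0) (r := ρ)).ne]
        exact ENNReal.ofReal_le_ofReal (by rw [ENNReal.toReal_ofReal ENNReal.toReal_nonneg]; linarith))
    (by rw [hS, ha]; exact hqn)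
  clear hqn
  obtain ⟨R, hR⟩ : ∃ R, R = min r' (min ρ rb) / 3 := ⟨_, rfl⟩
  have hR0 : 0 < R := by rw [hR]; have := lt_min hr' (lt_min hρ hrb); positivity
  have hR1 : 2 * R < r' := by have := min_le_left r' (min ρ rb); linarith
  have hR2 : 2 * R < ρ := by have := (min_le_right r' (min ρ rb)).trans (min_le_left _ _); linarith
  have hR3 : 2 * R < rb := by have := (min_le_right r' (min ρ rb)).trans (min_le_right _ _); linarith
  refine ⟨R, hR0, ?_⟩
  obtain ⟨Q, hQ⟩ : ∃ Q : ℕ → ℝ, Q = fun t : ℕ => Real.exp ((t : ℝ) + 1) := ⟨_, rfl⟩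
  obtain ⟨ε, hε⟩ : ∃ ε : ℕ → ℝ, ε = fun t => ψ (Q t) := ⟨_, rfl⟩
  have hQ0 : ∀ t, 0 < Q t := fun t => by rw [hQ]; exact Real.exp_pos _
  have hQ1 : ∀ t, 1 ≤ Q t := fun t => by rw [hQ]; exact Real.one_le_exp (by positivity)
  have hε0 : ∀ t, 0 < ε t := fun t => by rw [hε]; exact (hψmem _ (hQ0 t)).1
  have hε1 : ∀ t, ε t ≤ 1 := fun t => by rw [hε]; exact (hψmem _ (hQ0 t)).2.le
  have hu0 : Tendsto (fun t => ε t / Q t) atTop (𝓝 0) := by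
    have h1 : Tendsto (fun t => (Q t)⁻¹) atTop (𝓝 0) := by
      rw [hQ]
      exact (Real.tendsto_exp_atTop.comp (tendsto_atTop_add_const_right _ 1 tendsto_natCast_atTop_atTop)).inv_tendsto_atTop
    refine tendsto_of_tendsto_of_tendsto_of_le_of_le tendsto_const_nhds h1
      (fun t => (div_pos (hε0 t) (hQ0 t)).le) fun t => ?_
    show ε t / Q t ≤ (Q t)⁻¹
    rw [div_eq_mul_inv]
    exact mul_le_of_le_one_left (inv_pos.2 (hQ0 t)).le (hε1 t)
  have hsq0 : Tendsto (fun t => √(ε t / Q t)) atTop (𝓝 0) := by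
    simpa using hu0.sqrt
  have hD0 : Tendsto (fun t => 2 * b * (ε t / Q t)) atTop (𝓝 0) := by simpa using hu0.const_mul (2 * b)
  obtain ⟨t0, ht0⟩ := eventually_atTop.1 (hsq0.eventually (ge_mem_nhds hR0))
  obtain ⟨W, hW⟩ : ∃ W : ℕ → (Option (Fin n) → ℤ) → (Fin d → ℝ) → Prop, W = fun t v x => Q t ≤ v none ∧ (v none : ℝ) ≤ 3 * Q t ∧
    ∀ p, |(v none : ℝ) * augF f x p - v p - Θ p| ≤ ε t := ⟨_, rfl⟩
  obtain ⟨Gen, hGen⟩ : ∃ Gen : ℕ → Set (Fin d → ℝ), Gen = fun t => {x | ∀ v : Option (Fin n) → ℤ,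
    |linF (augF f) (castR v) x| ≤ 2 * (c1 / Q t) → (∀ i, |dlinF (augF f) (castR v) x i| ≤ 2 * (c1 / √(ε t * Q t))) →
        (∀ p, |(v p : ℝ)| ≤ C / ε t) → v = 0} := ⟨_, rfl⟩
  have hcov : ∀ t, ∃ c : ((Fin d → ℤ) × (Option (Fin n) → ℤ)) ⊕ (Fin d → ℤ) → Set (Fin d → ℝ), t ≥ t0 →
      {x | x ∈ Metric.closedBall x0 R ∧ ∃ v, W t v x} ⊆ ⋃ i, c i ∧
      (∀ i, Metric.ediam (c i) ≤ ENNReal.ofReal (max (√(ε t / Q t)) (2 * b * (ε t / Q t)))) ∧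
      ∑' i, Metric.ediam (c i) ^ s ≤
        ENNReal.ofReal (C * (Q t * √(ε t * Q t) ^ d * ε t ^ m) * (2 * b * (ε t / Q t)) ^ s / √(ε t / Q t) ^ d) *
          volume (Metric.closedBall x0 (2 * R)) +
        ENNReal.ofReal (√(ε t / Q t) ^ s / √(ε t / Q t) ^ d) * volume (Metric.closedBall x0 (2 * R) \ Gen t) := by
    intro t
    by_cases htt : t ≥ t0
    swap
    · exact ⟨fun _ => ∅, fun h => absurd h htt⟩
    have e0 := hε0 t
    have q0 := hQ0 t
    obtain ⟨c, hc⟩ := cover_lem (W t) (Gen t) x0 R (√(ε t / Q t)) (2 * b * (ε t / Q t)) s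
      (C * (Q t * √(ε t * Q t) ^ d * ε t ^ m)) (by positivity) (ht0 t htt) (by positivity) hs (by positivity)
      (by
        intro x hx hxR F hF
        rw [hGen] at hx
        have := hcount x (Metric.closedBall_subset_ball hR1 hxR) (ε t) (Q t) e0 (hε1 t) (hQ1 t) hx F (by
          intro v hv
          obtain ⟨x1, hx1, hxx, hw⟩ := hF v hv
          rw [hW] at hw
          refine ⟨v none, x1, ?_, Metric.closedBall_subset_ball (by linarith) hx1, hxx, hw.2.2⟩
          rw [abs_of_nonneg (q0.le.trans hw.1)]; exact hw.2.1)
        rwa [show n + 1 - (d + 1) = m by omega] at this)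
      (by
        intro v x hx y hy hwx hwy
        rw [hW] at hwx hwy
        have hvn : 0 < (v none : ℝ) := q0.trans_le hwx.1
        refine (hbil x (Metric.closedBall_subset_ball (by linarith) hx) y (Metric.closedBall_subset_ball (by linarith) hy)).trans ?_
        rw [show 2 * b * (ε t / Q t) = b * (2 * ε t / Q t) by ring]
        gcongr
        rw [pi_norm_le_iff_of_nonneg (by positivity)]
        intro j
        have h1 := hwx.2.2 (some j)
        have h2 := hwy.2.2 (some j)
        simp only [augF, Option.elim_some] at h1 h2
        rw [Pi.sub_apply, Real.norm_eq_abs, le_div_iff₀ q0]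
        have h3 : |f x j - f y j| * v none ≤ 2 * ε t := by
          rw [← abs_of_pos hvn, ← abs_mul]
          rw [abs_le] at h1 h2 ⊢
          constructor <;> linarith
        exact (mul_le_mul_of_nonneg_left hwx.1 (abs_nonneg _)).trans h3)
    exact ⟨c, fun _ => hc⟩
  choose c hc using hcov
  have hbad : ∀ t, volume (Metric.closedBall x0 (2 * R) \ Gen t) ≤
      ENNReal.ofReal (C' * (Q t * √(ε t * Q t) * ε t ^ (n - 1)) ^ (-(a / (n + 1)))) := by
    intro t
    refine le_trans (measure_mono ?_) (hng (ε t) (Q t) (hε0 t) (hε1 t) (hQ1 t))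
    rintro x ⟨hx, hxG⟩
    rw [hGen] at hxG
    simp only [mem_ofPred_eq, not_forall] at hxG
    obtain ⟨v, h1, h2, h3, h4⟩ := hxG
    rw [hS]
    exact ⟨Metric.closedBall_subset_closedBall hR2.le hx, v, h4, h1, h2, h3⟩
  have hs1 := sum_one n ψ hψmem hψanti (s + m) (by positivity) hconv1
  have hfin := haus_limsup s (fun t => {x | x ∈ Metric.closedBall x0 R ∧ ∃ v, W t v x}) c
    (fun t => ENNReal.ofReal (max (√(ε t / Q t)) (2 * b * (ε t / Q t))))
    (fun t => ENNReal.ofReal (C * (2 * b) ^ s * (Q t ^ (n + 1) * (ε t / Q t) ^ (s + (m : ℝ)))) *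
          volume (Metric.closedBall x0 (2 * R)) +
        ENNReal.ofReal (C' * ((ε t / Q t) ^ ((s - (d : ℝ)) / 2) * (ε t ^ ((n : ℝ) - 1 / 2) * Real.exp (3 * ((t : ℝ) + 1) / 2)) ^
            (-(1 / ((d : ℝ) * (2 * (l : ℝ) - 1) * ((n : ℝ) + 1)))))))
    t0 (fun t ht => (hc t ht).1) (fun t ht => (hc t ht).2.1) ?_ ?_ ?_
  · refine measure_mono_null ?_ hfin
    rintro x ⟨hx, hfx⟩
    refine (freq_scale θ (f x) ψ hψmem hψanti hfx).mono ?_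
    rintro t ⟨p, q, h1, h2, h3⟩
    refine ⟨hx, fun o => o.elim q p, ?_⟩
    rw [hW, hε, hQ, hΘ]
    refine ⟨h1, h2, ?_⟩
    rintro (_ | j)
    · simpa [augF] using (hψmem _ (Real.exp_pos ((t : ℝ) + 1))).1.le
    · exact h3 j
  · have := ENNReal.tendsto_ofReal (hsq0.max hD0)
    simpa using this
  · intro t ht
    refine (hc t ht).2.2.trans ?_
    rw [alg1 d m n hm C (ε t) (Q t) (2 * b) s (hε0 t) (hQ0 t) (by positivity)]
    refine add_le_add le_rfl ?_
    refine (mul_le_mul_right (hbad t) _).trans ?_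
    have hu := div_pos (hε0 t) (hQ0 t)
    rw [alg2 d _ s hu, ← ENNReal.ofReal_mul (by positivity)]
    refine ENNReal.ofReal_le_ofReal (le_of_eq ?_)
    have h3 := alg3 n hn (ε t) ((t : ℝ) + 1) (hε0 t)
    have hQt : Real.exp ((t : ℝ) + 1) = Q t := by rw [hQ]
    rw [hQt] at h3
    have hexp : a / (n + 1) = 1 / ((d : ℝ) * (2 * (l : ℝ) - 1) * ((n : ℝ) + 1)) := by
      rw [ha, Nat.cast_mul, Nat.cast_sub (by omega), inv_eq_one_div, div_div]; push_cast; rfl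
    rw [h3, hexp]; ring
  · rw [ENNReal.tsum_add, ENNReal.tsum_mul_right]
    refine ENNReal.add_ne_top.2 ⟨ENNReal.mul_ne_top ?_ (measure_closedBall_lt_top).ne, ?_⟩
    · have := hs1.mul_left (C * (2 * b) ^ s)
      rw [hε, hQ]
      exact this.tsum_ofReal_ne_top
    · have := hconv2.mul_left C'
      rw [hε, hQ]
      exact this.tsum_ofReal_ne_top

end Helpers

/-- **Hausdorff measure convergence theorem** (Theorem 2.3). -/
theorem hausdorff_convergence
    {d n m l : ℕ} (hn : 2 ≤ n) (hd : 1 ≤ d) (hdn : d < n) (hm : d + m = n)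
    (θ : Fin n → ℝ) (U : Set (Fin d → ℝ)) (hU : IsOpen U)
    (f : (Fin d → ℝ) → Fin n → ℝ)
    (hns : IsNonsingularOn f U) (hnd : IsNondegenerateIn f U)
    (ψ : ℝ → ℝ)
    (hψmem : ∀ q : ℝ, 0 < q → ψ q ∈ Set.Ioo (0 : ℝ) 1)
    (hψanti : AntitoneOn ψ (Set.Ioi 0))
    (s : ℝ) (hs : 0 < s)
    (hdeg : μH[s] {x | x ∈ U ∧ ¬ IsLNondegenerateAt l f x} = 0)
    (hconv1 : Summable (fun q : ℕ =>
      ((q : ℝ) + 1) ^ n * (ψ ((q : ℝ) + 1) / ((q : ℝ) + 1)) ^ (s + (m : ℝ))))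
    (hconv2 : Summable (fun t : ℕ =>
      (ψ (Real.exp ((t : ℝ) + 1)) / Real.exp ((t : ℝ) + 1)) ^ ((s - (d : ℝ)) / 2) *
        (ψ (Real.exp ((t : ℝ) + 1)) ^ ((n : ℝ) - 1 / 2) *
          Real.exp (3 * ((t : ℝ) + 1) / 2)) ^
            (-(1 / ((d : ℝ) * (2 * (l : ℝ) - 1) * ((n : ℝ) + 1)))))) :
    μH[s] (U ∩ f ⁻¹' SApprox n θ ψ) = 0 := by
  classical
  by_cases hl : l < 2
  · refine measure_mono_null ?_ hdeg
    rintro x ⟨hx, -⟩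
    exact ⟨hx, no_nd_one hl hdn f x⟩
  push Not at hl
  have h1 : μH[s] {x | x ∈ U ∧ IsLNondegenerateAt l f x ∧ f x ∈ SApprox n θ ψ} = 0 := by
    apply measure_null_of_locally_null
    rintro x0 ⟨hxU, hxN, -⟩
    obtain ⟨R, hR, h0⟩ := local_null hn hd hm hl θ f ψ hψmem hψanti s hs hconv1 hconv2 x0 hxN (hns x0 hxU)
    refine ⟨_, Filter.inter_mem self_mem_nhdsWithin (mem_nhdsWithin_of_mem_nhds (Metric.closedBall_mem_nhds x0 hR)),
      measure_mono_null ?_ h0⟩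
    rintro x ⟨⟨-, -, hx⟩, hxR⟩
    exact ⟨hxR, hx⟩
  refine measure_mono_null ?_ (measure_union_null hdeg h1)
  rintro x ⟨hxU, hx⟩
  by_cases h : IsLNondegenerateAt l f x
  · exact Or.inr ⟨hxU, h, hx⟩
  · exact Or.inl ⟨hxU, h⟩
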